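/- arXiv:math/9712213 — 5 statements merged into one kernel-verified Lean document; each statement's English description precedes it below -/
import Mathlib

section
/- For n ≥ 1, the number of regions of the Linial arrangement L_{n-1} equals the number of alternating trees on the vertex set {0, 1, ..., n}, where a tree (connected acyclic simple graph) on {0,1,...,n} is alternating if there are no vertices i < j < k such that both {i,j} and {j,k} are edges of the tree. -/
/-- The number of regions of the complement of an arrangement. -/
noncomputable def numRegions {V : Type*} [TopologicalSpace V] (s : Set V) : ℕ :=
  Nat.card (ConnectedComponents s)

/-- The sign pattern of a point `x` with respect to the Linial arrangement. -/
def linialSign {V : Type*} [LinearOrder V] (x : V → ℝ) : V → V → Prop :=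
  fun i j => i < j ∧ 1 < x i - x j

/-- The sign patterns of the points lying on no hyperplane of the Linial arrangement. -/
def linialSigns (V : Type*) [LinearOrder V] : Set (V → V → Prop) :=
  {R | ∃ x : V → ℝ, (∀ i j, i < j → x i - x j ≠ 1) ∧ linialSign x = R}

theorem card_linialSigns_congr {V W : Type*} [LinearOrder V] [LinearOrder W] (e : V ≃o W) :
    Nat.card (linialSigns V) = Nat.card (linialSigns W) := by
  refine Nat.card_congr
    { toFun R := ⟨fun i j => R.1 (e.symm i) (e.symm j), ?_⟩
      invFun R := ⟨fun i j => R.1 (e i) (e j), ?_⟩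
      left_inv R := by simp
      right_inv R := by simp }
  · obtain ⟨R, x, hx, rfl⟩ := R
    refine ⟨fun i => x (e.symm i), fun i j hij => hx _ _ (e.symm.lt_iff_lt.2 hij), ?_⟩
    funext i j
    simp [linialSign]
  · obtain ⟨R, x, hx, rfl⟩ := R
    refine ⟨fun i => x (e i), fun i j hij => hx _ _ (e.lt_iff_lt.2 hij), ?_⟩
    funext i j
    simp [linialSign]

theorem numRegions_linial (n : ℕ) :
    numRegions {x : Fin n → ℝ | (∑ i, x i) = 0 ∧ ∀ i j : Fin n, i < j → x i - x j ≠ 1} =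
      Nat.card (linialSigns (Fin n)) := by
  set s := {x : Fin n → ℝ | (∑ i, x i) = 0 ∧ ∀ i j : Fin n, i < j → x i - x j ≠ 1} with hs
  let _ : TopologicalSpace (linialSigns (Fin n)) := ⊥
  have : DiscreteTopology (linialSigns (Fin n)) := ⟨rfl⟩
  let f : s → linialSigns (Fin n) := fun x => ⟨linialSign x.1, x.1, x.2.2, rfl⟩
  have hf : Continuous f := by
    refine (IsLocallyConstant.iff_exists_open f).2 (fun x => ?_) |>.continuous
    refine ⟨⋂ i : Fin n, ⋂ j : Fin n, {y : s | i < j → (1 < y.1 i - y.1 j ↔ 1 < x.1 i - x.1 j)},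
      ?_, by simp, ?_⟩
    · refine isOpen_iInter_of_finite fun i => isOpen_iInter_of_finite fun j => ?_
      by_cases hij : i < j
      · have hc : Continuous fun y : s => y.1 i - y.1 j :=
          ((continuous_apply i).comp continuous_subtype_val).sub
            ((continuous_apply j).comp continuous_subtype_val)
        by_cases h1 : 1 < x.1 i - x.1 j
        · simpa [hij, h1] using isOpen_lt continuous_const hc
        · have : {y : s | i < j → (1 < y.1 i - y.1 j ↔ 1 < x.1 i - x.1 j)} =
              {y : s | y.1 i - y.1 j < 1} := by
            ext y
            have := y.2.2 i j hij
            simp only [Set.mem_ofPred_eq, hij, h1, iff_false, not_lt, forall_const]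
            exact ⟨fun h => lt_of_le_of_ne h this, le_of_lt⟩
          rw [this]
          exact isOpen_lt hc continuous_const
      · simp [hij]
    · intro y hy
      simp only [Set.mem_iInter, Set.mem_ofPred_eq] at hy
      apply Subtype.ext
      funext i j
      simp only [f, linialSign, eq_iff_iff]
      exact and_congr_right (hy i j)
  refine Nat.card_eq_of_bijective hf.connectedComponentsLift ⟨?_, ?_⟩
  · intro a b hab
    obtain ⟨x, rfl⟩ := ConnectedComponents.surjective_coe a
    obtain ⟨y, rfl⟩ := ConnectedComponents.surjective_coe b
    rw [hf.connectedComponentsLift_apply_coe, hf.connectedComponentsLift_apply_coe] at hab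
    have hxy : ∀ i j, i < j → (1 < x.1 i - x.1 j ↔ 1 < y.1 i - y.1 j) := fun i j hij => by
      have := congrFun (congrFun (congrArg Subtype.val hab) i) j
      simpa [f, linialSign, hij] using this
    rw [ConnectedComponents.coe_eq_coe']
    have hseg : segment ℝ x.1 y.1 ⊆ s := by
      rintro z ⟨a, b, ha, hb, hab, rfl⟩
      refine ⟨?_, fun i j hij => ?_⟩
      · simp [Finset.sum_add_distrib, ← Finset.mul_sum, x.2.1, y.2.1]
      · have h1 := x.2.2 i j hij
        have h2 := y.2.2 i j hij
        have h3 := hxy i j hij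
        simp only [Pi.add_apply, Pi.smul_apply, smul_eq_mul]
        have hb' : b = 1 - a := by linarith
        subst hb'
        rcases lt_or_gt_of_ne h1 with h | h
        · have h' : y.1 i - y.1 j < 1 := lt_of_le_of_ne (not_lt.1 (fun h' => by
            have := h3.2 h'; linarith)) h2
          intro he
          rcases ha.eq_or_lt with rfl | ha
          · linarith
          · nlinarith
        · have h' := h3.1 h
          intro he
          rcases ha.eq_or_lt with rfl | ha
          · linarith
          · nlinarith
    have hpre : IsPreconnected ((↑) ⁻¹' segment ℝ x.1 y.1 : Set s) := by
      have h := (convex_segment (𝕜 := ℝ) x.1 y.1).isPreconnected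
      rw [← Topology.IsInducing.subtypeVal.isPreconnected_image, Subtype.image_preimage_coe,
        Set.inter_eq_right.2 hseg]
      exact h
    exact hpre.subset_connectedComponent (right_mem_segment ℝ x.1 y.1)
      (left_mem_segment ℝ x.1 y.1)
  · rintro ⟨R, x, hx, rfl⟩
    let c : ℝ := (∑ i, x i) / n
    refine ⟨((⟨fun i => x i - c, ?_, fun i j hij => by simpa using hx i j hij⟩ : s) :
      ConnectedComponents s), ?_⟩
    · rcases Nat.eq_zero_or_pos n with rfl | hn
      · simp
      · simp only [Finset.sum_sub_distrib, Finset.sum_const, Finset.card_univ, Fintype.card_fin,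
          nsmul_eq_mul, c]
        field_simp
        ring
    · rw [hf.connectedComponentsLift_apply_coe]
      apply Subtype.ext
      funext i j
      simp [f, linialSign]

/-- The graph joining `i < j` when `v i = v j + 1`. -/
def layerGraph {V : Type*} [LinearOrder V] (v : V → ℕ) : SimpleGraph V where
  Adj i j := (i < j ∧ v i = v j + 1) ∨ (j < i ∧ v j = v i + 1)
  symm := ⟨fun _ _ h => h.symm⟩
  loopless := ⟨fun i h => by simp at h⟩

/-- The acyclic orientations of the subgraph of `G` induced on `S` all of whose sinks lie in `Z`.
An orientation is the set of its arcs, and is acyclic when its arcs decrease some real-valued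
function separating adjacent vertices. -/
def sinkOrientations {V : Type*} (G : SimpleGraph V) (Z S : Set V) : Set (V → V → Prop) :=
  {O | ∃ y : V → ℝ, (∀ i ∈ S, ∀ j ∈ S, G.Adj i j → y i ≠ y j) ∧
    (∀ i ∈ S, i ∈ Z ∨ ∃ j ∈ S, G.Adj i j ∧ y j < y i) ∧
    (fun i j => i ∈ S ∧ j ∈ S ∧ G.Adj i j ∧ y j < y i) = O}

theorem layer_le_of_sink {V : Type*} [LinearOrder V] [Finite V] {v v' : V → ℕ} {y : V → ℝ}
    {R : V → V → Prop} (hsink : ∀ i, v i = 0 ∨ ∃ j, (layerGraph v).Adj i j ∧ y j < y i)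
    (hR : ∀ i j, i < j → v i = v j + 1 → (R i j ↔ y j < y i))
    (h1 : ∀ i j, i < j → R i j → v' j + 1 ≤ v' i) (h2 : ∀ i j, i < j → ¬ R i j → v' i ≤ v' j + 1) :
    v ≤ v' := by
  by_contra hcon
  obtain ⟨i₀, hi₀⟩ : ∃ i, v' i < v i := by simpa [Pi.le_def] using hcon
  obtain ⟨i, hi, hmin⟩ := Set.exists_min_image {i | v' i < v i} y (Set.toFinite _) ⟨i₀, hi₀⟩
  simp only [Set.mem_ofPred_eq] at hi hmin
  rcases hsink i with h0 | ⟨j, hadj, hy⟩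
  · omega
  · have hj : v j ≤ v' j := not_lt.1 fun h => (hmin j h).not_gt hy
    rcases hadj with ⟨hij, hv⟩ | ⟨hij, hv⟩
    · have := h1 i j hij ((hR i j hij hv).2 hy)
      omega
    · have := h2 j i hij (fun h => ((hR j i hij hv).1 h).not_gt hy)
      omega

theorem layer_lt_card_of_sink {V : Type*} [LinearOrder V] [Fintype V] {v : V → ℕ} {y : V → ℝ}
    (hsink : ∀ i, v i = 0 ∨ ∃ j, (layerGraph v).Adj i j ∧ y j < y i) (i : V) :
    v i < Fintype.card V := by
  have key : ∀ i, v i ≤ (Finset.univ.filter fun k => y k < y i).card := by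
    by_contra! hcon
    obtain ⟨i₀, hi₀⟩ := hcon
    obtain ⟨i, hi, hmin⟩ := Set.exists_min_image
      {i | (Finset.univ.filter fun k => y k < y i).card < v i} y (Set.toFinite _) ⟨i₀, hi₀⟩
    simp only [Set.mem_ofPred_eq] at hi hmin
    rcases hsink i with h0 | ⟨j, hadj, hy⟩
    · omega
    · have hj := not_lt.1 fun h => (hmin j h).not_gt hy
      have hlt : (Finset.univ.filter fun k => y k < y j).card <
          (Finset.univ.filter fun k => y k < y i).card := by
        refine Finset.card_lt_card (Finset.ssubset_iff_of_subset ?_ |>.2 ⟨j, by simpa using hy,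
          by simp⟩)
        intro k hk
        simp only [Finset.mem_filter, Finset.mem_univ, true_and] at hk ⊢
        exact hk.trans hy
      rcases hadj with ⟨-, hv⟩ | ⟨-, hv⟩ <;> omega
  refine (key i).trans_lt (Finset.card_lt_card ?_)
  exact Finset.ssubset_iff_of_subset (Finset.subset_univ _) |>.2 ⟨i, by simp, by simp⟩

/-- Every sign pattern of the Linial arrangement is that of an infinitesimal perturbation of
a unique least layering. -/
theorem exists_layer_of_mem_linialSigns {V : Type*} [LinearOrder V] [Fintype V]
    {R : V → V → Prop} (hR : R ∈ linialSigns V) :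
    ∃ (v : V → ℕ) (y : V → ℝ), (∀ i j, (layerGraph v).Adj i j → y i ≠ y j) ∧
      (∀ i, v i = 0 ∨ ∃ j, (layerGraph v).Adj i j ∧ y j < y i) ∧
      ∀ i j, R i j ↔ i < j ∧ (v j + 1 < v i ∨ v i = v j + 1 ∧ y j < y i) := by
  obtain ⟨x₀, hx₀, rfl⟩ := hR
  obtain ⟨c, hc⟩ : ∃ c : ℝ, ∀ i, -c ≤ x₀ i := by
    obtain ⟨c, hc⟩ := (Set.finite_range x₀).bddBelow
    exact ⟨-c, fun i => by simpa using hc ⟨i, rfl⟩⟩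
  obtain ⟨x, hx0, hx, hxR⟩ : ∃ x : V → ℝ, (∀ i, 0 ≤ x i) ∧ (∀ i j, i < j → x i - x j ≠ 1) ∧
      linialSign x₀ = linialSign x :=
    ⟨fun i => x₀ i + c, fun i => by linarith [hc i], fun i j h => by simpa using hx₀ i j h, by
      funext i j; simp [linialSign]⟩
  rw [hxR]
  let A : Set (V → ℕ) := {v | ∀ i j, i < j →
    (1 < x i - x j → v j + 1 ≤ v i) ∧ (x i - x j < 1 → v i ≤ v j + 1)}
  have hA : A.Nonempty := by
    refine ⟨fun i => ⌊x i⌋₊, fun i j hij => ⟨fun h => ?_, fun h => ?_⟩⟩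
    · rw [← Nat.floor_add_one (hx0 j)]
      exact Nat.floor_le_floor (by linarith)
    · rw [← Nat.floor_add_one (hx0 j)]
      exact Nat.floor_le_floor (by linarith)
  obtain ⟨v, hv, hmin⟩ := WellFounded.has_min (measure fun v : V → ℕ => ∑ i, v i).wf A hA
  refine ⟨v, fun i => x i - v i, ?_, ?_, ?_⟩
  · rintro i j (⟨hij, h⟩ | ⟨hij, h⟩) he
    · have h' : (v i : ℝ) = v j + 1 := by exact_mod_cast h
      exact hx i j hij (by linarith)
    · have h' : (v j : ℝ) = v i + 1 := by exact_mod_cast h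
      exact hx j i hij (by linarith)
  · intro i
    by_contra! hcon
    obtain ⟨hpos, hcon⟩ := hcon
    refine hmin (Function.update v i (v i - 1)) ?_ ?_
    · intro a b hab
      obtain ⟨hv1, hv2⟩ := hv a b hab
      have hne := hx a b hab
      rcases eq_or_ne a i with rfl | ha
      · have hb : b ≠ a := hab.ne'
        simp only [Function.update_self, Function.update_of_ne hb]
        refine ⟨fun h => ?_, fun h => by have := hv2 h; omega⟩
        have h1 := hv1 h
        by_contra hlt
        have hvv : v a = v b + 1 := by omega
        have h' : (v a : ℝ) = v b + 1 := by exact_mod_cast hvv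
        have := hcon b (Or.inl ⟨hab, hvv⟩)
        linarith
      · rcases eq_or_ne b i with rfl | hb
        · simp only [Function.update_self, Function.update_of_ne ha]
          refine ⟨fun h => by have := hv1 h; omega, fun h => ?_⟩
          have h1 := hv2 h
          by_contra hlt
          have hvv : v a = v b + 1 := by omega
          have h' : (v a : ℝ) = v b + 1 := by exact_mod_cast hvv
          have := hcon a (Or.inr ⟨hab, hvv⟩)
          linarith
        · simpa only [Function.update_of_ne ha, Function.update_of_ne hb] using ⟨hv1, hv2⟩
    · change ∑ j, Function.update v i (v i - 1) j < ∑ j, v j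
      refine Finset.sum_lt_sum (fun j _ => ?_) ⟨i, Finset.mem_univ _, by simp; omega⟩
      rcases eq_or_ne j i with rfl | h
      · simp
      · simp [h]
  · intro i j
    refine and_congr_right fun hij => ?_
    obtain ⟨hv1, hv2⟩ := hv i j hij
    have hne := hx i j hij
    constructor
    · intro h
      rcases (hv1 h).eq_or_lt with h1 | h1
      · have h' : (v i : ℝ) = v j + 1 := by exact_mod_cast h1.symm
        exact Or.inr ⟨h1.symm, by linarith⟩
      · exact Or.inl h1
    · rintro (h | ⟨h, h'⟩)
      · by_contra hcon
        have := hv2 (lt_of_le_of_ne (not_lt.1 hcon) hne)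
        omega
      · have h' : (v i : ℝ) = v j + 1 := by exact_mod_cast h
        linarith

theorem card_linialSigns_eq_sum {V : Type*} [LinearOrder V] [Fintype V] {q : ℕ}
    (hq : Fintype.card V ≤ q) :
    Nat.card (linialSigns V) = ∑ v : V → Fin q,
      Nat.card (sinkOrientations (layerGraph fun i => (v i : ℕ)) {i | (v i : ℕ) = 0} Set.univ) := by
  rw [← Nat.card_sigma]
  symm
  let r : (v : V → Fin q) → (V → V → Prop) → V → V → Prop := fun v O i j =>
    i < j ∧ ((v j : ℕ) + 1 < v i ∨ (v i : ℕ) = v j + 1 ∧ O i j)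
  have hr : ∀ (v : V → Fin q) (y : V → ℝ),
      (∀ i j, (layerGraph fun i => (v i : ℕ)).Adj i j → y i ≠ y j) →
      r v (fun i j => i ∈ Set.univ ∧ j ∈ Set.univ ∧
        (layerGraph fun i => (v i : ℕ)).Adj i j ∧ y j < y i) ∈ linialSigns V := by
    intro v y hy
    have hlt : ∀ a b, Real.arctan a / 4 - Real.arctan b / 4 < 1 := fun a b => by
      linarith [Real.arctan_lt_pi_div_two a, Real.neg_pi_div_two_lt_arctan b, Real.pi_lt_four]
    have hmono : ∀ a b, Real.arctan a / 4 < Real.arctan b / 4 ↔ a < b := fun a b => by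
      rw [← Real.arctan_strictMono.lt_iff_lt (a := a)]
      constructor <;> intro h <;> linarith
    refine ⟨fun i => (v i : ℕ) + Real.arctan (y i) / 4, ?_, ?_⟩
    · intro i j hij he
      have h1 := hlt (y i) (y j)
      have h2 := hlt (y j) (y i)
      have h3 : ((v i : ℕ) : ℝ) < (v j : ℕ) + 2 := by linarith
      have h4 : ((v j : ℕ) : ℝ) < (v i : ℕ) := by linarith
      norm_cast at h3 h4
      have h5 : (v i : ℕ) = v j + 1 := by omega
      have h6 : ((v i : ℕ) : ℝ) = (v j : ℕ) + 1 := by exact_mod_cast h5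
      refine hy i j (Or.inl ⟨hij, h5⟩) (Real.arctan_injective ?_)
      linarith
    · funext i j
      simp only [linialSign, r, eq_iff_iff]
      refine and_congr_right fun hij => ?_
      have h1 := hlt (y i) (y j)
      have h2 := hlt (y j) (y i)
      constructor
      · intro h
        have h4 : ((v j : ℕ) : ℝ) < (v i : ℕ) := by linarith
        norm_cast at h4
        rcases (Nat.succ_le_of_lt h4).eq_or_lt with h5 | h5
        · have h6 : ((v i : ℕ) : ℝ) = (v j : ℕ) + 1 := by exact_mod_cast h5.symm
          exact Or.inr ⟨h5.symm, trivial, trivial, Or.inl ⟨hij, h5.symm⟩,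
            (hmono _ _).1 (by linarith)⟩
        · exact Or.inl h5
      · rintro (h | ⟨h, -, -, -, h'⟩)
        · have h6 : ((v j : ℕ) : ℝ) + 2 ≤ (v i : ℕ) := by exact_mod_cast h
          linarith
        · have h6 : ((v i : ℕ) : ℝ) = (v j : ℕ) + 1 := by exact_mod_cast h
          have := (hmono _ _).2 h'
          linarith
  refine Nat.card_eq_of_bijective (fun p => ⟨r p.1 p.2.1, ?_⟩) ⟨?_, ?_⟩
  · obtain ⟨v, O, y, hy, -, rfl⟩ := p
    exact hr v y fun i j => hy i trivial j trivial
  · have hle : ∀ (v v' : V → Fin q) (y : V → ℝ) (O' : V → V → Prop),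
        (∀ i, (v i : ℕ) = 0 ∨ ∃ j, (layerGraph fun i => (v i : ℕ)).Adj i j ∧ y j < y i) →
        r v (fun i j => i ∈ Set.univ ∧ j ∈ Set.univ ∧
          (layerGraph fun i => (v i : ℕ)).Adj i j ∧ y j < y i) = r v' O' → v ≤ v' := by
      intro v v' y O' hs he
      refine layer_le_of_sink (v := fun i => (v i : ℕ)) (v' := fun i => (v' i : ℕ))
        (R := r v' O') hs ?_ ?_ ?_
      · intro i j hij hv
        rw [← he]
        simp only [r, hij, hv, layerGraph]
        simp
      · rintro i j hij ⟨-, h | h⟩ <;> omega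
      · intro i j hij h
        by_contra hlt
        exact h ⟨hij, Or.inl (not_le.1 hlt)⟩
    rintro ⟨v, O, y, hy, hs, rfl⟩ ⟨v', O', y', hy', hs', rfl⟩ h
    have he := congrArg Subtype.val h
    simp only at he
    have hvv : v = v' := le_antisymm
      (hle v v' y _ (fun i => by simpa using hs i trivial) he)
      (hle v' v y' _ (fun i => by simpa using hs' i trivial) he.symm)
    subst hvv
    have hlt : ∀ i j, i < j → (v i : ℕ) = v j + 1 → (y j < y i ↔ y' j < y' i) := by
      intro i j hij hv
      have := congrFun (congrFun he i) j
      simp only [r, hij, hv, layerGraph] at this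
      simpa using this
    congr 2
    funext i j
    simp only [Set.mem_univ, true_and, eq_iff_iff]
    refine and_congr_right fun hadj => ?_
    have h1 := hy i trivial j trivial hadj
    have h2 := hy' i trivial j trivial hadj
    rcases hadj with ⟨hij, hv⟩ | ⟨hij, hv⟩
    · exact hlt i j hij hv
    · have h3 := hlt j i hij hv
      rw [lt_iff_not_ge, lt_iff_not_ge, h1.le_iff_lt, h2.le_iff_lt, h3]
  · rintro ⟨R, hR⟩
    obtain ⟨v, y, hy, hs, hRv⟩ := exists_layer_of_mem_linialSigns hR
    have hvq : ∀ i, v i < q := fun i => (layer_lt_card_of_sink hs i).trans_le hq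
    refine ⟨⟨fun i => ⟨v i, hvq i⟩, _, y, fun i _ j _ => hy i j,
      fun i _ => by simpa using hs i, rfl⟩, ?_⟩
    apply Subtype.ext
    funext i j
    simp only [r, eq_iff_iff, hRv]
    refine and_congr_right fun hij => or_congr_right (and_congr_right fun hv => ?_)
    simp [layerGraph, hij, hv]

section Toggle

variable {V : Type*} [DecidableEq V]

/-- The vertices that can be moved between the oriented part `S` and its independent complement. -/
def toggleable (G : SimpleGraph V) (Z : Set V) (p : Finset V × (V → V → Prop)) : Set V :=
  {a | (a ∈ p.1 ∧ (∀ j, ¬ p.2 j a) ∧ ∀ j, j ∉ p.1 → ¬ G.Adj a j) ∨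
    (a ∉ p.1 ∧ (a ∈ Z ∨ ∃ j ∈ p.1, G.Adj a j))}

/-- Move the vertex `a` out of the oriented part, or into it as a source. -/
def toggle (G : SimpleGraph V) (a : V) (p : Finset V × (V → V → Prop)) :
    Finset V × (V → V → Prop) :=
  if a ∈ p.1 then (p.1.erase a, fun i j => p.2 i j ∧ i ≠ a ∧ j ≠ a)
  else (insert a p.1, fun i j => p.2 i j ∨ (i = a ∧ j ∈ p.1 ∧ G.Adj a j))

/-- The pairs of a vertex set with independent complement and an orientation of it. -/
def orientedPairs (G : SimpleGraph V) (Z : Set V) : Set (Finset V × (V → V → Prop)) :=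
  {p | p.2 ∈ sinkOrientations G Z p.1 ∧ ∀ i, i ∉ p.1 → ∀ j, j ∉ p.1 → ¬ G.Adj i j}

variable {G : SimpleGraph V} {Z : Set V} {a : V} {p : Finset V × (V → V → Prop)}

theorem toggle_mem_orientedPairs [Finite V] (hp : p ∈ orientedPairs G Z)
    (ha : a ∈ toggleable G Z p) : toggle G a p ∈ orientedPairs G Z := by
  obtain ⟨S, O⟩ := p
  obtain ⟨⟨y, hy, hs, hO⟩, hind⟩ := hp
  dsimp only at hy hs hO hind
  subst hO
  simp only [toggleable, Set.mem_ofPred_eq, Finset.mem_coe, not_and, not_lt] at ha hy hs hind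
  by_cases haS : a ∈ S
  · obtain ⟨-, ha1, ha2⟩ := ha.resolve_right (fun h => h.1 haS)
    simp only [toggle, haS, if_true]
    refine ⟨⟨y, ?_, ?_, ?_⟩, ?_⟩
    · intro i hi j hj
      simp only [Finset.coe_erase, Set.mem_sdiff, Finset.mem_coe] at hi hj
      exact hy i hi.1 j hj.1
    · intro i hi
      simp only [Finset.coe_erase, Set.mem_sdiff, Finset.mem_coe, Set.mem_singleton_iff] at hi ⊢
      rcases hs i hi.1 with h | ⟨j, hj, hadj, hlt⟩
      · exact Or.inl h
      · refine Or.inr ⟨j, ⟨hj, ?_⟩, hadj, hlt⟩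
        rintro rfl
        exact (ha1 i hi.1 haS hadj).not_gt hlt
    · funext i j
      simp only [Finset.coe_erase, Set.mem_sdiff, Finset.mem_coe, Set.mem_singleton_iff, eq_iff_iff]
      tauto
    · intro i hi j hj hadj
      simp only [Finset.mem_erase, not_and_or, not_not] at hi hj
      rcases hi with rfl | hi
      · rcases hj with rfl | hj
        · exact G.loopless.irrefl _ hadj
        · exact ha2 j hj hadj
      · rcases hj with rfl | hj
        · exact ha2 i hi hadj.symm
        · exact hind i hi j hj hadj
  · have ha' := (ha.resolve_left (fun h => haS h.1)).2
    simp only [toggle, haS, if_false]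
    obtain ⟨M, hM⟩ : ∃ M, ∀ i, y i < M := by
      obtain ⟨c, hc⟩ := (Set.finite_range y).bddAbove
      exact ⟨c + 1, fun i => by linarith [hc ⟨i, rfl⟩]⟩
    have hne : ∀ {i}, i ∈ S → i ≠ a := fun hi h => haS (h ▸ hi)
    refine ⟨⟨Function.update y a M, ?_, ?_, ?_⟩, ?_⟩
    · intro i hi j hj hadj
      simp only [Finset.coe_insert, Set.mem_insert_iff, Finset.mem_coe] at hi hj
      rcases hi with rfl | hi
      · rcases hj with rfl | hj
        · exact absurd hadj (G.loopless.irrefl _)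
        · simpa [Function.update_of_ne (hne hj)] using (hM j).ne'
      · rcases hj with rfl | hj
        · simpa [Function.update_of_ne (hne hi)] using (hM i).ne
        · simpa [Function.update_of_ne (hne hi), Function.update_of_ne (hne hj)]
            using hy i hi j hj hadj
    · intro i hi
      simp only [Finset.coe_insert, Set.mem_insert_iff, Finset.mem_coe] at hi ⊢
      rcases hi with rfl | hi
      · refine ha'.imp id ?_
        rintro ⟨j, hj, hadj⟩
        exact ⟨j, Or.inr hj, hadj, by simpa [Function.update_of_ne (hne hj)] using hM j⟩
      · refine (hs i hi).imp id ?_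
        rintro ⟨j, hj, hadj, hlt⟩
        exact ⟨j, Or.inr hj, hadj,
          by simpa [Function.update_of_ne (hne hi), Function.update_of_ne (hne hj)] using hlt⟩
    · funext i j
      simp only [Finset.coe_insert, Set.mem_insert_iff, Finset.mem_coe, eq_iff_iff]
      by_cases hi : i = a
      · subst hi
        by_cases hj : j = i
        · subst hj
          simp [haS]
        · simp [haS, hj, hM]
      · by_cases hj : j = a
        · subst hj
          simp [hi, haS, (hM i).le]
        · simp [hi, hj]
    · intro i hi j hj
      simp only [Finset.mem_insert, not_or] at hi hj
      exact hind i hi.2 j hj.2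

theorem toggleable_toggle (hp : p ∈ orientedPairs G Z) (ha : a ∈ toggleable G Z p) :
    toggleable G Z (toggle G a p) = toggleable G Z p := by
  obtain ⟨S, O⟩ := p
  obtain ⟨⟨y, hy, hs, hO⟩, hind⟩ := hp
  dsimp only at hy hs hO hind
  have hO : ∀ i j, O i j ↔ i ∈ S ∧ j ∈ S ∧ G.Adj i j ∧ y j < y i := fun i j => by
    rw [← congrFun (congrFun hO i) j]; rfl
  have hsymm : ∀ i j, G.Adj i j → G.Adj j i := fun i j h => h.symm
  have hirr : ∀ i, ¬ G.Adj i i := fun i => G.loopless.irrefl i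
  ext b
  by_cases haS : a ∈ S
  · obtain ⟨-, ha1, ha2⟩ := ha.resolve_right (fun h => h.1 haS)
    rw [show toggle G a (S, O) = (S.erase a, fun i j => O i j ∧ i ≠ a ∧ j ≠ a) from if_pos haS]
    simp only [Finset.mem_coe] at ha1 ha2 hy hs
    simp only [toggleable, Set.mem_ofPred_eq, Finset.mem_erase]
    constructor
    · rintro (⟨⟨hba, hb⟩, h1, h2⟩ | ⟨h1, h2⟩)
      · refine Or.inl ⟨hb, fun j hj => ?_, fun j hj => h2 j (by tauto)⟩
        have hja : j ≠ a := by
          rintro rfl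
          exact h2 j (by simp) (hsymm _ _ ((hO _ _).1 hj).2.2.1)
        exact h1 j ⟨hj, hja, hba⟩
      · by_cases hba : b = a
        · subst hba
          exact Or.inl ⟨haS, ha1, ha2⟩
        · exact Or.inr ⟨by tauto, h2.imp id fun ⟨j, hj, h⟩ => ⟨j, hj.2, h⟩⟩
    · rintro (⟨hb, h1, h2⟩ | ⟨h1, h2⟩)
      · by_cases hba : b = a
        · subst hba
          refine Or.inr ⟨by simp, ?_⟩
          refine (hs b haS).imp id ?_
          rintro ⟨j, hj, hadj, -⟩
          exact ⟨j, ⟨fun h => hirr _ (h ▸ hadj), hj⟩, hadj⟩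
        · refine Or.inl ⟨⟨hba, hb⟩, fun j hj => h1 j hj.1, fun j hj => ?_⟩
          by_cases hja : j = a
          · subst hja
            intro hadj
            have hne := hy b hb j haS hadj
            rcases lt_or_gt_of_ne hne with h | h
            · exact h1 j ((hO _ _).2 ⟨haS, hb, hadj.symm, h⟩)
            · exact ha1 b ((hO _ _).2 ⟨hb, haS, hadj, h⟩)
          · exact h2 j (by tauto)
      · refine Or.inr ⟨by tauto, h2.imp id ?_⟩
        rintro ⟨j, hj, hadj⟩
        refine ⟨j, ⟨?_, hj⟩, hadj⟩
        rintro rfl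
        exact ha2 b h1 hadj.symm
  · have ha' := (ha.resolve_left (fun h => haS h.1)).2
    rw [show toggle G a (S, O) = (insert a S, fun i j => O i j ∨ (i = a ∧ j ∈ S ∧ G.Adj a j))
      from if_neg haS]
    simp only [Finset.mem_coe] at ha' hy hs
    simp only [toggleable, Set.mem_ofPred_eq, Finset.mem_insert]
    constructor
    · rintro (⟨hb, h1, h2⟩ | ⟨h1, h2⟩)
      · by_cases hba : b = a
        · subst hba
          exact Or.inr ⟨haS, ha'⟩
        · have hbS := hb.resolve_left hba
          refine Or.inl ⟨hbS, fun j hj => h1 j (Or.inl hj), fun j hj hadj => ?_⟩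
          by_cases hja : j = a
          · subst hja
            exact h1 j (Or.inr ⟨rfl, hbS, hadj.symm⟩)
          · exact h2 j (by tauto) hadj
      · push Not at h1
        refine Or.inr ⟨h1.2, h2.imp id ?_⟩
        rintro ⟨j, hj, hadj⟩
        rcases hj with rfl | hj
        · exact absurd hadj (hind b h1.2 j haS)
        · exact ⟨j, hj, hadj⟩
    · rintro (⟨hb, h1, h2⟩ | ⟨h1, h2⟩)
      · refine Or.inl ⟨Or.inr hb, ?_, fun j hj => h2 j (by tauto)⟩
        rintro j (h | ⟨rfl, -, h⟩)
        · exact h1 j h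
        · exact h2 j haS h.symm
      · by_cases hba : b = a
        · subst hba
          refine Or.inl ⟨Or.inl rfl, ?_, fun j hj => hind b haS j (by tauto)⟩
          rintro j (h | ⟨rfl, h, -⟩)
          · exact haS ((hO _ _).1 h).2.1
          · exact haS h
        · exact Or.inr ⟨by tauto, h2.imp id fun ⟨j, hj, h⟩ => ⟨j, Or.inr hj, h⟩⟩

theorem toggle_toggle (hp : p ∈ orientedPairs G Z) (ha : a ∈ toggleable G Z p) :
    toggle G a (toggle G a p) = p := by
  obtain ⟨S, O⟩ := p
  obtain ⟨⟨y, hy, hs, hO⟩, hind⟩ := hp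
  dsimp only at hy hs hO hind
  have hO : ∀ i j, O i j ↔ i ∈ S ∧ j ∈ S ∧ G.Adj i j ∧ y j < y i := fun i j => by
    rw [← congrFun (congrFun hO i) j]; rfl
  by_cases haS : a ∈ S
  · obtain ⟨-, ha1, ha2⟩ := ha.resolve_right (fun h => h.1 haS)
    simp only [toggle, haS, if_true, Finset.mem_erase, ne_eq, not_true, false_and, if_false,
      Finset.insert_erase, Prod.mk.injEq, true_and]
    funext i j
    rw [eq_iff_iff]
    constructor
    · rintro (h | ⟨rfl, ⟨hja, hj⟩, hadj⟩)
      · exact h.1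
      · refine (hO _ _).2 ⟨haS, hj, hadj, ?_⟩
        refine lt_of_le_of_ne (not_lt.1 fun h => ?_) (hy i haS j hj hadj).symm
        exact ha1 j ((hO _ _).2 ⟨hj, haS, hadj.symm, h⟩)
    · intro h
      have hja : j ≠ a := by
        rintro rfl
        exact ha1 i h
      by_cases hi : i = a
      · subst hi
        exact Or.inr ⟨rfl, ⟨hja, ((hO _ _).1 h).2.1⟩, ((hO _ _).1 h).2.2.1⟩
      · exact Or.inl ⟨h, hi, hja⟩
  · simp only [toggle, haS, if_false, Finset.mem_insert, true_or, if_true,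
      Finset.erase_insert haS, Prod.mk.injEq, true_and]
    funext i j
    rw [eq_iff_iff]
    constructor
    · rintro ⟨h | ⟨rfl, -, -⟩, h2, h3⟩
      · exact h
      · exact absurd rfl h2
    · intro h
      refine ⟨Or.inl h, ?_, ?_⟩
      · rintro rfl
        exact haS ((hO _ _).1 h).1
      · rintro rfl
        exact haS ((hO _ _).1 h).2.1

theorem orientedPairs_eq_of_toggleable_eq_empty [Finite V] (hp : p ∈ orientedPairs G Z)
    (h : toggleable G Z p = ∅) :
    p = (∅, fun _ _ => False) ∧ (∀ i j, ¬ G.Adj i j) ∧ ∀ i, i ∉ Z := by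
  obtain ⟨S, O⟩ := p
  obtain ⟨⟨y, hy, hs, hO⟩, hind⟩ := hp
  dsimp only at hy hs hO hind
  subst hO
  have hS : S = ∅ := by
    by_contra hne
    obtain ⟨i, hi, hmax⟩ := S.exists_max_image y (Finset.nonempty_iff_ne_empty.2 hne)
    have hi' : i ∉ toggleable G Z (S, _) := h ▸ Set.notMem_empty i
    refine hi' (Or.inl ⟨hi, fun j hj => (hmax j hj.1).not_gt hj.2.2.2, fun j hj hadj => ?_⟩)
    have hj' : j ∉ toggleable G Z (S, _) := h ▸ Set.notMem_empty j
    exact hj' (Or.inr ⟨hj, Or.inr ⟨i, hi, hadj.symm⟩⟩)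
  subst hS
  refine ⟨by simp, fun i j => hind i (by simp) j (by simp), fun i hi => ?_⟩
  have hi' : i ∉ toggleable G Z (∅, _) := h ▸ Set.notMem_empty i
  exact hi' (Or.inr ⟨by simp, Or.inl hi⟩)

open Classical in
theorem sum_card_sinkOrientations [Fintype V] (G : SimpleGraph V) (Z : Set V) :
    ∑ S : Finset V, (if ∀ i, i ∉ S → ∀ j, j ∉ S → ¬ G.Adj i j then
      (-1 : ℚ) ^ S.card * Nat.card (sinkOrientations G Z S) else 0) =
    if (∀ i j, ¬ G.Adj i j) ∧ ∀ i, i ∉ Z then 1 else 0 := by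
  have h1 : ∑ S : Finset V, (if ∀ i, i ∉ S → ∀ j, j ∉ S → ¬ G.Adj i j then
      (-1 : ℚ) ^ S.card * Nat.card (sinkOrientations G Z S) else 0) =
      ∑ p : Finset V × (V → V → Prop) with p ∈ orientedPairs G Z, (-1 : ℚ) ^ p.1.card := by
    rw [Finset.sum_filter, Fintype.sum_prod_type]
    refine Finset.sum_congr rfl fun S _ => ?_
    have hmem : ∀ O, (S, O) ∈ orientedPairs G Z ↔
      O ∈ sinkOrientations G Z S ∧ ∀ i, i ∉ S → ∀ j, j ∉ S → ¬ G.Adj i j := fun O => Iff.rfl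
    split_ifs with h
    · rw [← Finset.sum_filter]
      dsimp only
      rw [Finset.sum_const, nsmul_eq_mul, mul_comm, Nat.card_eq_fintype_card,
        Fintype.card_subtype]
      congr 3
      ext O
      simpa [hmem] using fun _ => h
    · exact (Finset.sum_eq_zero fun O _ => if_neg fun hO => h hO.2).symm
  rw [h1, ← Finset.sum_filter_add_sum_filter_not _ (fun p => (toggleable G Z p).Nonempty)]
  have h2 : ∑ p ∈ (Finset.univ.filter fun p : Finset V × (V → V → Prop) =>
      p ∈ orientedPairs G Z).filter (fun p => (toggleable G Z p).Nonempty),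
      (-1 : ℚ) ^ p.1.card = 0 := by
    have hV : ∀ p ∈ (Finset.univ.filter fun p : Finset V × (V → V → Prop) =>
        p ∈ orientedPairs G Z).filter (fun p => (toggleable G Z p).Nonempty), Nonempty V := by
      intro p hp
      exact ⟨(Finset.mem_filter.1 hp).2.some⟩
    let pick : (s : Set V) → s.Nonempty → V := fun s hs => hs.some
    have hpick : ∀ s hs, pick s hs ∈ s := fun s hs => hs.some_mem
    have hcongr : ∀ s s' (h : s = s') hs hs', pick s hs = pick s' hs' := by
      rintro s _ rfl _ _; rfl
    have hmem : ∀ p, p ∈ (Finset.univ.filter fun p : Finset V × (V → V → Prop) =>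
        p ∈ orientedPairs G Z).filter (fun p => (toggleable G Z p).Nonempty) ↔
        p ∈ orientedPairs G Z ∧ (toggleable G Z p).Nonempty := by simp
    refine Finset.sum_involution
      (fun p hp => toggle G (pick (toggleable G Z p) ((hmem p).1 hp).2) p) ?_ ?_ ?_ ?_
    · intro p hp
      set a := pick (toggleable G Z p) ((hmem p).1 hp).2
      by_cases haS : a ∈ p.1
      · simp only [toggle, haS, if_true]
        have hc : (-1 : ℚ) ^ p.1.card = -(-1) ^ (p.1.erase a).card := by
          have hcard := Finset.card_erase_add_one haS
          rw [← hcard, pow_succ]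
          ring
        rw [hc, neg_add_cancel]
      · simp only [toggle, haS, if_false]
        rw [Finset.card_insert_of_notMem haS, pow_succ]
        ring
    · intro p hp _ he
      set a := pick (toggleable G Z p) ((hmem p).1 hp).2
      have he := congrArg Prod.fst he
      by_cases haS : a ∈ p.1
      · simp only [toggle, haS, if_true] at he
        exact Finset.notMem_erase a p.1 (by rw [he]; exact haS)
      · simp only [toggle, haS, if_false] at he
        exact haS (he ▸ Finset.mem_insert_self a p.1)
    · intro p hp
      obtain ⟨hp1, hp2⟩ := (hmem p).1 hp
      refine (hmem _).2 ⟨toggle_mem_orientedPairs hp1 (hpick _ _), ?_⟩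
      rw [toggleable_toggle hp1 (hpick _ _)]
      exact hp2
    · intro p hp
      obtain ⟨hp1, hp2⟩ := (hmem p).1 hp
      rw [hcongr _ (toggleable G Z p) (toggleable_toggle hp1 (hpick _ hp2)) _ hp2]
      exact toggle_toggle hp1 (hpick _ hp2)
  rw [h2, zero_add]
  have h3 : (Finset.univ.filter fun p : Finset V × (V → V → Prop) =>
      p ∈ orientedPairs G Z).filter (fun p => ¬ (toggleable G Z p).Nonempty) =
      if (∀ i j, ¬ G.Adj i j) ∧ ∀ i, i ∉ Z then {(∅, fun _ _ => False)} else ∅ := by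
    ext p
    simp only [Finset.mem_filter, Finset.mem_univ, true_and, Set.not_nonempty_iff_eq_empty]
    constructor
    · rintro ⟨hp, he⟩
      obtain ⟨h1, h2⟩ := orientedPairs_eq_of_toggleable_eq_empty hp he
      simp [h1, h2]
    · split_ifs with h
      · rw [Finset.mem_singleton]
        rintro rfl
        refine ⟨⟨⟨0, by simp, by simp, by simp⟩, fun i _ j _ => h.1 i j⟩, ?_⟩
        ext i
        simp [toggleable, h.2]
      · simp
  rw [h3]
  split_ifs <;> simp

end Toggle

theorem card_sinkOrientations_subtype {V : Type*} (G : SimpleGraph V) (Z : Set V) (S : Set V) :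
    Nat.card (sinkOrientations G Z S) =
      Nat.card (sinkOrientations (G.comap (Subtype.val : S → V)) (Subtype.val ⁻¹' Z) Set.univ) := by
  classical
  let f : (S → S → Prop) → V → V → Prop := fun O i j => ∃ hi hj, O ⟨i, hi⟩ ⟨j, hj⟩
  have hf : Function.Injective f := by
    intro O O' h
    funext i j
    have := congrFun (congrFun h i) j
    simpa [f] using this
  rw [← Nat.card_image_of_injective hf]
  congr 2
  ext O
  constructor
  · rintro ⟨y, hy, hs, rfl⟩
    refine ⟨_, ⟨fun i => y i, ?_, ?_, rfl⟩, ?_⟩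
    · intro i _ j _ hadj
      exact hy i i.2 j j.2 hadj
    · intro i _
      refine (hs i i.2).imp id ?_
      rintro ⟨j, hj, h⟩
      exact ⟨⟨j, hj⟩, trivial, h⟩
    · funext i j
      simp only [f, eq_iff_iff, Set.mem_univ, true_and, SimpleGraph.comap_adj]
      tauto
  · rintro ⟨_, ⟨y, hy, hs, rfl⟩, rfl⟩
    have he : ∀ i (hi : i ∈ S), (if h : i ∈ S then y ⟨i, h⟩ else 0) = y ⟨i, hi⟩ :=
      fun i hi => dif_pos hi
    refine ⟨fun i => if h : i ∈ S then y ⟨i, h⟩ else 0, ?_, ?_, ?_⟩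
    · intro i hi j hj hadj
      simp only [he i hi, he j hj]
      exact hy ⟨i, hi⟩ trivial ⟨j, hj⟩ trivial hadj
    · intro i hi
      refine (hs ⟨i, hi⟩ trivial).imp id ?_
      rintro ⟨j, -, h, hlt⟩
      refine ⟨j, j.2, h, ?_⟩
      simpa only [he i hi, he j j.2] using hlt
    · funext i j
      simp only [f, eq_iff_iff, Set.mem_univ, true_and, SimpleGraph.comap_adj]
      constructor
      · rintro ⟨hi, hj, h, hlt⟩
        exact ⟨hi, hj, h, by simpa only [he i hi, he j hj] using hlt⟩
      · rintro ⟨hi, hj, h, hlt⟩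
        exact ⟨hi, hj, h, by simpa only [he i hi, he j hj] using hlt⟩

/-- The number of layerings of `V` with `q` layers and no two adjacent vertices. -/
noncomputable def placements (V : Type*) [LinearOrder V] (q : ℕ) : ℕ :=
  Nat.card {v : V → Fin q // ∀ i j, i < j → (v i : ℕ) ≠ v j + 1}

theorem placements_congr {V W : Type*} [LinearOrder V] [LinearOrder W] (e : V ≃o W) (q : ℕ) :
    placements V q = placements W q := by
  refine Nat.card_congr (Equiv.subtypeEquiv (Equiv.arrowCongr e.toEquiv (Equiv.refl _)) ?_)
  intro v
  constructor
  · intro h i j hij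
    exact h _ _ (e.symm.lt_iff_lt.2 hij)
  · intro h i j hij
    simpa using h (e i) (e j) (e.lt_iff_lt.2 hij)

theorem placements_eq {V : Type*} [LinearOrder V] [Fintype V] {n : ℕ} (h : Fintype.card V = n)
    (q : ℕ) : placements V q = placements (Fin n) q :=
  (placements_congr (Fintype.orderIsoFinOfCardEq V h) q).symm

theorem card_linialSigns_eq {V : Type*} [LinearOrder V] [Fintype V] {n : ℕ}
    (h : Fintype.card V = n) :
    Nat.card (linialSigns V) = Nat.card (linialSigns (Fin n)) :=
  (card_linialSigns_congr (Fintype.orderIsoFinOfCardEq V h)).symm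

open Classical in
theorem sum_card_linialSigns_mul_placements_aux {V : Type*} [LinearOrder V] [Fintype V] {q : ℕ}
    (hq : Fintype.card V ≤ q) (S : Finset V) :
    (-1 : ℚ) ^ S.card * Nat.card (linialSigns {i // i ∈ S}) * placements {i // i ∉ S} q =
      ∑ v : V → Fin q, (if ∀ i, i ∉ S → ∀ j, j ∉ S → ¬ (layerGraph fun i => (v i : ℕ)).Adj i j then
      (-1 : ℚ) ^ S.card *
        Nat.card (sinkOrientations (layerGraph fun i => (v i : ℕ)) {i | (v i : ℕ) = 0} S)
      else 0) := by
  have hS : Fintype.card {i // i ∈ S} ≤ q := (Fintype.card_subtype_le _).trans hq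
  rw [card_linialSigns_eq_sum hS, placements, Nat.card_eq_fintype_card (α := {v // _}),
    Fintype.card_subtype, Finset.card_filter]
  push_cast
  rw [mul_assoc, Finset.sum_mul_sum, Finset.mul_sum]
  simp_rw [Finset.mul_sum]
  rw [← Finset.sum_product', Finset.univ_product_univ]
  symm
  refine Fintype.sum_equiv (Equiv.piEquivPiSubtypeProd (· ∈ S) fun _ => Fin q) _ _ fun v => ?_
  have h1 : (∀ i, i ∉ S → ∀ j, j ∉ S → ¬ (layerGraph fun i => (v i : ℕ)).Adj i j) ↔
      ∀ i j : {i // i ∉ S}, i < j → (v i : ℕ) ≠ v j + 1 := by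
    constructor
    · intro h i j hij he
      exact h i i.2 j j.2 (Or.inl ⟨hij, he⟩)
    · rintro h i hi j hj (⟨hij, he⟩ | ⟨hij, he⟩)
      · exact h ⟨i, hi⟩ ⟨j, hj⟩ hij he
      · exact h ⟨j, hj⟩ ⟨i, hi⟩ hij he
  rw [card_sinkOrientations_subtype]
  simp only [h1, Equiv.piEquivPiSubtypeProd_apply]
  split_ifs
  · rw [mul_one]
    rfl
  · simp

theorem card_pos_layers {V : Type*} [LinearOrder V] (q : ℕ) :
    Nat.card {v : V → Fin (q + 1) // (∀ i j, ¬ (layerGraph fun i => (v i : ℕ)).Adj i j) ∧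
      ∀ i, i ∉ {i | (v i : ℕ) = 0}} = placements V q := by
  symm
  refine Nat.card_congr (Equiv.ofBijective (fun v => ⟨fun i => (v.1 i).succ, ?_, ?_⟩) ⟨?_, ?_⟩)
  · rintro i j (⟨hij, he⟩ | ⟨hij, he⟩)
    · exact v.2 i j hij (by simpa using he)
    · exact v.2 j i hij (by simpa using he)
  · simp
  · rintro ⟨v, hv⟩ ⟨w, hw⟩ h
    simp only [Subtype.mk.injEq] at h ⊢
    funext i
    exact Fin.succ_injective _ (congrFun h i)
  · rintro ⟨v, hv, h0⟩
    have h0' : ∀ i, v i ≠ 0 := fun i hi => h0 i (by simp [hi])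
    refine ⟨⟨fun i => (v i).pred (h0' i), ?_⟩, ?_⟩
    · intro i j hij he
      refine hv i j (Or.inl ⟨hij, ?_⟩)
      have h1 := h0 i
      have h2 := h0 j
      simp only [Fin.val_pred, Set.mem_ofPred_eq] at he h1 h2 ⊢
      omega
    · simp

theorem sum_card_linialSigns_mul_placements {V : Type*} [LinearOrder V] [Fintype V] {q : ℕ}
    (hq : Fintype.card V ≤ q + 1) :
    ∑ S : Finset V, (-1 : ℚ) ^ S.card * Nat.card (linialSigns {i // i ∈ S}) *
      placements {i // i ∉ S} (q + 1) = placements V q := by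
  classical
  simp_rw [sum_card_linialSigns_mul_placements_aux hq]
  rw [Finset.sum_comm]
  simp_rw [sum_card_sinkOrientations]
  rw [← card_pos_layers, Nat.card_eq_fintype_card, Fintype.card_subtype, Finset.card_filter]
  push_cast
  refine Finset.sum_congr rfl fun v _ => ?_
  congr

theorem sum_choose_card_linialSigns_mul_placements {n q : ℕ} (hq : n ≤ q + 1) :
    ∑ k ∈ Finset.range (n + 1), (n.choose k : ℚ) * ((-1) ^ k * Nat.card (linialSigns (Fin k)) *
      placements (Fin (n - k)) (q + 1)) = placements (Fin n) q := by
  rw [← sum_card_linialSigns_mul_placements (V := Fin n) (by simpa using hq)]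
  have h : ∀ S : Finset (Fin n), (-1 : ℚ) ^ S.card * Nat.card (linialSigns {i // i ∈ S}) *
      placements {i // i ∉ S} (q + 1) = (fun k => (-1 : ℚ) ^ k * Nat.card (linialSigns (Fin k)) *
      placements (Fin (n - k)) (q + 1)) S.card := by
    intro S
    rw [card_linialSigns_eq (n := S.card) (by simp),
      placements_eq (n := n - S.card) (by simp [Fintype.card_subtype_compl])]
  rw [Finset.sum_congr rfl fun S _ => h S, ← Finset.powerset_univ,
    Finset.sum_powerset_apply_card (fun k => (-1 : ℚ) ^ k * Nat.card (linialSigns (Fin k)) *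
      placements (Fin (n - k)) (q + 1))]
  simp [nsmul_eq_mul]

theorem placements_zero (n : ℕ) : placements (Fin n) 0 = if n = 0 then 1 else 0 := by
  rcases n with _ | n
  · have : Unique {v : Fin 0 → Fin 0 // ∀ i j, i < j → (v i : ℕ) ≠ v j + 1} :=
      ⟨⟨⟨Fin.elim0, fun i => i.elim0⟩⟩, fun v => Subtype.ext (funext fun i => i.elim0)⟩
    simp [placements]
  · have : IsEmpty {v : Fin (n + 1) → Fin 0 // ∀ i j, i < j → (v i : ℕ) ≠ v j + 1} :=
      ⟨fun v => (v.1 0).elim0⟩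
    simp [placements]

theorem placements_of_isEmpty (q : ℕ) : placements (Fin 0) q = 1 := by
  have : Unique {v : Fin 0 → Fin q // ∀ i j, i < j → (v i : ℕ) ≠ v j + 1} :=
    ⟨⟨⟨Fin.elim0, fun i => i.elim0⟩⟩, fun v => Subtype.ext (funext fun i => i.elim0)⟩
  simp [placements]

/-- Glue layerings of a set and of its complement, leaving layer `a` empty between them. -/
def glueLayers {V : Type*} [DecidableEq V] {a b : ℕ} (S : Finset V) (v : {i // i ∈ S} → Fin a)
    (w : {i // i ∉ S} → Fin b) (i : V) : ℕ :=
  if h : i ∈ S then v ⟨i, h⟩ else a + 1 + w ⟨i, h⟩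

theorem card_placements_avoiding {V : Type*} [LinearOrder V] [Fintype V] (a b : ℕ) :
    Nat.card {v : V → Fin (a + 1 + b) // (∀ i j, i < j → (v i : ℕ) ≠ v j + 1) ∧
      ∀ i, (v i : ℕ) ≠ a} =
    ∑ S : Finset V, placements {i // i ∈ S} a * placements {i // i ∉ S} b := by
  have hs : ∀ (S : Finset V) (v : {i // i ∈ S} → Fin a) (w : {i // i ∉ S} → Fin b) i
      (h : i ∈ S), glueLayers S v w i = v ⟨i, h⟩ := fun S v w i h => dif_pos h
  have hn : ∀ (S : Finset V) (v : {i // i ∈ S} → Fin a) (w : {i // i ∉ S} → Fin b) i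
      (h : i ∉ S), glueLayers S v w i = a + 1 + w ⟨i, h⟩ := fun S v w i h => dif_neg h
  have hiff : ∀ (S : Finset V) (v : {i // i ∈ S} → Fin a) (w : {i // i ∉ S} → Fin b) i,
      i ∈ S ↔ glueLayers S v w i < a := by
    intro S v w i
    by_cases h : i ∈ S
    · simp [h, hs S v w i h]
    · refine iff_of_false h ?_
      rw [hn S v w i h]
      omega
  have hlt : ∀ (S : Finset V) (v : {i // i ∈ S} → Fin a) (w : {i // i ∉ S} → Fin b) i,
      glueLayers S v w i < a + 1 + b := by
    intro S v w i
    by_cases h : i ∈ S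
    · have := (v ⟨i, h⟩).2
      rw [hs S v w i h]
      omega
    · have := (w ⟨i, h⟩).2
      rw [hn S v w i h]
      omega
  simp_rw [placements, ← Nat.card_prod]
  rw [← Nat.card_sigma]
  symm
  refine Nat.card_congr (Equiv.ofBijective
    (fun p => ⟨fun i => ⟨glueLayers p.1 p.2.1.1 p.2.2.1 i, hlt _ _ _ i⟩, ?_, ?_⟩) ⟨?_, ?_⟩)
  · obtain ⟨S, ⟨v, hv⟩, ⟨w, hw⟩⟩ := p
    intro i j hij
    dsimp only
    by_cases hi : i ∈ S <;> by_cases hj : j ∈ S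
    · rw [hs S v w i hi, hs S v w j hj]
      exact hv _ _ hij
    · have := (v ⟨i, hi⟩).2
      rw [hs S v w i hi, hn S v w j hj]
      omega
    · have := (v ⟨j, hj⟩).2
      rw [hn S v w i hi, hs S v w j hj]
      omega
    · have := hw ⟨i, hi⟩ ⟨j, hj⟩ hij
      rw [hn S v w i hi, hn S v w j hj]
      omega
  · obtain ⟨S, ⟨v, hv⟩, ⟨w, hw⟩⟩ := p
    intro i
    dsimp only
    by_cases hi : i ∈ S
    · have := (v ⟨i, hi⟩).2
      rw [hs S v w i hi]
      omega
    · rw [hn S v w i hi]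
      omega
  · rintro ⟨S, ⟨v, hv⟩, ⟨w, hw⟩⟩ ⟨S', ⟨v', hv'⟩, ⟨w', hw'⟩⟩ h
    simp only [Subtype.mk.injEq] at h
    have h : ∀ i, glueLayers S v w i = glueLayers S' v' w' i := fun i =>
      congrArg Fin.val (congrFun h i)
    obtain rfl : S = S' := by
      ext i
      rw [hiff S v w, hiff S' v' w', h]
    have h1 : v = v' := by
      funext i
      have := h i
      rw [hs _ _ _ _ i.2, hs _ _ _ _ i.2] at this
      exact Fin.ext this
    have h2 : w = w' := by
      funext i
      have := h i
      rw [hn _ _ _ _ i.2, hn _ _ _ _ i.2] at this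
      exact Fin.ext (Nat.add_left_cancel this)
    subst h1 h2
    rfl
  · rintro ⟨u, hu, hua⟩
    let S : Finset V := Finset.univ.filter fun i => (u i : ℕ) < a
    have hS : ∀ i, i ∈ S ↔ (u i : ℕ) < a := by simp [S]
    have hS' : ∀ i, i ∉ S → a + 1 ≤ u i := by
      intro i hi
      rw [hS] at hi
      have := hua i
      omega
    let v : {i // i ∈ S} → Fin a := fun i => ⟨u i, (hS _).1 i.2⟩
    let w : {i // i ∉ S} → Fin b := fun i => ⟨u i - (a + 1), by
      have := hS' i i.2
      have := (u i).2
      omega⟩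
    refine ⟨⟨S, ⟨v, fun i j hij => hu i j hij⟩, ⟨w, fun i j hij => ?_⟩⟩, ?_⟩
    · have h1 := hS' i i.2
      have h2 := hS' j j.2
      have h3 := hu i j hij
      simp only [w]
      omega
    · simp only [Subtype.mk.injEq]
      funext i
      refine Fin.ext ?_
      by_cases hi : i ∈ S
      · exact hs S v w i hi
      · have := hS' i hi
        refine (hn S v w i hi).trans ?_
        simp only [w]
        omega

theorem sum_placements_mul_placements (n a b : ℕ) :
    ∑ S : Finset (Fin n), placements {i // i ∈ S} a * placements {i // i ∉ S} b =
      ∑ k ∈ Finset.range (n + 1), n.choose k *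
        (placements (Fin k) a * placements (Fin (n - k)) b) := by
  have h : ∀ S : Finset (Fin n), placements {i // i ∈ S} a * placements {i // i ∉ S} b =
      placements (Fin S.card) a * placements (Fin (n - S.card)) b := by
    intro S
    rw [placements_eq (V := {i // i ∈ S}) (n := S.card) (by simp),
      placements_eq (V := {i // i ∉ S}) (n := n - S.card) (by simp [Fintype.card_subtype_compl])]
  rw [Finset.sum_congr rfl fun S _ => h S, ← Finset.powerset_univ,
    Finset.sum_powerset_apply_card (fun k => placements (Fin k) a * placements (Fin (n - k)) b)]
  simp

theorem placements_fin_succ (n q : ℕ) :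
    placements (Fin (n + 1)) q = ∑ p : Fin q, Nat.card {u : Fin n → Fin q //
      (∀ i j, i < j → (u i : ℕ) ≠ u j + 1) ∧ ∀ i, (u i : ℕ) + 1 ≠ p} := by
  rw [← Nat.card_sigma]
  refine Nat.card_congr (Equiv.ofBijective
    (fun v => ⟨v.1 0, fun i => v.1 i.succ, ?_, ?_⟩) ⟨?_, ?_⟩)
  · intro i j hij
    exact v.2 _ _ (Fin.succ_lt_succ_iff.2 hij)
  · intro i
    exact (v.2 0 i.succ (Fin.succ_pos i)).symm
  · rintro ⟨v, hv⟩ ⟨w, hw⟩ h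
    simp only [Sigma.mk.injEq] at h
    obtain ⟨h0, h1⟩ := h
    refine Subtype.ext (funext fun i => Fin.cases h0 (fun i => ?_) i)
    rw [Subtype.heq_iff_coe_eq (by simp [h0])] at h1
    exact congrFun h1 i
  · rintro ⟨p, u, hu, hp⟩
    refine ⟨⟨Fin.cons p u, ?_⟩, ?_⟩
    · intro i j
      refine Fin.cases ?_ (fun j => ?_) j
      · simp
      · refine Fin.cases ?_ (fun i => ?_) i
        · intro _
          simpa using (hp j).symm
        · intro hij
          simpa using hu i j (Fin.succ_lt_succ_iff.1 hij)
    · rfl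

theorem placements_succ_add (n q : ℕ) :
    placements (Fin (n + 1)) (q + 1) + placements (Fin n) q = placements (Fin n) (q + 1) +
      ∑ p ∈ Finset.HasAntidiagonal.antidiagonal q, ∑ k ∈ Finset.range (n + 1), n.choose k *
        (placements (Fin k) p.1 * placements (Fin (n - k)) p.2) := by
  have h0 : ∑ k ∈ Finset.range (n + 1), n.choose k *
      (placements (Fin k) q * placements (Fin (n - k)) 0) = placements (Fin n) q := by
    rw [Finset.sum_range_succ, Finset.sum_eq_zero]
    · simp [placements_zero]
    · intro k hk
      rw [Finset.mem_range] at hk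
      simp [placements_zero, Nat.sub_eq_zero_iff_le, hk]
  rw [placements_fin_succ, Fin.sum_univ_succ, Finset.Nat.sum_antidiagonal_eq_sum_range_succ
    (fun a b => ∑ k ∈ Finset.range (n + 1), n.choose k *
      (placements (Fin k) a * placements (Fin (n - k)) b)), Finset.sum_range_succ,
    Nat.sub_self, h0, ← add_assoc]
  congr 2
  · simp [placements]
  · rw [← Fin.sum_univ_eq_sum_range (fun a => ∑ k ∈ Finset.range (n + 1), n.choose k *
      (placements (Fin k) a * placements (Fin (n - k)) (q - a)))]
    refine Finset.sum_congr rfl fun a _ => ?_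
    rw [← sum_placements_mul_placements, ← card_placements_avoiding]
    have ha : (a : ℕ) + 1 + (q - a) = q + 1 := by
      have := a.2
      omega
    rw [ha]
    simp

section PowerSeriesRecurrence

open PowerSeries

/-- The divided power `U ^ j / j!`. -/
noncomputable def divPow (U : ℚ⟦X⟧) (j : ℕ) : ℚ⟦X⟧ := C (1 / (j.factorial : ℚ)) * U ^ j

theorem derivative_divPow_succ (U : ℚ⟦X⟧) (j : ℕ) :
    d⁄dX ℚ (divPow U (j + 1)) = d⁄dX ℚ U * divPow U j := by
  have h : (C (1 / ((j + 1).factorial : ℚ)) : ℚ⟦X⟧) * ((j + 1 : ℕ) : ℚ⟦X⟧) =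
      C (1 / (j.factorial : ℚ)) := by
    rw [← map_natCast (C (R := ℚ)), ← map_mul]
    congr 1
    rw [Nat.factorial_succ]
    push_cast
    field_simp
  rw [divPow, divPow, Derivation.leibniz, derivative_C, derivative_pow, Nat.add_sub_cancel, ← h]
  simp only [smul_eq_mul]
  ring

theorem derivative_divPow_zero (U : ℚ⟦X⟧) : d⁄dX ℚ (divPow U 0) = 0 := by
  simp [divPow]

/-- Differentiate a series of power series coefficientwise. -/
noncomputable def coeffDerivative (f : ℚ⟦X⟧⟦X⟧) : ℚ⟦X⟧⟦X⟧ := mk fun n => d⁄dX ℚ (coeff n f)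

theorem coeffDerivative_add (f g : ℚ⟦X⟧⟦X⟧) :
    coeffDerivative (f + g) = coeffDerivative f + coeffDerivative g := by
  ext1 n
  simp [coeffDerivative]

theorem coeffDerivative_sub (f g : ℚ⟦X⟧⟦X⟧) :
    coeffDerivative (f - g) = coeffDerivative f - coeffDerivative g := by
  ext1 n
  simp [coeffDerivative]

theorem coeffDerivative_mul (f g : ℚ⟦X⟧⟦X⟧) :
    coeffDerivative (f * g) = coeffDerivative f * g + f * coeffDerivative g := by
  ext1 n
  simp only [coeffDerivative, coeff_mk, coeff_mul, map_sum, Derivation.leibniz, smul_eq_mul,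
    map_add, ← Finset.sum_add_distrib]
  refine Finset.sum_congr rfl fun p _ => ?_
  ring

theorem coeffDerivative_one : coeffDerivative 1 = 0 := by
  ext1 n
  rw [coeffDerivative, coeff_mk, coeff_one]
  split_ifs <;> simp

theorem coeffDerivative_X : coeffDerivative X = 0 := by
  ext1 n
  rw [coeffDerivative, coeff_mk, coeff_X]
  split_ifs <;> simp

theorem eq_zero_of_coeffDerivative_eq_mul {M Y : ℚ⟦X⟧⟦X⟧} (hM : coeff 0 M = 1)
    (h : coeffDerivative Y = M * Y) (h0 : ∀ n, constantCoeff (coeff n Y) = 0) : Y = 0 := by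
  ext1 n
  induction n using Nat.strong_induction_on with
  | _ n ih =>
    have hn : d⁄dX ℚ (coeff n Y) = coeff n Y := by
      have := congrArg (coeff n) h
      rw [coeffDerivative, coeff_mk, coeff_mul, Finset.sum_eq_single (0, n)] at this
      · rw [this, hM, one_mul]
      · rintro ⟨a, b⟩ hab hne
        rw [Finset.HasAntidiagonal.mem_antidiagonal] at hab
        dsimp only at hab ⊢
        have : b < n := by
          rcases Nat.eq_zero_or_pos a with rfl | ha
          · simp_all
          · omega
        rw [ih b this, map_zero, mul_zero]
      · simp
    ext1 k
    rw [map_zero, map_zero]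
    induction k with
    | zero => simpa using h0 n
    | succ k ihk =>
      have := congrArg (coeff k) hn
      rw [coeff_derivative, ihk] at this
      exact (mul_eq_zero.1 this).resolve_right (by positivity)

theorem layer_series_eq {A : ℕ → ℚ⟦X⟧} (hA0 : A 0 = 1) (hAc : ∀ q, constantCoeff (A q) = 1)
    (hA : ∀ q, d⁄dX ℚ (A (q + 1)) + A (q + 1) + A q =
      ∑ p ∈ Finset.HasAntidiagonal.antidiagonal (q + 1), A p.1 * A p.2) (q : ℕ) :
    A (q + 2) = exp ℚ * ∑ p ∈ Finset.HasAntidiagonal.antidiagonal q, divPow X p.1 * A p.2 := by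
  let M : ℚ⟦X⟧⟦X⟧ := mk A
  let e : ℚ⟦X⟧⟦X⟧ := mk fun j => exp ℚ * divPow X j
  have hM : coeffDerivative M = M * M - (1 + X) * M := by
    ext1 n
    rw [map_sub, add_mul, one_mul, map_add, coeff_mul]
    simp only [coeffDerivative, coeff_mk, M]
    rcases n with _ | n
    · simp [hA0]
    · rw [coeff_succ_X_mul, coeff_mk, ← hA]
      ring
  have he : coeffDerivative e = (1 + X) * e := by
    ext1 n
    rw [add_mul, one_mul, map_add]
    simp only [coeffDerivative, coeff_mk, e]
    rcases n with _ | n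
    · simp [derivative_divPow_zero, derivative_exp, mul_comm]
    · rw [coeff_succ_X_mul, coeff_mk, Derivation.leibniz, derivative_divPow_succ, derivative_exp]
      simp only [smul_eq_mul, derivative_X]
      ring
  have hcoeff : ∀ n, coeff (n + 2) (1 + X - M + X * (X * (e * M))) = -A (n + 2) +
      ∑ p ∈ Finset.HasAntidiagonal.antidiagonal n, exp ℚ * divPow X p.1 * A p.2 := by
    intro n
    rw [map_add, map_sub, map_add, coeff_succ_X_mul, coeff_succ_X_mul, coeff_mul, coeff_one,
      coeff_X]
    simp [M, e]
  have hY : 1 + X - M + X * (X * (e * M)) = 0 := by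
    refine eq_zero_of_coeffDerivative_eq_mul (M := M) (by simp [M, hA0]) ?_ ?_
    · simp only [coeffDerivative_add, coeffDerivative_sub, coeffDerivative_mul, coeffDerivative_one,
        coeffDerivative_X, hM, he]
      ring
    · intro n
      rcases n with _ | _ | n
      · simp [M, hAc]
      · simp [M, hAc, coeff_one, coeff_succ_X_mul]
      · rw [hcoeff, map_add, map_sum, Finset.sum_eq_single (0, n)]
        · simp [divPow, hAc]
        · rintro ⟨a, b⟩ hab hne
          rcases a with _ | a
          · simp_all
          · simp [divPow]
        · simp
  have h := hcoeff q
  rw [hY, map_zero] at h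
  rw [Finset.mul_sum]
  simp only [← mul_assoc]
  linear_combination h

theorem X_pow_dvd_derivative {f : ℚ⟦X⟧} {n : ℕ} (h : X ^ (n + 1) ∣ f) : X ^ n ∣ d⁄dX ℚ f := by
  rw [X_pow_dvd_iff] at h ⊢
  intro m hm
  rw [coeff_derivative, h (m + 1) (by omega), zero_mul]

theorem X_pow_dvd_of_mul {f g : ℚ⟦X⟧} {n : ℕ} (hf : constantCoeff f = 1) (h : X ^ n ∣ f * g) :
    X ^ n ∣ g := by
  have : IsUnit f := isUnit_iff_constantCoeff.2 (by simp [hf])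
  exact (this.dvd_mul_left).1 h

theorem eq_zero_of_X_pow_dvd {f : ℚ⟦X⟧} (h : ∀ n, X ^ n ∣ f) : f = 0 := by
  ext n
  exact X_pow_dvd_iff.1 (h (n + 1)) n (Nat.lt_succ_self n)

theorem layer_series_mul_sub_dvd {A : ℕ → ℚ⟦X⟧} {T : ℚ⟦X⟧}
    (hTA : ∀ q, X ^ (q + 1) ∣ T * A (q + 1) - A q) (q j : ℕ) :
    X ^ (q + 1) ∣ T ^ j * A (q + j) - A q := by
  induction j generalizing q with
  | zero => simp
  | succ j ih =>
    have h1 := ih (q + 1)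
    have h2 := hTA q
    have h3 : X ^ (q + 1) ∣ T * (T ^ j * A (q + 1 + j) - A (q + 1)) :=
      ((pow_dvd_pow X (by omega)).trans h1).mul_left T
    have h4 := h3.add h2
    rw [show q + (j + 1) = q + 1 + j by omega]
    convert! h4 using 1
    ring

theorem sq_mul_exp_mul_sum_dvd {A : ℕ → ℚ⟦X⟧} {T : ℚ⟦X⟧}
    (hA0 : A 0 = 1) (hAc : ∀ q, constantCoeff (A q) = 1)
    (hA : ∀ q, d⁄dX ℚ (A (q + 1)) + A (q + 1) + A q =
      ∑ p ∈ Finset.HasAntidiagonal.antidiagonal (q + 1), A p.1 * A p.2)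
    (hTA : ∀ q, X ^ (q + 1) ∣ T * A (q + 1) - A q) (q : ℕ) :
    X ^ (q + 1) ∣ T ^ 2 * exp ℚ * ∑ j ∈ Finset.range (q + 1), divPow (X * T) j - 1 := by
  refine X_pow_dvd_of_mul (hAc (q + 2)) ?_
  have h1 : A (q + 2) = exp ℚ * ∑ j ∈ Finset.range (q + 1), divPow X j * A (q - j) := by
    rw [layer_series_eq hA0 hAc hA,
      Finset.Nat.sum_antidiagonal_eq_sum_range_succ (fun a b => divPow X a * A b)]
  have h2 : A (q + 2) * (T ^ 2 * exp ℚ * ∑ j ∈ Finset.range (q + 1), divPow (X * T) j - 1) =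
      exp ℚ * ∑ j ∈ Finset.range (q + 1),
        divPow X j * (T ^ (j + 2) * A (q - j + (j + 2)) - A (q - j)) := by
    have h3 : ∀ j ∈ Finset.range (q + 1),
        divPow X j * (T ^ (j + 2) * A (q - j + (j + 2)) - A (q - j)) =
        A (q + 2) * T ^ 2 * divPow (X * T) j - divPow X j * A (q - j) := by
      intro j hj
      rw [Finset.mem_range] at hj
      rw [show q - j + (j + 2) = q + 2 by omega, divPow, divPow]
      ring
    rw [Finset.sum_congr rfl h3, Finset.sum_sub_distrib, ← Finset.mul_sum, mul_sub (exp ℚ), ← h1]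
    ring
  rw [h2]
  refine (Finset.dvd_sum fun j hj => ?_).mul_left _
  rw [Finset.mem_range] at hj
  rw [show q + 1 = j + (q - j + 1) by omega, pow_add]
  exact mul_dvd_mul (Dvd.intro_left _ rfl) (layer_series_mul_sub_dvd hTA _ _)

theorem two_mul_derivative_add_eq_zero {A : ℕ → ℚ⟦X⟧} {T : ℚ⟦X⟧}
    (hA0 : A 0 = 1) (hAc : ∀ q, constantCoeff (A q) = 1)
    (hA : ∀ q, d⁄dX ℚ (A (q + 1)) + A (q + 1) + A q =
      ∑ p ∈ Finset.HasAntidiagonal.antidiagonal (q + 1), A p.1 * A p.2)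
    (hT : constantCoeff T = 1) (hTA : ∀ q, X ^ (q + 1) ∣ T * A (q + 1) - A q) :
    2 * d⁄dX ℚ T + T * (1 + T + X * d⁄dX ℚ T) = 0 := by
  refine eq_zero_of_X_pow_dvd fun n => (pow_dvd_pow X (Nat.le_succ n)).trans ?_
  let S := ∑ j ∈ Finset.range (n + 1), divPow (X * T) j
  have hS : d⁄dX ℚ (S + divPow (X * T) (n + 1)) = (T + X * d⁄dX ℚ T) * S := by
    simp only [S]
    rw [← Finset.sum_range_succ, Finset.sum_range_succ', map_add, derivative_divPow_zero, map_sum,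
      add_zero, Finset.mul_sum]
    refine Finset.sum_congr rfl fun j _ => ?_
    rw [derivative_divPow_succ, Derivation.leibniz, derivative_X]
    simp only [smul_eq_mul]
    ring
  have hdvd : X ^ (n + 1) ∣ divPow (X * T) (n + 1) :=
    ⟨C (1 / ((n + 1).factorial : ℚ)) * T ^ (n + 1), by rw [divPow]; ring⟩
  have h := X_pow_dvd_derivative (sq_mul_exp_mul_sum_dvd hA0 hAc hA hTA (n + 1))
  rw [Finset.sum_range_succ] at h
  change X ^ (n + 1) ∣ d⁄dX ℚ (T ^ 2 * exp ℚ * (S + divPow (X * T) (n + 1)) - 1) at h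
  have hS0 : constantCoeff S = 1 := by
    simp [S, Finset.sum_range_succ', divPow]
  refine X_pow_dvd_of_mul (f := T * exp ℚ * S) (by simp [hT, hS0]) ?_
  have h2 : d⁄dX ℚ (T ^ 2 * exp ℚ * (S + divPow (X * T) (n + 1)) - 1) =
      T * exp ℚ * S * (2 * d⁄dX ℚ T + T * (1 + T + X * d⁄dX ℚ T)) +
      (2 * T * d⁄dX ℚ T * exp ℚ + T ^ 2 * exp ℚ) * divPow (X * T) (n + 1) := by
    rw [map_sub, Derivation.leibniz, hS, derivative_one, Derivation.leibniz, derivative_exp,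
      derivative_pow]
    simp only [smul_eq_mul]
    push_cast
    ring
  rw [h2] at h
  exact (dvd_add_left (hdvd.mul_left _)).1 h

end PowerSeriesRecurrence

section LinialRecurrence

open PowerSeries

/-- The exponential generating function of a sequence. -/
noncomputable def egf (f : ℕ → ℚ) : ℚ⟦X⟧ := mk fun n => f n / n.factorial

theorem coeff_egf (f : ℕ → ℚ) (n : ℕ) : coeff n (egf f) = f n / n.factorial := coeff_mk _ _

theorem constantCoeff_egf (f : ℕ → ℚ) : constantCoeff (egf f) = f 0 := by
  rw [← coeff_zero_eq_constantCoeff_apply, coeff_egf]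
  simp

theorem coeff_egf_mul (f g : ℕ → ℚ) (n : ℕ) : coeff n (egf f * egf g) =
    (∑ k ∈ Finset.range (n + 1), (n.choose k : ℚ) * (f k * g (n - k))) / n.factorial := by
  rw [coeff_mul, Finset.Nat.sum_antidiagonal_eq_sum_range_succ
    (fun a b => coeff a (egf f) * coeff b (egf g)), Finset.sum_div]
  refine Finset.sum_congr rfl fun k hk => ?_
  rw [Finset.mem_range, Nat.lt_succ_iff] at hk
  rw [coeff_egf, coeff_egf, Nat.cast_choose ℚ hk]
  field_simp

theorem coeff_derivative_egf (f : ℕ → ℚ) (n : ℕ) :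
    coeff n (d⁄dX ℚ (egf f)) = f (n + 1) / n.factorial := by
  rw [coeff_derivative, coeff_egf, Nat.factorial_succ]
  push_cast
  field_simp

/-- The exponential generating function of the placements into `q - 1` layers. -/
noncomputable def layerSeries : ℕ → ℚ⟦X⟧
  | 0 => 1
  | q + 1 => egf fun n => placements (Fin n) q

theorem layerSeries_one : layerSeries 1 = 1 := by
  ext n
  rw [layerSeries, coeff_egf, placements_zero, coeff_one]
  split_ifs with h <;> simp [h]

theorem derivative_layerSeries (q : ℕ) :
    d⁄dX ℚ (layerSeries (q + 1)) + layerSeries (q + 1) + layerSeries q =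
      ∑ p ∈ Finset.HasAntidiagonal.antidiagonal (q + 1), layerSeries p.1 * layerSeries p.2 := by
  rcases q with _ | q
  · have h0 : layerSeries 0 = 1 := rfl
    simp [Finset.Nat.antidiagonal_succ, layerSeries_one, h0]
  · rw [Finset.Nat.antidiagonal_succ_succ']
    simp only [Finset.sum_cons, Finset.sum_map, Function.Embedding.prodMap,
      Function.Embedding.coeFn_mk, Prod.map, Nat.succ_eq_add_one]
    ext n
    have h := congrArg (Nat.cast (R := ℚ)) (placements_succ_add n q)
    push_cast at h
    simp only [layerSeries, map_add, map_sum, coeff_egf_mul, coeff_derivative_egf, coeff_egf,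
      one_mul, mul_one]
    rw [← Finset.sum_div]
    linear_combination h / n.factorial

theorem card_linialSigns_fin_zero : Nat.card (linialSigns (Fin 0)) = 1 := by
  have := sum_choose_card_linialSigns_mul_placements (Nat.zero_le (0 + 1))
  simpa [placements_of_isEmpty] using this

theorem two_mul_card_linialSigns_succ (n : ℕ) :
    2 * Nat.card (linialSigns (Fin (n + 1))) = ∑ k ∈ Finset.range (n + 1), n.choose k *
      (Nat.card (linialSigns (Fin k)) * ((n - k + 1) * Nat.card (linialSigns (Fin (n - k))) +
        if n - k = 0 then 1 else 0)) := by
  set r : ℕ → ℕ := fun n => Nat.card (linialSigns (Fin n)) with hr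
  have hE : ∀ n q, n ≤ q + 1 → ∑ k ∈ Finset.range (n + 1), (n.choose k : ℚ) *
      ((-1) ^ k * r k * placements (Fin (n - k)) (q + 1)) = placements (Fin n) q :=
    fun n q h => sum_choose_card_linialSigns_mul_placements h
  have hr0 : r 0 = 1 := card_linialSigns_fin_zero
  let t : ℕ → ℚ := fun n => (-1) ^ n * r n
  have hdvd : ∀ q, X ^ (q + 1) ∣ egf t * layerSeries (q + 1) - layerSeries q := by
    intro q
    rw [X_pow_dvd_iff]
    intro m hm
    rcases q with _ | q
    · obtain rfl : m = 0 := by omega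
      simp [layerSeries, constantCoeff_egf, placements_of_isEmpty, t, hr0]
    · rw [map_sub, layerSeries, layerSeries, coeff_egf_mul, coeff_egf, ← hE m q (by omega),
        sub_self]
  have key := two_mul_derivative_add_eq_zero (A := layerSeries) (T := egf t) rfl
    (fun q => by cases q <;> simp [layerSeries, constantCoeff_egf, placements_of_isEmpty])
    derivative_layerSeries (by simp [constantCoeff_egf, t, hr0]) hdvd
  have hW : 1 + egf t + X * d⁄dX ℚ (egf t) =
      egf fun m => (-1) ^ m * ((m + 1) * r m + if m = 0 then 1 else 0) := by
    ext m
    rcases m with _ | m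
    · simp [constantCoeff_egf, t, hr0]
    · rw [map_add, map_add, coeff_succ_X_mul, coeff_derivative_egf, coeff_egf, coeff_egf,
        coeff_one, Nat.factorial_succ]
      simp only [t, Nat.succ_ne_zero, if_false]
      push_cast
      field_simp
      ring
  rw [hW] at key
  have hn := congrArg (coeff n) key
  rw [map_add, two_mul, map_add, coeff_derivative_egf, coeff_egf_mul, map_zero] at hn
  have hsum : ∑ k ∈ Finset.range (n + 1), (n.choose k : ℚ) * (t k * ((-1) ^ (n - k) *
      (((n - k : ℕ) + 1) * r (n - k) + if n - k = 0 then 1 else 0))) =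
      (-1) ^ n * ∑ k ∈ Finset.range (n + 1), (n.choose k : ℚ) * (r k *
      (((n - k : ℕ) + 1) * r (n - k) + if n - k = 0 then 1 else 0)) := by
    rw [Finset.mul_sum]
    refine Finset.sum_congr rfl fun k hk => ?_
    rw [Finset.mem_range, Nat.lt_succ_iff] at hk
    have : (-1 : ℚ) ^ n = (-1) ^ k * (-1) ^ (n - k) := by rw [← pow_add, Nat.add_sub_cancel' hk]
    rw [this]
    simp only [t]
    ring
  rw [hsum, ← add_div, ← add_div, div_eq_zero_iff] at hn
  replace hn := hn.resolve_right (by positivity)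
  simp only [t, pow_succ] at hn
  have hne : (-1 : ℚ) ^ n ≠ 0 := by simp
  have hfin : (2 * r (n + 1) : ℚ) = ∑ k ∈ Finset.range (n + 1), (n.choose k : ℚ) * (r k *
      (((n - k : ℕ) + 1) * r (n - k) + if n - k = 0 then 1 else 0)) := by
    refine mul_left_cancel₀ hne ?_
    linear_combination -hn
  exact_mod_cast hfin

end LinialRecurrence

section TreeSplitting

variable {V W : Type*}

theorem SimpleGraph.Reachable.map_of_adj {G : SimpleGraph V} {H : SimpleGraph W} {f : V → W}
    (hf : ∀ x y, G.Adj x y → H.Reachable (f x) (f y)) {x y : V} (h : G.Reachable x y) :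
    H.Reachable (f x) (f y) := by
  rw [SimpleGraph.reachable_iff_reflTransGen] at h
  induction h with
  | refl => exact .refl _
  | tail _ h ih => exact ih.trans (hf _ _ h)

theorem SimpleGraph.Reachable.mem_of_adj {G : SimpleGraph V} {S : Set V}
    (hS : ∀ x y, G.Adj x y → x ∈ S → y ∈ S) {x y : V} (h : G.Reachable x y) (hx : x ∈ S) :
    y ∈ S := by
  rw [SimpleGraph.reachable_iff_reflTransGen] at h
  induction h with
  | refl => exact hx
  | tail _ h ih => exact hS _ _ h ih

open Classical in
/-- A retraction onto `K` that sends the complement of `K` to `u`. -/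
noncomputable def collapse (K : Set V) (u : K) (x : V) : K := if h : x ∈ K then ⟨x, h⟩ else u

theorem collapse_coe {K : Set V} (u x : K) : collapse K u x = x := by simp [collapse]

theorem collapse_of_notMem {K : Set V} (u : K) {x : V} (h : x ∉ K) : collapse K u x = u := by
  simp [collapse, h]

theorem collapse_reachable {G : SimpleGraph V} {K : Set V} {u : K} {H : SimpleGraph K}
    (hK : ∀ x ∈ K, ∀ y ∉ K, G.Adj x y → x = u) (hH : ∀ x y : K, G.Adj x y → H.Adj x y)
    {x y : V} (h : G.Reachable x y) : H.Reachable (collapse K u x) (collapse K u y) := by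
  refine h.map_of_adj fun x y hxy => ?_
  by_cases hx : x ∈ K <;> by_cases hy : y ∈ K
  · lift x to K using hx
    lift y to K using hy
    rw [collapse_coe, collapse_coe]
    exact (hH x y hxy).reachable
  · obtain rfl := hK x hx y hy hxy
    rw [collapse_coe, collapse_of_notMem u hy]
  · obtain rfl := hK y hy x hx hxy.symm
    rw [collapse_coe, collapse_of_notMem u hx]
  · rw [collapse_of_notMem u hx, collapse_of_notMem u hy]

theorem connected_induce_of_crossing {G : SimpleGraph V} {K : Set V} {u : V} (hu : u ∈ K)
    (hK : ∀ x ∈ K, ∀ y ∉ K, G.Adj x y → x = u) (hG : G.Connected) : (G.induce K).Connected := by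
  lift u to K using hu
  have : Nonempty K := ⟨u⟩
  refine ⟨fun x y => ?_⟩
  have := collapse_reachable (H := G.induce K) hK (fun x y h => h) (hG.preconnected x y)
  rwa [collapse_coe, collapse_coe] at this

theorem isBridge_of_induce {G : SimpleGraph V} {K : Set V} {u : V} (hu : u ∈ K)
    (hK : ∀ x ∈ K, ∀ y ∉ K, G.Adj x y → x = u) (hG : (G.induce K).IsAcyclic) {x y : V}
    (hx : x ∈ K) (hy : y ∈ K) (hxy : G.Adj x y) : G.IsBridge s(x, y) := by
  lift u to K using hu
  lift x to K using hx
  lift y to K using hy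
  rw [SimpleGraph.isBridge_iff]
  intro h
  have hb := SimpleGraph.isAcyclic_iff_forall_adj_isBridge.1 hG (v := x) (w := y) hxy
  rw [SimpleGraph.isBridge_iff] at hb
  apply hb
  have := collapse_reachable (K := K) (u := u)
    (H := (G.induce K).deleteEdges {s(x, y)}) (fun a ha b hb hab => ?_) (fun a b hab => ?_) h
  · rwa [collapse_coe, collapse_coe] at this
  · exact hK a ha b hb (SimpleGraph.deleteEdges_le _ hab)
  · simpa [SimpleGraph.deleteEdges_adj, Subtype.ext_iff] using hab

theorem isTree_iff_of_crossing {G : SimpleGraph V} {K : Set V} {u w : V} (hu : u ∈ K)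
    (hw : w ∉ K) (huw : G.Adj u w) (hK : ∀ x ∈ K, ∀ y ∉ K, G.Adj x y → x = u ∧ y = w) :
    G.IsTree ↔ (G.induce K).IsTree ∧ (G.induce Kᶜ).IsTree := by
  have hK1 : ∀ x ∈ K, ∀ y ∉ K, G.Adj x y → x = u := fun x hx y hy h => (hK x hx y hy h).1
  have hK2 : ∀ x ∈ Kᶜ, ∀ y ∉ Kᶜ, G.Adj x y → x = w :=
    fun x hx y hy h => (hK y (not_not.1 hy) x hx h.symm).2
  refine ⟨fun h => ⟨⟨connected_induce_of_crossing hu hK1 h.connected, h.isAcyclic.induce _⟩,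
    ⟨connected_induce_of_crossing hw hK2 h.connected, h.isAcyclic.induce _⟩⟩,
    fun ⟨h1, h2⟩ => ⟨?_, ?_⟩⟩
  · have key : ∀ x, G.Reachable u x := by
      intro x
      by_cases hx : x ∈ K
      · exact (h1.connected.preconnected ⟨u, hu⟩ ⟨x, hx⟩).map
          (SimpleGraph.Embedding.induce K).toHom
      · exact huw.reachable.trans ((h2.connected.preconnected ⟨w, hw⟩ ⟨x, hx⟩).map
          (SimpleGraph.Embedding.induce Kᶜ).toHom)
    have : Nonempty V := ⟨u⟩
    exact ⟨fun x y => (key x).symm.trans (key y)⟩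
  · have cross : G.IsBridge s(u, w) := by
      rw [SimpleGraph.isBridge_iff]
      intro h
      refine hw (h.mem_of_adj (S := K) (fun x y hxy hx => ?_) hu)
      by_contra hy
      rw [SimpleGraph.deleteEdges_adj] at hxy
      obtain ⟨rfl, rfl⟩ := hK x hx y hy hxy.1
      exact hxy.2 rfl
    rw [SimpleGraph.isAcyclic_iff_forall_adj_isBridge]
    intro x y hxy
    by_cases hx : x ∈ K <;> by_cases hy : y ∈ K
    · exact isBridge_of_induce hu hK1 h1.isAcyclic hx hy hxy
    · obtain ⟨rfl, rfl⟩ := hK x hx y hy hxy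
      exact cross
    · obtain ⟨rfl, rfl⟩ := hK y hy x hx hxy.symm
      rwa [Sym2.eq_swap]
    · exact isBridge_of_induce hw hK2 h2.isAcyclic hx hy hxy

/-- The vertices reachable from `v` without entering `b`. -/
def branch (T : SimpleGraph V) (b v : V) : Set V :=
  {x | Relation.ReflTransGen (fun x y => T.Adj x y ∧ y ≠ b) v x}

theorem mem_branch_self (T : SimpleGraph V) (b v : V) : v ∈ branch T b v :=
  Relation.ReflTransGen.refl

theorem mem_branch_of_adj {T : SimpleGraph V} {b v x y : V} (hx : x ∈ branch T b v)
    (h : T.Adj x y) (hy : y ≠ b) : y ∈ branch T b v :=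
  Relation.ReflTransGen.tail hx ⟨h, hy⟩

theorem notMem_branch {b v : V} (T : SimpleGraph V) (h : v ≠ b) : b ∉ branch T b v := by
  intro hb
  obtain hb | ⟨c, -, hc⟩ := Relation.ReflTransGen.cases_tail hb
  · exact h hb.symm
  · exact hc.2 rfl

theorem branch_eq {T : SimpleGraph V} {b v : V} {K : Set V} (hv : v ∈ K) (hb : b ∉ K)
    (hK : (T.induce K).Connected) (hcl : ∀ x ∈ K, ∀ y ∉ K, T.Adj x y → y = b) :
    branch T b v = K := by
  ext x
  refine ⟨fun hx => ?_, fun hx => ?_⟩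
  · induction hx with
    | refl => exact hv
    | tail _ h ih =>
      by_contra hy
      exact h.2 (hcl _ ih _ hy h.1)
  · have h := hK.preconnected ⟨v, hv⟩ ⟨x, hx⟩
    rw [SimpleGraph.reachable_iff_reflTransGen] at h
    refine h.lift (p := fun x y => T.Adj x y ∧ y ≠ b) Subtype.val fun a c hac => ⟨hac, ?_⟩
    rintro rfl
    exact hb c.2

theorem connected_induce_branch (T : SimpleGraph V) {b v : V} :
    (T.induce (branch T b v)).Connected := by
  have key : ∀ x (hx : x ∈ branch T b v), (T.induce (branch T b v)).Reachable
      ⟨v, mem_branch_self T b v⟩ ⟨x, hx⟩ := by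
    intro x hx
    induction hx with
    | refl => exact .refl _
    | @tail c d hc h ih =>
      exact ih.trans (SimpleGraph.Adj.reachable h.1)
  have : Nonempty (branch T b v) := ⟨⟨v, mem_branch_self T b v⟩⟩
  exact ⟨fun x y => (key x x.2).symm.trans (key y y.2)⟩

theorem existsUnique_mem_branch_adj {T : SimpleGraph V} (hT : T.IsTree) {b v : V} (h : v ≠ b) :
    ∃! u, u ∈ branch T b v ∧ T.Adj u b := by
  apply existsUnique_of_exists_of_unique
  · by_contra! hno
    refine notMem_branch T h ((hT.connected.preconnected v b).mem_of_adj (fun x y hxy hx => ?_)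
      (mem_branch_self T b v))
    refine mem_branch_of_adj hx hxy ?_
    rintro rfl
    exact hno x hx hxy
  · rintro u u' ⟨hu, hub⟩ ⟨hu', hub'⟩
    by_contra hne
    have hbr := SimpleGraph.isAcyclic_iff_forall_adj_isBridge.1 hT.isAcyclic hub
    rw [SimpleGraph.isBridge_iff] at hbr
    have hb := notMem_branch T h
    have h1 : (T.deleteEdges {s(u, b)}).Reachable u u' := by
      refine ((connected_induce_branch T).preconnected ⟨u, hu⟩ ⟨u', hu'⟩).map_of_adj
        (f := Subtype.val) fun x y hxy => SimpleGraph.Adj.reachable ?_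
      rw [SimpleGraph.deleteEdges_adj]
      refine ⟨hxy, fun he => ?_⟩
      rw [Set.mem_singleton_iff, Sym2.eq_iff] at he
      obtain ⟨-, he⟩ | ⟨he, -⟩ := he
      · exact ne_of_mem_of_not_mem y.2 hb he
      · exact ne_of_mem_of_not_mem x.2 hb he
    refine hbr (h1.trans (SimpleGraph.Adj.reachable ?_))
    rw [SimpleGraph.deleteEdges_adj]
    refine ⟨hub', fun he => ?_⟩
    rw [Set.mem_singleton_iff, Sym2.eq_iff] at he
    obtain ⟨rfl, -⟩ | ⟨rfl, -⟩ := he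
    exacts [hne rfl, hb hu']

end TreeSplitting

section AlternatingTrees

/-- The alternating trees on a linearly ordered vertex set. -/
def altTrees (V : Type*) [LinearOrder V] : Set (SimpleGraph V) :=
  {G | G.IsTree ∧ ∀ i j k, i < j → j < k → ¬(G.Adj i j ∧ G.Adj j k)}

/-- The alternating trees with a marked vertex all of whose neighbours are smaller. -/
def rightPairs (V : Type*) [LinearOrder V] : Set (SimpleGraph V × V) :=
  {p | p.1 ∈ altTrees V ∧ ∀ j, p.1.Adj p.2 j → j < p.2}

section Glue

variable {V : Type*}

/-- The disjoint union of a graph on `K` and a graph on `Kᶜ`, together with an edge from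
`u` to `b`. -/
def glue {K : Set V} (G : SimpleGraph K) (H : SimpleGraph (Kᶜ : Set V)) (u : K)
    (b : (Kᶜ : Set V)) : SimpleGraph V where
  Adj x y := (∃ (hx : x ∈ K) (hy : y ∈ K), G.Adj ⟨x, hx⟩ ⟨y, hy⟩) ∨
    (∃ (hx : x ∈ Kᶜ) (hy : y ∈ Kᶜ), H.Adj ⟨x, hx⟩ ⟨y, hy⟩) ∨ (x = u ∧ y = b) ∨ (x = b ∧ y = u)
  symm := ⟨by
    rintro x y (⟨hx, hy, h⟩ | ⟨hx, hy, h⟩ | h | h)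
    exacts [.inl ⟨hy, hx, h.symm⟩, .inr (.inl ⟨hy, hx, h.symm⟩), .inr (.inr (.inr h.symm)),
      .inr (.inr (.inl h.symm))]⟩
  loopless := ⟨by
    rintro x (⟨hx, hy, h⟩ | ⟨hx, hy, h⟩ | ⟨h, h'⟩ | ⟨h, h'⟩)
    exacts [h.ne rfl, h.ne rfl, b.2 (h'.symm.trans h ▸ u.2), b.2 (h.symm.trans h' ▸ u.2)]⟩

variable {K : Set V} {G G' : SimpleGraph K} {H H' : SimpleGraph (Kᶜ : Set V)} {u u' : K}
  {b : (Kᶜ : Set V)}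

theorem glue_adj_left (x y : K) : (glue G H u b).Adj x y ↔ G.Adj x y := by
  have := x.2
  have := y.2
  have := b.2
  simp only [glue]
  grind

theorem glue_adj_right (x y : (Kᶜ : Set V)) : (glue G H u b).Adj x y ↔ H.Adj x y := by
  have := x.2
  have := y.2
  have := u.2
  simp only [glue]
  grind

theorem glue_adj_cross {x y : V} (hx : x ∈ K) (hy : y ∉ K) :
    (glue G H u b).Adj x y ↔ x = u ∧ y = b := by
  have := u.2
  have := b.2
  simp only [glue]
  grind

theorem induce_glue_left : (glue G H u b).induce K = G := by
  ext x y
  exact glue_adj_left x y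

theorem induce_glue_right : (glue G H u b).induce Kᶜ = H := by
  ext x y
  exact glue_adj_right x y

theorem glue_mem_altTrees [LinearOrder V] (hb : ∀ x, b.1 ≤ x) (hG : (G, u) ∈ rightPairs K)
    (hH : H ∈ altTrees (Kᶜ : Set V)) : glue G H u b ∈ altTrees V := by
  refine ⟨(isTree_iff_of_crossing u.2 b.2 ((glue_adj_cross u.2 b.2).2 ⟨rfl, rfl⟩)
    fun x hx y hy h => (glue_adj_cross hx hy).1 h).2 ?_, ?_⟩
  · rw [induce_glue_left, induce_glue_right]
    exact ⟨hG.1.1, hH.1⟩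
  · rintro i j k hij hjk ⟨h1, h2⟩
    by_cases hj : j ∈ K
    · by_cases hk : k ∈ K
      · by_cases hi : i ∈ K
        · lift i to K using hi
          lift j to K using hj
          lift k to K using hk
          rw [glue_adj_left] at h1 h2
          exact hG.1.2 i j k hij hjk ⟨h1, h2⟩
        · obtain ⟨rfl, -⟩ := (glue_adj_cross hj hi).1 h1.symm
          lift k to K using hk
          rw [glue_adj_left] at h2
          exact (hG.2 k h2).not_gt hjk
      · obtain ⟨-, rfl⟩ := (glue_adj_cross hj hk).1 h2
        exact (hb j).not_gt hjk
    · by_cases hi : i ∈ K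
      · obtain ⟨-, rfl⟩ := (glue_adj_cross hi hj).1 h1
        exact (hb i).not_gt hij
      · by_cases hk : k ∈ K
        · obtain ⟨-, rfl⟩ := (glue_adj_cross hk hj).1 h2.symm
          exact (hb i).not_gt hij
        · exact hH.2 ⟨i, hi⟩ ⟨j, hj⟩ ⟨k, hk⟩ hij hjk
            ⟨(glue_adj_right ⟨i, hi⟩ ⟨j, hj⟩).1 h1, (glue_adj_right ⟨j, hj⟩ ⟨k, hk⟩).1 h2⟩

theorem branch_glue (v : K) (hG : G.Connected) : branch (glue G H u b) b v = K := by
  refine branch_eq v.2 b.2 ?_ fun x hx y hy h => ((glue_adj_cross hx hy).1 h).2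
  rwa [induce_glue_left]

theorem eq_glue {T : SimpleGraph V} (h : ∀ x ∈ K, ∀ y ∉ K, T.Adj x y ↔ x = u ∧ y = b) :
    glue (T.induce K) (T.induce Kᶜ) u b = T := by
  ext x y
  by_cases hx : x ∈ K <;> by_cases hy : y ∈ K
  · exact glue_adj_left ⟨x, hx⟩ ⟨y, hy⟩
  · rw [glue_adj_cross hx hy, h x hx y hy]
  · rw [SimpleGraph.adj_comm, glue_adj_cross hy hx, T.adj_comm, h y hy x hx]
  · exact glue_adj_right ⟨x, hx⟩ ⟨y, hy⟩

theorem card_altTrees_branch_eq [LinearOrder V] {v : V} (hv : v ∈ K) (hb : ∀ x, b.1 ≤ x) :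
    Nat.card {T : altTrees V // branch T.1 b v = K} =
      Nat.card (rightPairs K) * Nat.card (altTrees (Kᶜ : Set V)) := by
  rw [← Nat.card_prod]
  symm
  refine Nat.card_congr (Equiv.ofBijective (fun p => ⟨⟨glue p.1.1.1 p.2.1 p.1.1.2 b,
    glue_mem_altTrees hb p.1.2 p.2.2⟩, branch_glue ⟨v, hv⟩ p.1.2.1.1.connected⟩) ⟨?_, ?_⟩)
  · rintro ⟨⟨⟨G, u⟩, hG⟩, ⟨H, hH⟩⟩ ⟨⟨⟨G', u'⟩, hG'⟩, ⟨H', hH'⟩⟩ h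
    have h : glue G H u b = glue G' H' u' b := congrArg (fun T => T.1.1) h
    have h1 : G = G' := by rw [← induce_glue_left (G := G) (H := H) (u := u) (b := b), h,
      induce_glue_left]
    have h2 : H = H' := by rw [← induce_glue_right (G := G) (H := H) (u := u) (b := b), h,
      induce_glue_right]
    have h3 : (glue G' H' u' b).Adj u b := h ▸ (glue_adj_cross u.2 b.2).2 ⟨rfl, rfl⟩
    have h4 : u = u' := Subtype.ext ((glue_adj_cross u.2 b.2).1 h3).1
    simp only [h1, h2, h4]
  · rintro ⟨⟨T, hT⟩, hbr⟩
    replace hbr : branch T b v = K := hbr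
    obtain ⟨u, ⟨hu, hub⟩, huniq⟩ :=
      existsUnique_mem_branch_adj hT.1 (ne_of_mem_of_not_mem hv b.2)
    rw [hbr] at hu
    have hcr : ∀ x ∈ K, ∀ y ∉ K, T.Adj x y ↔ x = u ∧ y = b := by
      refine fun x hx y hy => ⟨fun hxy => ?_, ?_⟩
      · have hyb : y = b := by
          by_contra hne
          exact hy (hbr ▸ mem_branch_of_adj (hbr.symm ▸ hx) hxy hne)
        exact ⟨huniq x ⟨hbr.symm ▸ hx, hyb ▸ hxy⟩, hyb⟩
      · rintro ⟨rfl, rfl⟩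
        exact hub
    have htree := (isTree_iff_of_crossing hu b.2 hub fun x hx y hy => (hcr x hx y hy).1).1 hT.1
    refine ⟨⟨⟨⟨T.induce _, ⟨u, hu⟩⟩, ⟨htree.1, fun i j k hij hjk h => hT.2 i j k hij hjk h⟩,
      fun j hj => ?_⟩, ⟨T.induce _, htree.2, fun i j k hij hjk h => hT.2 i j k hij hjk h⟩⟩, ?_⟩
    · have hbu : b.1 < u := (hb u).lt_of_ne' (ne_of_mem_of_not_mem hu b.2)
      rcases lt_or_ge j ⟨u, hu⟩ with h | h
      · exact h
      · exact (hT.2 b u j hbu (h.lt_of_ne hj.ne) ⟨hub.symm, hj⟩).elim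
    · exact Subtype.ext (Subtype.ext (eq_glue hcr))

end Glue

section Counting

variable {V W : Type*} [LinearOrder V] [LinearOrder W]

theorem comap_mem_altTrees (e : V ≃o W) {G : SimpleGraph W} :
    G.comap e ∈ altTrees V ↔ G ∈ altTrees W := by
  refine and_congr (SimpleGraph.Iso.comap e.toEquiv G).isTree_iff
    ⟨fun h i j k hij hjk => ?_, fun h i j k hij hjk => ?_⟩
  · simpa using h (e.symm i) (e.symm j) (e.symm k) (by simpa) (by simpa)
  · exact h _ _ _ (e.lt_iff_lt.2 hij) (e.lt_iff_lt.2 hjk)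

theorem comap_rev_mem_altTrees {n : ℕ} {G : SimpleGraph (Fin n)} :
    G.comap Fin.rev ∈ altTrees (Fin n) ↔ G ∈ altTrees (Fin n) := by
  refine and_congr (SimpleGraph.Iso.comap Fin.revPerm G).isTree_iff
    ⟨fun h i j k hij hjk h' => ?_, fun h i j k hij hjk h' => ?_⟩
  · exact h k.rev j.rev i.rev (Fin.rev_lt_rev.2 hjk) (Fin.rev_lt_rev.2 hij)
      (by simpa [G.adj_comm, and_comm] using h')
  · exact h k.rev j.rev i.rev (Fin.rev_lt_rev.2 hjk) (Fin.rev_lt_rev.2 hij)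
      ⟨h'.2.symm, h'.1.symm⟩

theorem card_altTrees_congr (e : V ≃o W) : Nat.card (altTrees V) = Nat.card (altTrees W) :=
  Nat.card_congr (e.symm.toEquiv.simpleGraph.subtypeEquiv
    fun _ => (comap_mem_altTrees e).symm).symm

theorem card_rightPairs_congr (e : V ≃o W) :
    Nat.card (rightPairs V) = Nat.card (rightPairs W) := by
  refine Nat.card_congr ((e.symm.toEquiv.simpleGraph.prodCongr e.symm.toEquiv).subtypeEquiv
    fun p => ?_).symm
  refine and_congr (comap_mem_altTrees e).symm ⟨fun h j hj => ?_, fun h j hj => ?_⟩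
  · exact e.lt_symm_apply.2 (h (e j) (by simpa using hj))
  · simpa using h (e.symm j) (by simpa using hj)

theorem card_altTrees_of_card [Finite V] {n : ℕ} (h : Nat.card V = n) :
    Nat.card (altTrees V) = Nat.card (altTrees (Fin n)) := by
  have := Fintype.ofFinite V
  exact (card_altTrees_congr
    (Fintype.orderIsoFinOfCardEq V (Nat.card_eq_fintype_card.symm.trans h))).symm

theorem card_rightPairs_of_card [Finite V] {n : ℕ} (h : Nat.card V = n) :
    Nat.card (rightPairs V) = Nat.card (rightPairs (Fin n)) := by
  have := Fintype.ofFinite V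
  exact (card_rightPairs_congr
    (Fintype.orderIsoFinOfCardEq V (Nat.card_eq_fintype_card.symm.trans h))).symm

theorem card_altTrees_fin_one : Nat.card (altTrees (Fin 1)) = 1 := by
  have h : altTrees (Fin 1) = Set.univ := by
    refine Set.eq_univ_of_forall fun G => ⟨.of_subsingleton, fun i j k hij => ?_⟩
    exact (hij.ne (Subsingleton.elim i j)).elim
  rw [h, Nat.card_univ, Nat.card_unique]

theorem two_mul_card_rightPairs (m : ℕ) : 2 * Nat.card (rightPairs (Fin (m + 1))) =
    (m + 1) * Nat.card (altTrees (Fin (m + 1))) + if m = 0 then 1 else 0 := by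
  set R := rightPairs (Fin (m + 1)) with hR
  set L : Set (SimpleGraph (Fin (m + 1)) × Fin (m + 1)) :=
    {p | p.1 ∈ altTrees (Fin (m + 1)) ∧ ∀ j, p.1.Adj p.2 j → p.2 < j} with hL
  have hLR : Nat.card L = Nat.card R := by
    refine Nat.card_congr ((Fin.revPerm.simpleGraph.prodCongr Fin.revPerm).subtypeEquiv
      fun p => ?_)
    refine and_congr comap_rev_mem_altTrees.symm ⟨fun h j hj => ?_, fun h j hj => ?_⟩
    · exact Fin.lt_rev_iff.1 (h j.rev (by simpa using hj))
    · simpa using h j.rev (by simpa using hj)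
  have hunion : R ∪ L = altTrees (Fin (m + 1)) ×ˢ Set.univ := by
    ext ⟨G, v⟩
    refine ⟨fun h => ⟨h.elim And.left And.left, trivial⟩, fun ⟨h, _⟩ => ?_⟩
    by_contra hno
    have h1 : ¬∀ j, G.Adj v j → j < v := fun h' => hno (.inl ⟨h, h'⟩)
    have h2 : ¬∀ j, G.Adj v j → v < j := fun h' => hno (.inr ⟨h, h'⟩)
    push Not at h1 h2
    obtain ⟨k, hk, hvk⟩ := h1
    obtain ⟨i, hi, hiv⟩ := h2
    exact h.2 i v k (hiv.lt_of_ne hi.ne') (hvk.lt_of_ne hk.ne) ⟨hi.symm, hk⟩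
  have hinter : (R ∩ L).ncard = if m = 0 then 1 else 0 := by
    have hno : ∀ p ∈ R ∩ L, ∀ j, ¬p.1.Adj p.2 j := fun p hp j hj =>
      (hp.1.2 j hj).not_gt (hp.2.2 j hj)
    split_ifs with hm
    · subst hm
      have : Subsingleton (Fin (0 + 1)) := Fin.subsingleton_one
      rw [Set.ncard_eq_one]
      refine ⟨(⊥, 0), Set.eq_singleton_iff_unique_mem.2 ⟨?_, fun p _ => Subsingleton.elim _ _⟩⟩
      have hmem : (⊥ : SimpleGraph (Fin (0 + 1))) ∈ altTrees (Fin (0 + 1)) :=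
        ⟨.of_subsingleton, fun _ _ _ _ _ h => h.1⟩
      exact ⟨⟨hmem, fun _ h => h.elim⟩, hmem, fun _ h => h.elim⟩
    · have : Nontrivial (Fin (m + 1)) := Fin.nontrivial_iff_two_le.2 (by omega)
      rw [Set.ncard_eq_zero, Set.eq_empty_iff_forall_notMem]
      intro p hp
      obtain ⟨j, hj⟩ := hp.1.1.1.connected.preconnected.exists_adj_of_nontrivial p.2
      exact hno p hp j hj
  have h := Set.ncard_union_add_ncard_inter R L
  rw [hunion, hinter, Set.ncard_prod, Set.ncard_univ, Nat.card_fin, ← Nat.card_coe_set_eq,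
    ← Nat.card_coe_set_eq, ← Nat.card_coe_set_eq, hLR] at h
  rw [two_mul, ← h, mul_comm]

theorem card_altTrees_succ (n : ℕ) : Nat.card (altTrees (Fin (n + 2))) =
    ∑ m ∈ Finset.range (n + 1), n.choose m *
      (Nat.card (rightPairs (Fin (m + 1))) * Nat.card (altTrees (Fin (n - m + 1)))) := by
  classical
  let K (S : Finset (Fin n)) : Finset (Fin (n + 2)) :=
    insert (Fin.last (n + 1)) (S.map (Fin.castSuccEmb.trans (Fin.succEmb _)))
  have hK0 (S : Finset (Fin n)) : (0 : Fin (n + 2)) ∉ (K S : Set (Fin (n + 2))) := by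
    simp [K, Fin.ext_iff]
  have hKl (S : Finset (Fin n)) : Fin.last (n + 1) ∈ (K S : Set (Fin (n + 2))) := by simp [K]
  have hKi (S : Finset (Fin n)) (i : Fin n) :
      i.castSucc.succ ∈ (K S : Set (Fin (n + 2))) ↔ i ∈ S := by
    have h : i.castSucc.succ ≠ Fin.last (n + 1) := by simp [Fin.ext_iff, i.2.ne]
    simp [K, h]
  have hcard (S : Finset (Fin n)) : (K S).card = S.card + 1 := by
    rw [Finset.card_insert_of_notMem, Finset.card_map]
    simp [Fin.ext_iff, Fin.is_lt, Nat.ne_of_lt]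
  let f (T : altTrees (Fin (n + 2))) : Finset (Fin n) :=
    {i | i.castSucc.succ ∈ branch T.1 0 (Fin.last (n + 1))}
  have hne : Fin.last (n + 1) ≠ 0 := by simp
  have hf (S : Finset (Fin n)) (T : altTrees (Fin (n + 2))) :
      f T = S ↔ branch T.1 0 (Fin.last (n + 1)) = K S := by
    refine ⟨?_, fun h => ?_⟩
    · rintro rfl
      ext x
      induction x using Fin.cases with
      | zero => exact iff_of_false (notMem_branch T.1 hne) (hK0 _)
      | succ y =>
        induction y using Fin.lastCases with
        | last => exact iff_of_true (mem_branch_self T.1 0 _) (hKl _)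
        | cast i => simp [hKi, f]
    · ext i
      rw [← hKi S i, ← h]
      simp [f]
  rw [← Nat.card_congr (Equiv.sigmaFiberEquiv f), Nat.card_sigma,
    ← Finset.powerset_univ]
  have hfib (S : Finset (Fin n)) : Nat.card {T // f T = S} =
      Nat.card (rightPairs (Fin (S.card + 1))) * Nat.card (altTrees (Fin (n - S.card + 1))) := by
    rw [Nat.card_congr (Equiv.subtypeEquivRight (hf S)),
      card_altTrees_branch_eq (b := ⟨0, hK0 S⟩) (hKl S) fun x => Fin.zero_le x,
      card_rightPairs_of_card (n := S.card + 1), card_altTrees_of_card (n := n - S.card + 1)]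
    · have h := Set.ncard_add_ncard_compl (K S : Set (Fin (n + 2)))
      rw [Set.ncard_coe_finset, hcard, Nat.card_fin] at h
      rw [Nat.card_coe_set_eq]
      have := card_finset_fin_le S
      omega
    · rw [Nat.card_coe_set_eq, Set.ncard_coe_finset, hcard]
  simp_rw [hfib]
  rw [Finset.sum_powerset_apply_card (fun m => Nat.card (rightPairs (Fin (m + 1))) *
    Nat.card (altTrees (Fin (n - m + 1)))), Finset.card_univ, Fintype.card_fin]
  simp_rw [smul_eq_mul]

theorem two_mul_card_altTrees_succ (n : ℕ) :
    2 * Nat.card (altTrees (Fin (n + 2))) = ∑ k ∈ Finset.range (n + 1), n.choose k *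
      (Nat.card (altTrees (Fin (k + 1))) * ((n - k + 1) * Nat.card (altTrees (Fin (n - k + 1))) +
        if n - k = 0 then 1 else 0)) := by
  rw [card_altTrees_succ, Finset.mul_sum, ← Finset.sum_range_reflect]
  refine Finset.sum_congr rfl fun k hk => ?_
  rw [Finset.mem_range, Nat.lt_succ_iff] at hk
  rw [Nat.add_sub_cancel, Nat.choose_symm hk, Nat.sub_sub_self hk, ← two_mul_card_rightPairs]
  ring

end Counting

end AlternatingTrees

theorem card_linialSigns_eq_card_altTrees (n : ℕ) :
    Nat.card (linialSigns (Fin n)) = Nat.card (altTrees (Fin (n + 1))) := by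
  induction n using Nat.strong_induction_on with
  | _ n ih =>
    rcases n with _ | n
    · rw [card_linialSigns_fin_zero, card_altTrees_fin_one]
    · refine Nat.eq_of_mul_eq_mul_left two_pos ?_
      rw [two_mul_card_linialSigns_succ, two_mul_card_altTrees_succ]
      refine Finset.sum_congr rfl fun k hk => ?_
      rw [Finset.mem_range] at hk
      rw [ih k hk, ih (n - k) (by omega)]

/-- The number of regions of the Linial arrangement `x_i - x_j = 1` (`1 ≤ i < j ≤ n`)
in `V_{n-1}` equals the number of alternating trees on the vertex set
`{0, 1, ..., n}`. -/
theorem stmt9 (n : ℕ) (hn : 1 ≤ n) :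
    numRegions {x : Fin n → ℝ | (∑ i, x i) = 0 ∧
        ∀ i j : Fin n, i < j → x i - x j ≠ 1} =
      Nat.card {G : SimpleGraph (Fin (n + 1)) // G.IsTree ∧
        ∀ i j k : Fin (n + 1), i < j → j < k → ¬(G.Adj i j ∧ G.Adj j k)} := by
  rw [numRegions_linial, card_linialSigns_eq_card_altTrees]
  rfl
end

section
/- For n ≥ 1, the number of regions of the Linial arrangement L_{n-1} satisfies 2^n · r(L_{n-1}) = Σ_{k=0}^{n} binomial(n,k)·(k+1)^{n−1}. -/
section boxes

/-- Placements of the labels `0, …, n-1` into boxes `1, …, q` such that every label in a box is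
smaller than every label in the next box. -/
def boxings (q n : ℕ) : Finset (Fin n → ℕ) :=
  (Fintype.piFinset fun _ => Finset.Icc 1 q).filter fun x => ∀ i j, i < j → x i ≠ x j + 1

/-- Merge boxes `t` and `t + 1`. -/
def mergeBoxes {n : ℕ} (t : ℕ) (x : Fin n → ℕ) : Fin n → ℕ :=
  fun i => if x i ≤ t then x i else x i - 1

lemma mem_boxings {q n : ℕ} {x : Fin n → ℕ} :
    x ∈ boxings q n ↔ (∀ i, 1 ≤ x i ∧ x i ≤ q) ∧ ∀ i j, i < j → x i ≠ x j + 1 := by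
  simp [boxings]

/-- Insert an empty box at position `s`. -/
def insertBox {n : ℕ} (s : ℕ) (y : Fin n → ℕ) : Fin n → ℕ :=
  fun i => if y i < s then y i else y i + 1

lemma card_empty_merge (q n t s : ℕ) (hs : s = t ∨ s = t + 1) :
    ((boxings (q + 1) n).filter fun x => (∀ i, x i ≠ s) ∧ mergeBoxes t x ∈ boxings q n).card
      = (boxings q n).card := by
  refine Finset.card_nbij' (mergeBoxes t) (insertBox s) ?_ ?_ ?_ ?_
  · intro x hx
    simp only [Finset.coe_filter, Set.mem_ofPred_eq] at hx
    exact hx.2.2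
  · intro y hy
    have hy' : mergeBoxes t (insertBox s y) = y := by
      funext i
      simp only [mergeBoxes, insertBox]
      split_ifs <;> omega
    simp only [Finset.coe_filter, Set.mem_ofPred_eq, hy']
    have hy := mem_boxings.1 hy
    refine ⟨mem_boxings.2 ⟨fun i => ?_, fun i j hij => ?_⟩, fun i => ?_, mem_boxings.2 hy⟩
    · have := hy.1 i
      simp only [insertBox]; split_ifs <;> omega
    · have := hy.2 i j hij
      simp only [insertBox]; split_ifs <;> omega
    · simp only [insertBox]; split_ifs <;> omega
  · intro x hx
    simp only [Finset.coe_filter, Set.mem_ofPred_eq] at hx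
    funext i
    have := hx.2.1 i
    have := (mem_boxings.1 hx.1).1 i
    simp only [mergeBoxes, insertBox]
    split_ifs <;> omega
  · intro y hy
    funext i
    simp only [mergeBoxes, insertBox]
    split_ifs <;> omega

/-- Cut box `t` after the label `a`. -/
def cutBox {n : ℕ} (t : ℕ) (a : Fin n) (y : Fin n → ℕ) : Fin n → ℕ :=
  fun i => if y i < t ∨ (y i = t ∧ i ≤ a) then y i else y i + 1

lemma mergeBoxes_cutBox {n : ℕ} (t : ℕ) (a : Fin n) (y : Fin n → ℕ) :
    mergeBoxes t (cutBox t a y) = y := by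
  funext i
  simp only [mergeBoxes, cutBox]
  split_ifs <;> omega

lemma card_nonempty_merge (q n t : ℕ) :
    ((boxings (q + 1) n).filter fun x => (∃ i, x i = t) ∧ mergeBoxes t x ∈ boxings q n).card
      = ∑ a, ((boxings q n).filter fun y => y a = t).card := by
  rw [← Finset.card_sigma]
  symm
  refine Finset.card_bij (fun p _ => cutBox t p.1 p.2) ?_ ?_ ?_
  · rintro ⟨a, y⟩ h
    simp only [Finset.mem_sigma, Finset.mem_univ, true_and, Finset.mem_filter] at h
    simp only [Finset.mem_filter, mergeBoxes_cutBox]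
    have hy := mem_boxings.1 h.1
    refine ⟨mem_boxings.2 ⟨fun i => ?_, fun i j hij => ?_⟩, ⟨a, by simp [cutBox, h.2]⟩, h.1⟩
    · have := hy.1 i
      simp only [cutBox]; split_ifs <;> omega
    · have := hy.2 i j hij
      simp only [cutBox]; split_ifs <;> omega
  · rintro ⟨a, y⟩ h ⟨b, z⟩ h' heq
    simp only [Finset.mem_sigma, Finset.mem_univ, true_and, Finset.mem_filter] at h h'
    have hyz : y = z := by
      rw [← mergeBoxes_cutBox t a y, heq, mergeBoxes_cutBox]
    subst hyz
    have h1 := congrFun heq a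
    have h2 := congrFun heq b
    simp only [cutBox, h.2, h'.2, le_refl, and_true, true_and, lt_irrefl, or_true, if_true,
      false_or] at h1 h2
    have : a = b := by
      split_ifs at h1 h2 <;> omega
    rw [this]
  · intro x hx
    simp only [Finset.mem_filter] at hx
    obtain ⟨hx, ⟨i, hi⟩, hm⟩ := hx
    have hne : (Finset.univ.filter fun i => x i = t).Nonempty := ⟨i, by simp [hi]⟩
    obtain ⟨a, ha, hmax⟩ := Finset.exists_max_image _ id hne
    simp only [Finset.mem_filter, Finset.mem_univ, true_and, id] at ha hmax
    refine ⟨⟨a, mergeBoxes t x⟩, ?_, ?_⟩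
    · simp [hm, mergeBoxes, ha]
    · funext k
      have h1 := hmax k
      have h2 := (mem_boxings.1 hx).2 k a
      simp only [mergeBoxes, cutBox]
      split_ifs <;> grind

lemma mergeBoxes_mem {q n t : ℕ} (h1 : 1 ≤ t) (ht : t ≤ q) {x : Fin n → ℕ}
    (hx : x ∈ boxings (q + 1) n)
    (h : ((∀ i, x i ≠ t) ∧ ∀ i, x i ≠ t + 1) ∨ ((∃ i, x i = t) ∧ ∃ i, x i = t + 1)) :
    mergeBoxes t x ∈ boxings q n := by
  have hx := mem_boxings.1 hx
  refine mem_boxings.2 ⟨fun i => ?_, fun i j hij => ?_⟩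
  · have := hx.1 i
    simp only [mergeBoxes]; split_ifs <;> omega
  · have := hx.2 i j hij
    have := hx.1 i
    have := hx.1 j
    rcases h with h | ⟨⟨a, ha⟩, b, hb⟩
    · have := h.1 i
      have := h.1 j
      have := h.2 i
      have := h.2 j
      simp only [mergeBoxes]; split_ifs <;> omega
    · have := hx.2 i a
      have := hx.2 a i
      have := hx.2 b i
      have := hx.2 i b
      have := hx.2 j a
      have := hx.2 a j
      have := hx.2 b j
      have := hx.2 j b
      have := hx.2 a b
      simp only [mergeBoxes]; split_ifs <;> omega

/-- The number of placements leaving box `s` empty. -/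
def emptyCount (q n s : ℕ) : ℕ := ((boxings q n).filter fun x => ∀ i, x i ≠ s).card

lemma emptyCount_add_succ {q n t : ℕ} (h1 : 1 ≤ t) (ht : t ≤ q) :
    emptyCount (q + 1) n t + emptyCount (q + 1) n (t + 1)
        + ∑ a, ((boxings q n).filter fun y => y a = t).card
      = (boxings (q + 1) n).card + (boxings q n).card := by
  rw [← card_nonempty_merge q n t, ← card_empty_merge q n t (t + 1) (Or.inr rfl),
    emptyCount, emptyCount]
  simp only [Finset.card_filter]
  rw [Finset.card_eq_sum_ones, ← Finset.sum_add_distrib, ← Finset.sum_add_distrib,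
    ← Finset.sum_add_distrib]
  refine Finset.sum_congr rfl fun x hx => ?_
  have h := mergeBoxes_mem h1 ht hx
  have e (s : ℕ) : (∃ i, x i = s) ↔ ¬ ∀ i, x i ≠ s := by simp
  simp only [e] at h ⊢
  split_ifs <;> first | rfl | (exfalso; tauto)

lemma emptyCount_one (q n : ℕ) : emptyCount (q + 1) n 1 = (boxings q n).card := by
  rw [← card_empty_merge q n 0 1 (Or.inr rfl), emptyCount]
  congr 1
  refine Finset.filter_congr fun x hx => ?_
  rw [iff_self_and]
  intro h
  have hx := mem_boxings.1 hx
  refine mem_boxings.2 ⟨fun i => ?_, fun i j hij => ?_⟩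
  · have := hx.1 i
    have := h i
    simp only [mergeBoxes]; split_ifs <;> omega
  · have := hx.2 i j hij
    have := hx.1 i
    have := hx.1 j
    simp only [mergeBoxes]; split_ifs <;> omega

lemma emptyCount_last (q n : ℕ) : emptyCount (q + 1) n (q + 1) = (boxings q n).card := by
  rw [emptyCount]
  congr 1
  ext x
  simp only [Finset.mem_filter, mem_boxings]
  constructor
  · rintro ⟨⟨h1, h2⟩, h3⟩
    exact ⟨fun i => by have := h1 i; have := h3 i; omega, h2⟩
  · rintro ⟨h1, h2⟩
    exact ⟨⟨fun i => by have := h1 i; omega, h2⟩, fun i => by have := h1 i; omega⟩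

lemma emptyCount_out (q n : ℕ) : emptyCount q n (q + 1) = (boxings q n).card := by
  rw [emptyCount, Finset.filter_true_of_mem]
  intro x hx i
  have := (mem_boxings.1 hx).1 i
  omega

lemma card_boxings_succ (q n : ℕ) :
    (boxings q (n + 1)).card = ∑ s ∈ Finset.Icc 1 q, emptyCount q n (s + 1) := by
  unfold emptyCount
  rw [← Finset.card_sigma]
  refine Finset.card_nbij' (fun x => ⟨x (Fin.last n), Fin.init x⟩)
    (fun p => Fin.snoc p.2 p.1) ?_ ?_ ?_ ?_
  · intro x hx
    have hx := mem_boxings.1 hx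
    simp only [Finset.coe_sigma, Set.mem_sigma_iff, Finset.coe_filter, Set.mem_ofPred_eq,
      Finset.coe_Icc, Set.mem_Icc, mem_boxings]
    exact ⟨hx.1 _, ⟨fun i => hx.1 _, fun i j hij => hx.2 _ _ (by simpa using hij)⟩,
      fun i => hx.2 _ _ (Fin.castSucc_lt_last i)⟩
  · rintro ⟨s, y⟩ h
    simp only [Finset.coe_sigma, Set.mem_sigma_iff, Finset.coe_filter, Set.mem_ofPred_eq,
      Finset.coe_Icc, Set.mem_Icc, mem_boxings] at h
    refine Finset.mem_coe.2 (mem_boxings.2 ⟨fun i => ?_, fun i j hij => ?_⟩)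
    · refine Fin.lastCases ?_ (fun i => ?_) i
      · simpa using h.1
      · simpa using h.2.1.1 i
    · revert hij
      refine Fin.lastCases ?_ (fun j => ?_) j <;> refine Fin.lastCases ?_ (fun i => ?_) i
      · simp
      · simpa using h.2.2 i
      · intro hij
        exact absurd (Fin.castSucc_lt_last j) (not_lt.2 hij.le)
      · simpa using h.2.1.2 i j
  · intro x _
    simp
  · rintro ⟨s, y⟩ _
    simp

lemma sum_card_boxings_eq (q n : ℕ) :
    ∑ t ∈ Finset.Icc 1 q, ∑ a, ((boxings q n).filter fun y => y a = t).card
      = n * (boxings q n).card := by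
  rw [Finset.sum_comm]
  rw [Finset.sum_congr rfl (g := fun _ => (boxings q n).card)]
  · simp
  · intro a _
    rw [← Finset.card_eq_sum_card_fiberwise]
    intro x hx
    have := (mem_boxings.1 hx).1 a
    simpa using this

lemma two_mul_card_boxings_succ (q n : ℕ) :
    2 * ((boxings (q + 1) (n + 1)).card : ℤ)
      = (q + 2) * (boxings (q + 1) n).card + (q - n) * (boxings q n).card := by
  have h1 := Finset.sum_congr (rfl : Finset.Icc 1 q = _) fun t ht =>
    emptyCount_add_succ (n := n) (Finset.mem_Icc.1 ht).1 (Finset.mem_Icc.1 ht).2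
  rw [Finset.sum_add_distrib, Finset.sum_add_distrib, sum_card_boxings_eq] at h1
  have h2 := card_boxings_succ (q + 1) n
  rw [Finset.sum_Icc_succ_top (by omega), emptyCount_out] at h2
  have h3 : ∑ t ∈ Finset.Icc 1 q, emptyCount (q + 1) n t
      = ∑ t ∈ Finset.Icc 1 q, emptyCount (q + 1) n (t + 1) := by
    have h4 := Finset.sum_range_succ (fun t => emptyCount (q + 1) n (t + 1)) q
    rw [Finset.sum_range_succ', emptyCount_one, emptyCount_last] at h4
    have h5 (f : ℕ → ℕ) : ∑ t ∈ Finset.Icc 1 q, f t = ∑ t ∈ Finset.range q, f (t + 1) := by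
      rw [Finset.range_eq_Ico, Finset.sum_Ico_add' f 0 q 1]
      rfl
    rw [h5, h5]
    omega
  rw [h3] at h1
  simp only [Finset.sum_const, Nat.card_Icc, smul_eq_mul, Nat.add_sub_cancel] at h1
  zify at h1 h2
  linear_combination 2 * h2 + h1

/-- `binomSum m k q = ∑ i, (m choose i) (q - i) ^ k`. -/
def binomSum (m k : ℕ) (q : ℤ) : ℤ := ∑ i ∈ Finset.range (m + 1), (m.choose i : ℤ) * (q - i) ^ k

lemma binomSum_succ (m k : ℕ) (q : ℤ) :
    binomSum (m + 1) k q = binomSum m k q + binomSum m k (q - 1) := by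
  unfold binomSum
  rw [Finset.sum_range_succ', Finset.sum_congr rfl (g := fun i : ℕ =>
    (m.choose i : ℤ) * (q - 1 - i) ^ k + (m.choose (i + 1) : ℤ) * (q - (i + 1 : ℕ)) ^ k)]
  · rw [Finset.sum_add_distrib, Finset.sum_range_succ (fun i : ℕ => (m.choose (i + 1) : ℤ) * _),
      Finset.sum_range_succ' (fun i : ℕ => (m.choose i : ℤ) * (q - i) ^ k)]
    simp
    ring
  · intro i _
    rw [Nat.choose_succ_succ]
    push_cast
    ring

lemma binomSum_succ_succ (m k : ℕ) (q : ℤ) :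
    binomSum (m + 1) (k + 1) q
      = q * binomSum (m + 1) k q - (m + 1) * binomSum m k (q - 1) := by
  unfold binomSum
  rw [Finset.sum_range_succ', Finset.sum_range_succ' (fun i : ℕ => ((m + 1).choose i : ℤ) * _ ^ k),
    mul_add, Finset.mul_sum, Finset.mul_sum, add_sub_right_comm, ← Finset.sum_sub_distrib]
  congr 1
  · refine Finset.sum_congr rfl fun i _ => ?_
    have h : ((m + 1 : ℕ) : ℤ) * m.choose i = (m + 1).choose (i + 1) * ((i + 1 : ℕ) : ℤ) := by
      exact_mod_cast Nat.add_one_mul_choose_eq m i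
    push_cast at h ⊢
    have : (q - 1 - (i : ℤ)) = q - (i + 1) := by ring
    rw [this]
    linear_combination (q - (i + 1)) ^ k * h
  · simp
    ring

lemma card_boxings (n q : ℕ) (h : n ≤ q) :
    2 ^ (n + 1) * ((boxings q n).card : ℤ) = binomSum (n + 1) n (q + 1) := by
  induction n generalizing q with
  | zero =>
    have : boxings q 0 = Finset.univ := by
      ext x
      simp only [mem_boxings, Finset.mem_univ, iff_true]
      exact ⟨fun i => i.elim0, fun i => i.elim0⟩
    simp [this, binomSum, Finset.sum_range_succ]
  | succ n ih =>
    obtain ⟨q, rfl⟩ : ∃ p, q = p + 1 := ⟨q - 1, by omega⟩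
    have h1 := ih (q + 1) (by omega)
    have h2 := ih q (by omega)
    rw [binomSum_succ_succ, binomSum_succ]
    push_cast at h1 ⊢
    rw [show (q : ℤ) + 1 + 1 - 1 = q + 1 by ring, ← h1, ← h2]
    linear_combination 2 ^ (n + 1) * two_mul_card_boxings_succ q n

end boxes

section gain

open Polynomial

variable {ι : Type} {R : Type*} [CommRing R]

/-- The complement in `R ^ ι` of the hyperplanes `x i - x j = c`, for `(i, j, c) ∈ L`. -/
def gainCompl (R : Type*) [CommRing R] (L : List (ι × ι × ℤ)) : Set (ι → R) :=
  {x | ∀ e ∈ L, x e.1 - x e.2.1 ≠ (e.2.2 : R)}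

lemma gainCompl_cons (e : ι × ι × ℤ) (L : List (ι × ι × ℤ)) :
    gainCompl R (e :: L) = gainCompl R L ∩ {x | x e.1 - x e.2.1 ≠ (e.2.2 : R)} := by
  ext x
  simp [gainCompl, and_comm]

/-- The side of each hyperplane on which a point lies. -/
noncomputable def gainSigns (L : List (ι × ι × ℤ)) (x : ι → ℝ) : List Bool :=
  L.map fun e => decide ((e.2.2 : ℝ) < x e.1 - x e.2.1)

lemma gainSigns_cons (e : ι × ι × ℤ) (L : List (ι × ι × ℤ)) (x : ι → ℝ) :
    gainSigns (e :: L) x = decide ((e.2.2 : ℝ) < x e.1 - x e.2.1) :: gainSigns L x := rfl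

lemma gainSigns_eq_iff {L : List (ι × ι × ℤ)} {x y : ι → ℝ} :
    gainSigns L x = gainSigns L y ↔
      ∀ e ∈ L, ((e.2.2 : ℝ) < x e.1 - x e.2.1 ↔ (e.2.2 : ℝ) < y e.1 - y e.2.1) := by
  simp [gainSigns, List.map_inj_left]

lemma finite_image_gainSigns (L : List (ι × ι × ℤ)) (s : Set (ι → ℝ)) :
    (gainSigns L '' s).Finite := by
  refine (List.finite_length_eq Bool L.length).subset ?_
  rintro _ ⟨x, _, rfl⟩
  simp [gainSigns]

lemma eventually_gainSigns_eq (L : List (ι × ι × ℤ)) {x : ι → ℝ} (hx : x ∈ gainCompl ℝ L) :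
    ∀ᶠ y in nhds x, y ∈ gainCompl ℝ L ∧ gainSigns L y = gainSigns L x := by
  induction L with
  | nil => simp [gainCompl, gainSigns]
  | cons e L ih =>
    rw [gainCompl_cons] at hx
    have hc : Continuous fun y : ι → ℝ => y e.1 - y e.2.1 := by fun_prop
    rcases lt_or_gt_of_ne hx.2 with h | h
    · filter_upwards [ih hx.1, hc.continuousAt.eventually_lt_const h] with y hy hlt
      rw [gainCompl_cons, gainSigns_cons, gainSigns_cons, hy.2]
      refine ⟨⟨hy.1, hlt.ne⟩, ?_⟩
      simp only [not_lt.2 hlt.le, not_lt.2 h.le]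
    · filter_upwards [ih hx.1, hc.continuousAt.eventually_const_lt h] with y hy hlt
      rw [gainCompl_cons, gainSigns_cons, gainSigns_cons, hy.2]
      refine ⟨⟨hy.1, hlt.ne'⟩, ?_⟩
      have h' : (e.2.2 : ℝ) < x e.1 - x e.2.1 := h
      simp [hlt, h']

lemma segment_subset_gainCompl {L : List (ι × ι × ℤ)} {x y : ι → ℝ}
    (hx : x ∈ gainCompl ℝ L) (hy : y ∈ gainCompl ℝ L) (h : gainSigns L x = gainSigns L y) :
    segment ℝ x y ⊆ {z | z ∈ gainCompl ℝ L ∧ gainSigns L z = gainSigns L x} := by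
  rintro _ ⟨a, b, ha, hb, hab, rfl⟩
  rw [gainSigns_eq_iff] at h
  have key : ∀ e ∈ L,
      (((e.2.2 : ℝ) < x e.1 - x e.2.1) ∧
        (e.2.2 : ℝ) < (a • x + b • y) e.1 - (a • x + b • y) e.2.1) ∨
      ((x e.1 - x e.2.1 < (e.2.2 : ℝ)) ∧
        (a • x + b • y) e.1 - (a • x + b • y) e.2.1 < (e.2.2 : ℝ)) := by
    intro e he
    have h1 := hx e he
    have h2 := hy e he
    have h3 := h e he
    have heq : (a • x + b • y) e.1 - (a • x + b • y) e.2.1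
        = a * (x e.1 - x e.2.1) + b * (y e.1 - y e.2.1) := by
      simp
      ring
    rw [heq]
    rcases lt_or_gt_of_ne h1 with h4 | h4
    · right
      have h5 : y e.1 - y e.2.1 < e.2.2 :=
        lt_of_le_of_ne (not_lt.1 fun h5 => absurd (h3.2 h5) (not_lt.2 h4.le)) h2
      exact ⟨h4, convex_Iio (e.2.2 : ℝ) (Set.mem_Iio.2 h4) (Set.mem_Iio.2 h5) ha hb hab⟩
    · exact Or.inl ⟨h4, convex_Ioi (e.2.2 : ℝ) (Set.mem_Ioi.2 h4) (Set.mem_Ioi.2 (h3.1 h4)) ha hb hab⟩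
  refine ⟨fun e he => ?_, gainSigns_eq_iff.2 fun e he => ?_⟩
  · rcases key e he with h | h
    · exact h.2.ne'
    · exact h.2.ne
  · rcases key e he with h | h
    · simp only [h.1, h.2]
    · simp only [not_lt.2 h.1.le, not_lt.2 h.2.le]

/-- The number of sign vectors realised by points off the hyperplanes. -/
noncomputable def gainRegions (L : List (ι × ι × ℤ)) : ℕ :=
  (gainSigns L '' gainCompl ℝ L).ncard

/-- Deletion and restriction: each cell met by the hyperplane `x i - x j = c` is cut in two. -/
lemma gainRegions_cons (i j : ι) (hij : i ≠ j) (c : ℤ) (L : List (ι × ι × ℤ)) :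
    gainRegions ((i, j, c) :: L) = gainRegions L +
      (gainSigns L '' (gainCompl ℝ L ∩ {x | x i - x j = (c : ℝ)})).ncard := by
  classical
  set P := gainSigns L '' (gainCompl ℝ L ∩ {x | (c : ℝ) < x i - x j}) with hP
  set N := gainSigns L '' (gainCompl ℝ L ∩ {x | x i - x j < (c : ℝ)}) with hN
  have move : ∀ x ∈ gainCompl ℝ L, x i - x j = c → gainSigns L x ∈ P ∩ N := by
    intro x hx hxc
    have hev := eventually_gainSigns_eq L hx
    have hcont : Continuous fun ε : ℝ => Function.update x i (x i + ε) := by fun_prop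
    have h0 : Filter.Tendsto (fun ε : ℝ => Function.update x i (x i + ε)) (nhds 0) (nhds x) := by
      have := hcont.tendsto 0
      simpa using this
    have h1 := h0.eventually hev
    obtain ⟨δ, hδ, hball⟩ := Metric.eventually_nhds_iff.1 h1
    constructor
    · obtain ⟨h2, h3⟩ := @hball (δ / 2) (by
        rw [dist_zero_right, Real.norm_eq_abs, abs_of_pos (by linarith)]; linarith)
      refine ⟨_, ⟨h2, ?_⟩, h3⟩
      simp only [Set.mem_ofPred_eq, Function.update_self, Function.update_of_ne hij.symm]
      linarith
    · obtain ⟨h2, h3⟩ := @hball (-(δ / 2)) (by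
        rw [dist_zero_right, Real.norm_eq_abs, abs_neg, abs_of_pos (by linarith)]; linarith)
      refine ⟨_, ⟨h2, ?_⟩, h3⟩
      simp only [Set.mem_ofPred_eq, Function.update_self, Function.update_of_ne hij.symm]
      linarith
  have hunion : P ∪ N = gainSigns L '' gainCompl ℝ L := by
    apply Set.Subset.antisymm
    · exact Set.union_subset (Set.image_mono Set.inter_subset_left)
        (Set.image_mono Set.inter_subset_left)
    · rintro _ ⟨x, hx, rfl⟩
      rcases lt_trichotomy (x i - x j) c with h | h | h
      · exact Or.inr ⟨x, ⟨hx, h⟩, rfl⟩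
      · exact Or.inl (move x hx h).1
      · exact Or.inl ⟨x, ⟨hx, h⟩, rfl⟩
  have hinter : P ∩ N = gainSigns L '' (gainCompl ℝ L ∩ {x | x i - x j = (c : ℝ)}) := by
    apply Set.Subset.antisymm
    · rintro _ ⟨⟨x, ⟨hx, hxc⟩, rfl⟩, y, ⟨hy, hyc⟩, hxy⟩
      have hseg := segment_subset_gainCompl hx hy hxy.symm
      have hcont : ContinuousOn (fun z : ι → ℝ => z i - z j) (segment ℝ x y) := by fun_prop
      obtain ⟨z, hz, hzc⟩ := (convex_segment x y).isPreconnected.intermediate_value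
        (right_mem_segment ℝ x y) (left_mem_segment ℝ x y) hcont
        (show (c : ℝ) ∈ _ from ⟨le_of_lt hyc, le_of_lt hxc⟩)
      exact ⟨z, ⟨(hseg hz).1, hzc⟩, (hseg hz).2⟩
    · rintro _ ⟨x, ⟨hx, hxc⟩, rfl⟩
      exact move x hx hxc
  have hfin (s) := finite_image_gainSigns L s
  have hsplit : gainSigns ((i, j, c) :: L) '' gainCompl ℝ ((i, j, c) :: L)
      = List.cons true '' P ∪ List.cons false '' N := by
    apply Set.Subset.antisymm
    · rintro _ ⟨x, hx, rfl⟩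
      rw [gainCompl_cons] at hx
      rw [gainSigns_cons]
      rcases lt_or_gt_of_ne hx.2 with h | h
      · refine Or.inr ⟨_, ⟨x, ⟨hx.1, h⟩, rfl⟩, ?_⟩
        rw [decide_eq_false (not_lt.2 h.le)]
      · refine Or.inl ⟨_, ⟨x, ⟨hx.1, h⟩, rfl⟩, ?_⟩
        rw [decide_eq_true h]
    · rintro _ (⟨_, ⟨x, ⟨hx, h⟩, rfl⟩, rfl⟩ | ⟨_, ⟨x, ⟨hx, h⟩, rfl⟩, rfl⟩)
      · have h : (c : ℝ) < x i - x j := h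
        refine ⟨x, ?_, ?_⟩
        · rw [gainCompl_cons]; exact ⟨hx, h.ne'⟩
        · rw [gainSigns_cons]; simp only [decide_eq_true h]
      · have h : x i - x j < (c : ℝ) := h
        refine ⟨x, ?_, ?_⟩
        · rw [gainCompl_cons]; exact ⟨hx, h.ne⟩
        · rw [gainSigns_cons]; simp only [decide_eq_false (not_lt.2 h.le)]
  unfold gainRegions
  rw [hsplit, Set.ncard_union_eq ?_ ((hfin _).image _) ((hfin _).image _),
    Set.ncard_image_of_injective _ (List.cons_injective),
    Set.ncard_image_of_injective _ (List.cons_injective), ← hunion, ← hinter]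
  · exact (Set.ncard_union_add_ncard_inter _ _ (hfin _) (hfin _)).symm
  · rw [Set.disjoint_left]
    rintro _ ⟨a, _, rfl⟩ ⟨b, _, h⟩
    simp at h

section restrict

variable [DecidableEq ι]

/-- The retraction of `ι` onto `{k // k ≠ i}` sending `i` to `j`. -/
def retractTo (i j : ι) (hij : j ≠ i) (a : ι) : {k // k ≠ i} :=
  if h : a = i then ⟨j, hij⟩ else ⟨a, h⟩

/-- The restriction of the hyperplane `e` to the hyperplane `x i - x j = c`, in the coordinates
other than `x i`. -/
def gainRestrict (i j : ι) (hij : j ≠ i) (c : ℤ) (e : ι × ι × ℤ) :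
    {k // k ≠ i} × {k // k ≠ i} × ℤ :=
  (retractTo i j hij e.1, retractTo i j hij e.2.1,
    e.2.2 - (if e.1 = i then c else 0) + (if e.2.1 = i then c else 0))

/-- The parametrisation of the hyperplane `x i - x j = c` by the coordinates other than `x i`. -/
def gainLift (i j : ι) (hij : j ≠ i) (c : ℤ) (y : {k // k ≠ i} → R) : ι → R :=
  fun a => y (retractTo i j hij a) + ((if a = i then c else 0 : ℤ) : R)

lemma gainLift_sub (i j : ι) (hij : j ≠ i) (c : ℤ) (y : {k // k ≠ i} → R) (e : ι × ι × ℤ) :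
    gainLift i j hij c y e.1 - gainLift i j hij c y e.2.1 - (e.2.2 : R)
      = y (gainRestrict i j hij c e).1 - y (gainRestrict i j hij c e).2.1
        - ((gainRestrict i j hij c e).2.2 : R) := by
  simp only [gainLift, gainRestrict]
  push_cast
  ring

lemma gainLift_injective (i j : ι) (hij : j ≠ i) (c : ℤ) :
    Function.Injective (gainLift (R := R) i j hij c) := by
  intro y z h
  funext ⟨k, hk⟩
  simpa [gainLift, retractTo, hk] using congrFun h k

lemma image_gainLift (i j : ι) (hij : j ≠ i) (c : ℤ) (L : List (ι × ι × ℤ)) :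
    gainLift i j hij c '' gainCompl R (L.map (gainRestrict i j hij c))
      = gainCompl R L ∩ {x | x i - x j = (c : R)} := by
  have hmem (y : {k // k ≠ i} → R) : gainLift i j hij c y ∈ gainCompl R L ↔
      y ∈ gainCompl R (L.map (gainRestrict i j hij c)) := by
    simp only [gainCompl, Set.mem_ofPred_eq, List.forall_mem_map]
    refine forall₂_congr fun e _ => ?_
    rw [← sub_ne_zero, gainLift_sub, sub_ne_zero]
  ext x
  constructor
  · rintro ⟨y, hy, rfl⟩
    refine ⟨(hmem y).2 hy, ?_⟩
    simp [gainLift, retractTo, hij]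
  · rintro ⟨hx, hxc⟩
    have hx' : gainLift i j hij c (fun k => x k) = x := by
      funext a
      by_cases ha : a = i
      · subst ha
        have hxc : x a - x j = c := hxc
        simp [gainLift, retractTo, ← hxc]
      · simp [gainLift, retractTo, ha]
    refine ⟨fun k => x k, (hmem _).1 ?_, hx'⟩
    rwa [hx']

lemma gainSigns_gainLift (i j : ι) (hij : j ≠ i) (c : ℤ) (L : List (ι × ι × ℤ))
    (y : {k // k ≠ i} → ℝ) :
    gainSigns L (gainLift i j hij c y) = gainSigns (L.map (gainRestrict i j hij c)) y := by
  simp only [gainSigns, List.map_map, List.map_inj_left]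
  intro e _
  simp only [Function.comp]
  congr 1
  rw [← sub_pos, gainLift_sub, sub_pos]

lemma gainRegions_map_gainRestrict (i j : ι) (hij : j ≠ i) (c : ℤ) (L : List (ι × ι × ℤ)) :
    gainRegions (L.map (gainRestrict i j hij c))
      = (gainSigns L '' (gainCompl ℝ L ∩ {x | x i - x j = (c : ℝ)})).ncard := by
  rw [← image_gainLift i j hij, Set.image_image]
  simp only [gainSigns_gainLift]
  rfl

lemma ncard_gainCompl_cons [Finite ι] [Finite R] (i j : ι) (hij : j ≠ i) (c : ℤ)
    (L : List (ι × ι × ℤ)) :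
    (gainCompl R ((i, j, c) :: L)).ncard
      + (gainCompl R (L.map (gainRestrict i j hij c))).ncard = (gainCompl R L).ncard := by
  rw [← Set.ncard_image_of_injective _ (gainLift_injective (R := R) i j hij c), image_gainLift,
    gainCompl_cons, add_comm]
  have := Set.ncard_inter_add_ncard_sdiff_eq_ncard (gainCompl R L) {x | x i - x j = (c : R)}
  rw [← this]
  rfl

end restrict

/-- The finite field method: points off the hyperplanes modulo large `q` are counted by a
polynomial, whose value at `-1` is up to sign the number of regions. -/
theorem exists_gain_charPoly [Fintype ι] (L : List (ι × ι × ℤ)) :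
    ∃ χ : ℤ[X], (∀ᶠ q : ℕ in Filter.atTop, ((gainCompl (ZMod q) L).ncard : ℤ) = χ.eval (q : ℤ)) ∧
      (gainRegions L : ℤ) = (-1) ^ Fintype.card ι * χ.eval (-1) := by
  classical
  induction hl : L.length generalizing ι with
  | zero =>
    obtain rfl := List.length_eq_zero_iff.1 hl
    refine ⟨X ^ Fintype.card ι, ?_, ?_⟩
    · filter_upwards [Filter.eventually_gt_atTop 0] with q hq
      have : NeZero q := ⟨hq.ne'⟩
      have : gainCompl (ZMod q) ([] : List (ι × ι × ℤ)) = Set.univ := by simp [gainCompl]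
      rw [this, Set.ncard_univ, Nat.card_eq_fintype_card]
      simp [ZMod.card]
    · have : gainSigns ([] : List (ι × ι × ℤ)) '' gainCompl ℝ [] = {[]} := by
        simp [gainSigns, gainCompl]
      rw [gainRegions, this, Set.ncard_singleton]
      simp [← mul_pow]
  | succ m ih =>
    obtain ⟨⟨i, j, c⟩, L, rfl⟩ := List.exists_cons_of_length_eq_add_one hl
    have hL : L.length = m := by simpa using hl
    obtain ⟨χ, h1, h2⟩ := ih L hL
    by_cases hij : i = j
    · subst hij
      by_cases hc : c = 0
      · have hempty (R : Type) [CommRing R] : gainCompl R ((i, i, c) :: L) = ∅ := by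
          simp [gainCompl_cons, hc]
        refine ⟨0, ?_, ?_⟩
        · simp [hempty]
        · simp [gainRegions, hempty]
      · refine ⟨χ, ?_, ?_⟩
        · filter_upwards [h1, Filter.eventually_gt_atTop c.natAbs] with q hq hqc
          rw [← hq, gainCompl_cons]
          congr 3
          refine Set.inter_eq_left.2 fun x _ => ?_
          simp only [Set.mem_ofPred_eq, sub_self]
          intro h0
          have := (ZMod.intCast_zmod_eq_zero_iff_dvd c q).1 h0.symm
          exact absurd (Nat.le_of_dvd (Int.natAbs_pos.2 hc) (Int.natCast_dvd.1 this))
            (not_le.2 hqc)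
        · rw [← h2]
          have h3 : gainCompl ℝ ((i, i, c) :: L) = gainCompl ℝ L := by
            rw [gainCompl_cons]
            refine Set.inter_eq_left.2 fun x _ => ?_
            simpa [eq_comm] using hc
          have h4 : gainSigns ((i, i, c) :: L)
              = fun x => decide ((c : ℝ) < 0) :: gainSigns L x := by
            funext x
            simp [gainSigns_cons]
          rw [gainRegions, h3, h4, ← Set.image_image (List.cons _) (gainSigns L),
            Set.ncard_image_of_injective _ List.cons_injective, gainRegions]
    · obtain ⟨ψ, h3, h4⟩ := ih (L.map (gainRestrict i j (Ne.symm hij) c)) (by simpa using hL)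
      refine ⟨χ - ψ, ?_, ?_⟩
      · filter_upwards [h1, h3, Filter.eventually_gt_atTop 0] with q hq1 hq3 hq
        have : NeZero q := ⟨hq.ne'⟩
        rw [eval_sub, ← hq1, ← hq3,
          ← ncard_gainCompl_cons (R := ZMod q) i j (Ne.symm hij) c L]
        push_cast
        ring
      · rw [gainRegions_cons i j hij, ← gainRegions_map_gainRestrict i j (Ne.symm hij)]
        have hcard : Fintype.card ι = Fintype.card {k // k ≠ i} + 1 := by
          have := Fintype.card_pos_iff.2 ⟨i⟩
          rw [Fintype.card_subtype_compl, Fintype.card_subtype_eq]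
          omega
        push_cast
        rw [h2, h4, eval_sub, hcard]
        ring

end gain

section linial

open Polynomial

/-- The number of regions of an arrangement in the hyperplane `∑ i, x i = 0` is the number of
sign vectors it realises. -/
lemma numRegions_sum_eq_zero {n : ℕ} (hn : 1 ≤ n) (L : List (Fin n × Fin n × ℤ)) :
    numRegions {x : Fin n → ℝ | (∑ i, x i) = 0 ∧ x ∈ gainCompl ℝ L} = gainRegions L := by
  set S := {x : Fin n → ℝ | (∑ i, x i) = 0 ∧ x ∈ gainCompl ℝ L} with hS
  have hconst : IsLocallyConstant fun x : S => gainSigns L x := by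
    rw [IsLocallyConstant.iff_eventually_eq]
    intro x
    have h := continuous_subtype_val.continuousAt.eventually (eventually_gainSigns_eq L x.2.2)
    filter_upwards [h] with y hy using hy.2
  have himage : gainSigns L '' gainCompl ℝ L = Set.range fun x : S => gainSigns L x := by
    apply Set.Subset.antisymm
    · rintro _ ⟨x, hx, rfl⟩
      have hn' : (n : ℝ) ≠ 0 := by positivity
      refine ⟨⟨fun i => x i - (∑ k, x k) / n, ?_, ?_⟩, ?_⟩
      · simp [Finset.sum_sub_distrib, mul_div_cancel₀ _ hn']
      · simpa [gainCompl] using hx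
      · simp [gainSigns]
    · rintro _ ⟨x, rfl⟩
      exact ⟨x, x.2.2, rfl⟩
  rw [gainRegions, himage, numRegions, ← Nat.card_coe_set_eq]
  refine Nat.card_eq_of_bijective (Quotient.lift (fun x : S => ⟨gainSigns L x, x, rfl⟩) ?_)
    ⟨?_, ?_⟩
  · intro x y hxy
    have hxy : connectedComponent x = connectedComponent y := hxy
    refine Subtype.ext (hconst.apply_eq_of_isPreconnected isPreconnected_connectedComponent
      mem_connectedComponent ?_)
    rw [hxy]
    exact mem_connectedComponent
  · rintro ⟨x⟩ ⟨y⟩ hxy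
    have hxy : gainSigns L x = gainSigns L y := congrArg Subtype.val hxy
    have hseg : segment ℝ (x : Fin n → ℝ) y ⊆ S := by
      intro z hz
      refine ⟨?_, (segment_subset_gainCompl x.2.2 y.2.2 hxy hz).1⟩
      obtain ⟨a, b, -, -, -, rfl⟩ := hz
      simp [Finset.sum_add_distrib, ← Finset.mul_sum, x.2.1, y.2.1]
    have hpre : IsPreconnected ((↑) ⁻¹' segment ℝ (x : Fin n → ℝ) y : Set S) := by
      rw [← Topology.IsInducing.subtypeVal.isPreconnected_image, Subtype.image_preimage_coe,
        Set.inter_eq_right.2 hseg]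
      exact (convex_segment _ _).isPreconnected
    refine Quotient.sound ?_
    have := hpre.subset_connectedComponent (x := x) (left_mem_segment ℝ _ _)
    exact connectedComponent_eq (this (right_mem_segment ℝ _ _))
  · rintro ⟨_, x, rfl⟩
    exact ⟨Quotient.mk _ x, rfl⟩

/-- The hyperplanes `x i - x j = 1` with `i < j`. -/
noncomputable def linial (n : ℕ) : List (Fin n × Fin n × ℤ) :=
  ((Finset.univ.filter fun p : Fin n × Fin n => p.1 < p.2).toList).map fun p => (p.1, p.2, 1)

lemma mem_gainCompl_linial {R : Type*} [CommRing R] {n : ℕ} {x : Fin n → R} :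
    x ∈ gainCompl R (linial n) ↔ ∀ i j, i < j → x i - x j ≠ 1 := by
  simp only [gainCompl, linial, Set.mem_ofPred_eq, List.forall_mem_map, Finset.mem_toList,
    Finset.mem_filter, Finset.mem_univ, true_and, Prod.forall, Int.cast_one]

lemma ncard_gainCompl_linial (p m : ℕ) :
    (gainCompl (ZMod (p + 1)) (linial (m + 1))).ncard = (p + 1) * (boxings p m).card := by
  let f : ZMod (p + 1) × (Fin m → ℕ) → Fin (m + 1) → ZMod (p + 1) :=
    fun u => Fin.snoc (fun i => (u.2 i : ZMod (p + 1)) + u.1 + 1) u.1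
  have hcast {a b : ℕ} (ha : a < p + 1) (hb : b < p + 1) (h : (a : ZMod (p + 1)) = b) :
      a = b := by
    rw [ZMod.natCast_eq_natCast_iff'] at h
    rwa [Nat.mod_eq_of_lt ha, Nat.mod_eq_of_lt hb] at h
  have himage : gainCompl (ZMod (p + 1)) (linial (m + 1))
      = f '' ((Finset.univ ×ˢ boxings p m : Finset (ZMod (p + 1) × (Fin m → ℕ))) : Set _) := by
    ext x
    simp only [Set.mem_image, Finset.mem_coe, Finset.mem_product, Finset.mem_univ, true_and,
      mem_gainCompl_linial, mem_boxings]
    constructor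
    · intro hx
      have hy (i : Fin m) : (((x i.castSucc - x (Fin.last m) - 1).val : ℕ) : ZMod (p + 1))
          = x i.castSucc - x (Fin.last m) - 1 := ZMod.natCast_zmod_val _
      refine ⟨(x (Fin.last m), fun i => (x i.castSucc - x (Fin.last m) - 1).val),
        ⟨fun i => ⟨?_, ?_⟩, fun i j hij h => ?_⟩, ?_⟩
      · rw [Nat.one_le_iff_ne_zero]
        intro h
        refine hx _ _ (Fin.castSucc_lt_last i) ?_
        rw [← sub_eq_zero, ← hy]
        simp only at h
        rw [h, Nat.cast_zero]
      · exact Nat.lt_succ_iff.1 (ZMod.val_lt (x i.castSucc - x (Fin.last m) - 1))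
      · refine hx i.castSucc j.castSucc (by simpa using hij) ?_
        have h := congrArg (Nat.cast (R := ZMod (p + 1))) h
        simp only [Nat.cast_add, hy, Nat.cast_one] at h
        linear_combination h
      · funext i
        refine Fin.lastCases ?_ (fun i => ?_) i
        · simp [f]
        · simp only [f, Fin.snoc_castSucc, hy]
          ring
    · rintro ⟨⟨a, y⟩, ⟨h1, h2⟩, rfl⟩ i j
      simp only at h1 h2
      refine Fin.lastCases ?_ (fun j => ?_) j <;> refine Fin.lastCases ?_ (fun i => ?_) i
      · simp
      · intro _ h
        have h0 : (y i : ZMod (p + 1)) = (0 : ℕ) := by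
          simp only [f, Fin.snoc_castSucc, Fin.snoc_last] at h
          rw [Nat.cast_zero]
          linear_combination h
        have := hcast (by have := h1 i; omega) (by omega) h0
        have := h1 i
        omega
      · intro hij
        exact absurd (Fin.castSucc_lt_last j) (not_lt.2 hij.le)
      · intro hij h
        simp only [f, Fin.snoc_castSucc] at h
        have hi := h1 i
        have hj := h1 j
        rcases hj.2.lt_or_eq with hlt | heq
        · refine h2 i j (by simpa using hij) (hcast (by omega) (by omega) ?_)
          push_cast
          linear_combination h
        · have h0 : (y i : ZMod (p + 1)) = (0 : ℕ) := by
            have h3 : ((p + 1 : ℕ) : ZMod (p + 1)) = 0 := ZMod.natCast_self _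
            rw [heq] at h
            push_cast at h3 ⊢
            linear_combination h + h3
          have := hcast (by omega) (by omega) h0
          omega
  rw [himage, Set.InjOn.ncard_image, Set.ncard_coe_finset, Finset.card_product,
    Finset.card_univ, ZMod.card]
  rintro ⟨a, y⟩ hy ⟨b, z⟩ hz h
  simp only [Finset.mem_coe, Finset.mem_product, Finset.mem_univ, true_and, mem_boxings]
    at hy hz
  have hab : a = b := by simpa [f] using congrFun h (Fin.last m)
  subst hab
  congr 1
  funext i
  have hi : (y i : ZMod (p + 1)) = z i := by simpa [f] using congrFun h i.castSucc
  exact hcast (by have := hy.1 i; omega) (by have := hz.1 i; omega) hi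

lemma gainRegions_linial (m : ℕ) :
    2 ^ (m + 1) * (gainRegions (linial (m + 1)) : ℤ) = (-1) ^ m * binomSum (m + 1) m (-1) := by
  obtain ⟨χ, h1, h2⟩ := exists_gain_charPoly (linial (m + 1))
  have hχ : C (2 ^ (m + 1)) * χ = X * ∑ i ∈ Finset.range (m + 1 + 1),
      C ((m + 1).choose i : ℤ) * (X - C (i : ℤ)) ^ m := by
    apply eq_of_infinite_eval_eq
    have h3 : ∀ᶠ q : ℕ in Filter.atTop, (q : ℤ) ∈ {a : ℤ | (C (2 ^ (m + 1)) * χ).eval a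
        = (X * ∑ i ∈ Finset.range (m + 1 + 1),
          C ((m + 1).choose i : ℤ) * (X - C (i : ℤ)) ^ m).eval a} := by
      filter_upwards [h1, Filter.eventually_gt_atTop m] with q hq hqm
      obtain ⟨p, rfl⟩ : ∃ p, q = p + 1 := ⟨q - 1, by omega⟩
      rw [ncard_gainCompl_linial] at hq
      have h4 := card_boxings m p (by omega)
      rw [eval_mul, eval_C, ← hq, eval_mul, eval_X, eval_finsetSum]
      simp only [eval_mul, eval_C, eval_pow, eval_sub, eval_X]
      rw [binomSum] at h4
      push_cast
      rw [← h4]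
      ring
    have h5 : Set.Infinite {q : ℕ | (q : ℤ) ∈ {a : ℤ | (C (2 ^ (m + 1)) * χ).eval a
        = (X * ∑ i ∈ Finset.range (m + 1 + 1),
          C ((m + 1).choose i : ℤ) * (X - C (i : ℤ)) ^ m).eval a}} :=
      Nat.frequently_atTop_iff_infinite.1 h3.frequently
    refine (h5.image (f := Nat.cast) Nat.cast_injective.injOn).mono ?_
    rintro _ ⟨q, hq, rfl⟩
    exact hq
  have h := congrArg (eval (-1)) hχ
  rw [eval_mul, eval_C, eval_mul, eval_X, eval_finsetSum] at h
  simp only [eval_mul, eval_C, eval_pow, eval_sub, eval_X] at h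
  rw [h2, Fintype.card_fin, binomSum, pow_succ (-1 : ℤ)]
  linear_combination -(-1) ^ m * h

end linial

/-- The number of regions of the Linial arrangement `x_i - x_j = 1` (`1 ≤ i < j ≤ n`)
in `V_{n-1}` satisfies `2^n r(L_{n-1}) = ∑_{k=0}^n (n choose k) (k+1)^(n-1)`. -/
theorem stmt10 (n : ℕ) (hn : 1 ≤ n) :
    2 ^ n * numRegions {x : Fin n → ℝ | (∑ i, x i) = 0 ∧
        ∀ i j : Fin n, i < j → x i - x j ≠ 1} =
      ∑ k ∈ Finset.range (n + 1), n.choose k * (k + 1) ^ (n - 1) := by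
  have h := numRegions_sum_eq_zero hn (linial n)
  simp only [mem_gainCompl_linial] at h
  rw [h]
  obtain ⟨m, rfl⟩ : ∃ m, n = m + 1 := ⟨n - 1, by omega⟩
  zify
  rw [gainRegions_linial, binomSum, Finset.mul_sum]
  refine Finset.sum_congr rfl fun k _ => ?_
  rw [Nat.add_sub_cancel, show (-1 - k : ℤ) = (-1) * (k + 1) by ring, mul_pow, mul_left_comm,
    ← mul_assoc ((-1 : ℤ) ^ m), ← mul_pow]
  simp
end

section
/- For n ≥ 1, the number of regions of the Linial arrangement L_{n-1} equals the number of sleek partial orders on {1, 2, ..., n}. -/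
/-- A partial order `Q` on `{1, ..., n}` is a semiorder if there is a point
`(x_1, ..., x_n) ∈ ℝ^n` with `i >_Q j ↔ x_i - x_j > 1` for all `i, j`. -/
def IsSemiorder {n : ℕ} (Q : PartialOrder (Fin n)) : Prop :=
  ∃ x : Fin n → ℝ, ∀ i j : Fin n, Q.lt j i ↔ x i - x j > 1

/-- A partial order `P` on `{1, ..., n}` is sleek if it is the intersection of a
semiorder with the natural chain `1 < 2 < ⋯ < n`. -/
def IsSleek {n : ℕ} (P : PartialOrder (Fin n)) : Prop :=
  ∃ Q : PartialOrder (Fin n), IsSemiorder Q ∧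
    ∀ i j : Fin n, P.lt i j ↔ (Q.lt i j ∧ i < j)

/-- A surjective locally constant map with preconnected fibers identifies the set of connected
components of its domain with its codomain. -/
theorem card_connectedComponents_eq_of_isLocallyConstant {X Y : Type*} [TopologicalSpace X]
    {f : X → Y} (hf : IsLocallyConstant f) (hsurj : Function.Surjective f)
    (hconn : ∀ x, IsPreconnected {y | f y = f x}) :
    Nat.card (ConnectedComponents X) = Nat.card Y := by
  let _ : TopologicalSpace Y := ⊥
  have : DiscreteTopology Y := ⟨rfl⟩
  have hc : Continuous f := hf.continuous
  refine Nat.card_congr (Equiv.ofBijective hc.connectedComponentsLift ⟨?_, ?_⟩)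
  · intro a b hab
    obtain ⟨x, rfl⟩ := ConnectedComponents.surjective_coe a
    obtain ⟨y, rfl⟩ := ConnectedComponents.surjective_coe b
    rw [hc.connectedComponentsLift_apply_coe, hc.connectedComponentsLift_apply_coe] at hab
    exact (ConnectedComponents.coe_eq_coe'.2
      ((hconn x).subset_connectedComponent rfl hab.symm)).symm
  · intro y
    obtain ⟨x, rfl⟩ := hsurj y
    exact ⟨x, hc.connectedComponentsLift_apply_coe x⟩

/-- The partial order on `Fin n` with `i < j` iff `x j - x i > 1`. -/
noncomputable abbrev semiorderOfPoint {n : ℕ} (x : Fin n → ℝ) : PartialOrder (Fin n) :=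
  haveI : IsStrictOrder (Fin n) (fun i j => x j - x i > 1) :=
    { irrefl := fun i h => by norm_num at h
      trans := fun i j k h₁ h₂ => by linarith }
  partialOrderOfSO (fun i j => x j - x i > 1)

theorem semiorderOfPoint_lt {n : ℕ} (x : Fin n → ℝ) (i j : Fin n) :
    (semiorderOfPoint x).lt i j ↔ x j - x i > 1 := Iff.rfl

/-- The partial order on `Fin n` recording on which side of each Linial hyperplane `x` lies. -/
noncomputable abbrev sleekOfPoint {n : ℕ} (x : Fin n → ℝ) : PartialOrder (Fin n) :=
  haveI : IsStrictOrder (Fin n) (fun i j => i < j ∧ x i - x j > 1) :=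
    { irrefl := fun i h => lt_irrefl i h.1
      trans := fun i j k h₁ h₂ => ⟨h₁.1.trans h₂.1, by linarith [h₁.2, h₂.2]⟩ }
  partialOrderOfSO (fun i j => i < j ∧ x i - x j > 1)

theorem sleekOfPoint_lt {n : ℕ} (x : Fin n → ℝ) (i j : Fin n) :
    (sleekOfPoint x).lt i j ↔ i < j ∧ x i - x j > 1 := Iff.rfl

theorem isSleek_sleekOfPoint {n : ℕ} (x : Fin n → ℝ) : IsSleek (sleekOfPoint x) := by
  refine ⟨semiorderOfPoint (-x), ⟨-x, fun i j => semiorderOfPoint_lt _ _ _⟩, fun i j => ?_⟩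
  rw [sleekOfPoint_lt, semiorderOfPoint_lt, and_comm]
  simp only [Pi.neg_apply, neg_sub_neg]

theorem sleekOfPoint_eq_iff {n : ℕ} {x y : Fin n → ℝ} :
    sleekOfPoint x = sleekOfPoint y ↔ ∀ i j, i < j → (x i - x j > 1 ↔ y i - y j > 1) := by
  constructor
  · intro h i j hij
    have := sleekOfPoint_lt x i j
    rw [h, sleekOfPoint_lt] at this
    tauto
  · intro h
    refine PartialOrder.ext_lt fun i j => ?_
    rw [sleekOfPoint_lt, sleekOfPoint_lt]
    exact and_congr_right (h i j)

/-- Shrinking a point slightly moves it off all hyperplanes `z i - z j = 1` without changing which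
differences exceed `1`. -/
theorem exists_scaling_ne_one {n : ℕ} (x : Fin n → ℝ) :
    ∃ c : ℝ, ∀ i j, (c * (x i - x j) > 1 ↔ x i - x j > 1) ∧ c * (x i - x j) ≠ 1 := by
  have hev : ∀ᶠ c : ℝ in nhdsWithin 1 (Set.Iio 1), ∀ i j, x i - x j > 1 → c * (x i - x j) > 1 := by
    refine Filter.eventually_all.2 fun i => Filter.eventually_all.2 fun j => ?_
    by_cases h : x i - x j > 1
    · have hcont : Continuous fun c : ℝ => c * (x i - x j) := by fun_prop
      have := (hcont.tendsto' 1 _ (one_mul _)).eventually (lt_mem_nhds h)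
      exact (this.filter_mono nhdsWithin_le_nhds).mono fun c hc _ => hc
    · exact Filter.Eventually.of_forall fun c hx => absurd hx h
  have hpos : ∀ᶠ c : ℝ in nhdsWithin 1 (Set.Iio 1), 0 < c :=
    (lt_mem_nhds one_pos).filter_mono nhdsWithin_le_nhds
  obtain ⟨c, ⟨hc, hc0⟩, hc1⟩ := ((hev.and hpos).and self_mem_nhdsWithin).exists
  refine ⟨c, fun i j => ?_⟩
  by_cases h : x i - x j > 1
  · exact ⟨⟨fun _ => h, hc i j⟩, (hc i j h).ne'⟩
  · have : c * (x i - x j) < 1 := by nlinarith [not_lt.1 h]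
    exact ⟨⟨fun h' => absurd h' this.not_gt, fun h' => absurd h' h⟩, this.ne⟩

theorem convex_sum_zero_sides {n : ℕ} (R : Fin n → Fin n → Prop) :
    Convex ℝ {x : Fin n → ℝ | (∑ i, x i) = 0 ∧
      ∀ i j, i < j → (R i j → x i - x j > 1) ∧ (¬ R i j → x i - x j < 1)} := by
  intro x hx y hy a b ha hb hab
  refine ⟨?_, fun i j hij => ⟨fun h => ?_, fun h => ?_⟩⟩
  · simp [Finset.sum_add_distrib, ← Finset.mul_sum, hx.1, hy.1]
  · have := (convex_Ioi (1 : ℝ)) ((hx.2 i j hij).1 h) ((hy.2 i j hij).1 h) ha hb hab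
    simp only [smul_eq_mul, Set.mem_Ioi, Pi.add_apply, Pi.smul_apply] at this ⊢
    linarith
  · have := (convex_Iio (1 : ℝ)) ((hx.2 i j hij).2 h) ((hy.2 i j hij).2 h) ha hb hab
    simp only [smul_eq_mul, Set.mem_Iio, Pi.add_apply, Pi.smul_apply] at this ⊢
    linarith

/-- The number of regions of the Linial arrangement `x_i - x_j = 1` (`1 ≤ i < j ≤ n`)
in `V_{n-1}` equals the number of sleek partial orders on `{1, ..., n}`. -/
theorem stmt11 (n : ℕ) (hn : 1 ≤ n) :
    numRegions {x : Fin n → ℝ | (∑ i, x i) = 0 ∧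
        ∀ i j : Fin n, i < j → x i - x j ≠ 1} =
      Nat.card {P : PartialOrder (Fin n) // IsSleek P} := by
  refine card_connectedComponents_eq_of_isLocallyConstant
    (f := fun x => ⟨sleekOfPoint x.1, isSleek_sleekOfPoint x.1⟩) ?_ ?_ ?_
  · refine (IsLocallyConstant.iff_eventually_eq _).2 fun x => ?_
    simp only [Subtype.mk.injEq, sleekOfPoint_eq_iff]
    refine Filter.eventually_all.2 fun i => Filter.eventually_all.2 fun j => ?_
    by_cases hij : i < j
    · have hcont : Continuous fun y : {x : Fin n → ℝ | (∑ i, x i) = 0 ∧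
          ∀ i j : Fin n, i < j → x i - x j ≠ 1} => y.1 i - y.1 j :=
        ((continuous_apply i).comp continuous_subtype_val).sub
          ((continuous_apply j).comp continuous_subtype_val)
      rcases lt_or_gt_of_ne (x.2.2 i j hij) with h | h
      · filter_upwards [hcont.continuousAt.eventually (gt_mem_nhds h)] with y hy _
        exact iff_of_false hy.not_gt h.not_gt
      · filter_upwards [hcont.continuousAt.eventually (lt_mem_nhds h)] with y hy _
        exact iff_of_true hy h
    · exact Filter.Eventually.of_forall fun y h => absurd h hij
  · rintro ⟨P, Q, ⟨x, hx⟩, hP⟩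
    obtain ⟨c, hc⟩ := exists_scaling_ne_one x
    set m : ℝ := (∑ i, c * x i) / n
    have hdiff : ∀ i j, (m - c * x i) - (m - c * x j) = c * (x j - x i) := fun i j => by ring
    refine ⟨⟨fun i => m - c * x i, ?_, fun i j _ => ?_⟩, ?_⟩
    · have : (n : ℝ) ≠ 0 := by positivity
      simp only [Finset.sum_sub_distrib, Finset.sum_const, Finset.card_univ, Fintype.card_fin,
        nsmul_eq_mul, m]
      field_simp
      ring
    · rw [hdiff]
      exact (hc j i).2
    · refine Subtype.ext (PartialOrder.ext_lt fun i j => ?_)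
      rw [sleekOfPoint_lt, hP, hx, hdiff, (hc j i).1, and_comm]
  · intro x
    refine (Topology.IsInducing.subtypeVal.isPreconnected_image).1 ?_
    convert (convex_sum_zero_sides fun i j => x.1 i - x.1 j > 1).isPreconnected using 1
    ext y
    simp only [Set.mem_image, Set.mem_ofPred_eq, Subtype.mk.injEq, sleekOfPoint_eq_iff]
    constructor
    · rintro ⟨y, hy, rfl⟩
      refine ⟨y.2.1, fun i j hij => ⟨(hy i j hij).2, fun h => ?_⟩⟩
      exact lt_of_le_of_ne (not_lt.1 (mt (hy i j hij).1 h)) (y.2.2 i j hij)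
    · rintro ⟨h0, h⟩
      refine ⟨⟨y, h0, fun i j hij => ?_⟩, fun i j hij => ⟨fun hy => ?_, (h i j hij).1⟩, rfl⟩
      · by_cases hx : x.1 i - x.1 j > 1
        · exact ((h i j hij).1 hx).ne'
        · exact ((h i j hij).2 hx).ne
      · by_contra hx
        exact ((h i j hij).2 hx).not_gt hy
end

section
/- For n ≥ 1, the number of regions of the Linial arrangement L_{n-1} equals the number of semiacyclic tournaments on the vertex set {1, 2, ..., n}. -/
/-- A tournament on `{1, ..., n}`: a loopless directed graph with exactly one of the
edges `(i,j)`, `(j,i)` for each pair `i ≠ j`. -/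
def IsTournament {n : ℕ} (T : Fin n → Fin n → Prop) : Prop :=
  (∀ i, ¬ T i i) ∧ ∀ i j : Fin n, i ≠ j → (T i j ↔ ¬ T j i)

/-- `T` contains an ascending directed cycle: a directed cycle `(c_1, ..., c_m)` with
distinct vertices whose number of ascents (indices `i` with `c_{i-1} < c_i`, cyclically)
is at least its number of descents. -/
def HasAscendingCycle {n : ℕ} (T : Fin n → Fin n → Prop) : Prop :=
  ∃ (m : ℕ) (_ : 0 < m) (c : ZMod m → Fin n), Function.Injective c ∧
    (∀ i : ZMod m, T (c i) (c (i + 1))) ∧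
    Nat.card {i : ZMod m | c (i + 1) < c i} ≤ Nat.card {i : ZMod m | c i < c (i + 1)}

section

open Finset

/-- The sign of the edge `(a, b)`: `1` for a descent, `-1` for an ascent. -/
noncomputable def descentSign {n : ℕ} (a b : Fin n) : ℝ :=
  (if b < a then 1 else 0) - (if a < b then 1 else 0)

lemma descentSign_swap {n : ℕ} (a b : Fin n) : descentSign b a = -descentSign a b := by
  simp [descentSign]

lemma descentSign_of_lt {n : ℕ} {a b : Fin n} (h : a < b) : descentSign a b = -1 := by
  simp [descentSign, h, h.not_gt]

lemma neg_one_le_descentSign {n : ℕ} (a b : Fin n) : -1 ≤ descentSign a b := by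
  unfold descentSign
  split_ifs <;> norm_num

lemma sum_descentSign {n m : ℕ} [NeZero m] (c : ZMod m → Fin n) :
    ∑ i, descentSign (c i) (c (i + 1)) =
      (Nat.card {i : ZMod m | c (i + 1) < c i} : ℝ) -
        Nat.card {i : ZMod m | c i < c (i + 1)} := by
  simp [descentSign, Finset.sum_sub_distrib, Finset.sum_boole, Nat.card_eq_fintype_card,
    Fintype.card_subtype]

/-- `x` satisfies the strict difference constraint attached to every edge of `T`. -/
def SatisfiesConstraints {n : ℕ} (T : Fin n → Fin n → Prop) (x : Fin n → ℝ) : Prop :=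
  ∀ i j, T i j → x j - x i < descentSign i j

lemma SatisfiesConstraints.not_hasAscendingCycle {n : ℕ} {T : Fin n → Fin n → Prop}
    {x : Fin n → ℝ} (h : SatisfiesConstraints T x) : ¬ HasAscendingCycle T := by
  rintro ⟨m, hm, c, -, hT, hcard⟩
  have : NeZero m := ⟨hm.ne'⟩
  have hlt : ∑ i, (x (c (i + 1)) - x (c i)) < ∑ i, descentSign (c i) (c (i + 1)) :=
    Finset.sum_lt_sum_of_nonempty Finset.univ_nonempty fun i _ => h _ _ (hT i)
  have hzero : ∑ i, (x (c (i + 1)) - x (c i)) = 0 := by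
    rw [Finset.sum_sub_distrib, sub_eq_zero]
    exact Equiv.sum_comp (Equiv.addRight (1 : ZMod m)) fun i => x (c i)
  rw [hzero, sum_descentSign] at hlt
  have : (Nat.card {i : ZMod m | c (i + 1) < c i} : ℝ) ≤
      Nat.card {i : ZMod m | c i < c (i + 1)} := by exact_mod_cast hcard
  linarith

/-- `p 0, ..., p k` is a path in `T` without repeated vertices. -/
def IsSimplePath {n : ℕ} (T : Fin n → Fin n → Prop) (p : ℕ → Fin n) (k : ℕ) : Prop :=
  Set.InjOn p (Set.Iic k) ∧ ∀ a < k, T (p a) (p (a + 1))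

lemma IsSimplePath.lt {n : ℕ} {T : Fin n → Fin n → Prop} {p : ℕ → Fin n} {k : ℕ}
    (h : IsSimplePath T p k) : k < n := by
  have := Finset.card_le_card_of_injOn (s := Finset.range (k + 1)) (t := Finset.univ) p
    (by simp) (h.1.mono fun a ha => by simp at ha ⊢; omega)
  simpa using this

lemma IsSimplePath.take {n : ℕ} {T : Fin n → Fin n → Prop} {p : ℕ → Fin n} {k l : ℕ}
    (h : IsSimplePath T p k) (hl : l ≤ k) : IsSimplePath T p l :=
  ⟨h.1.mono (Set.Iic_subset_Iic.2 hl), fun a ha => h.2 a (by omega)⟩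

lemma IsSimplePath.drop {n : ℕ} {T : Fin n → Fin n → Prop} {p : ℕ → Fin n} {k l : ℕ}
    (h : IsSimplePath T p (l + k)) : IsSimplePath T (fun a => p (l + a)) k := by
  refine ⟨fun a ha b hb hab => ?_, fun a ha => h.2 (l + a) (by omega)⟩
  have := h.1 (Set.mem_Iic.2 (Nat.add_le_add_left ha l))
    (Set.mem_Iic.2 (Nat.add_le_add_left hb l)) hab
  omega

lemma IsSimplePath.update {n : ℕ} {T : Fin n → Fin n → Prop} {p : ℕ → Fin n} {k : ℕ} {j : Fin n}
    (h : IsSimplePath T p k) (hj : ∀ a ≤ k, p a ≠ j) (hT : T (p k) j) :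
    IsSimplePath T (Function.update p (k + 1) j) (k + 1) := by
  constructor
  · intro a ha b hb hab
    simp only [Set.mem_Iic, Function.update_apply] at ha hb hab
    split_ifs at hab with h1 h2 h2
    · omega
    · exact absurd hab.symm (hj b (by omega))
    · exact absurd hab (hj a (by omega))
    · exact h.1 (Set.mem_Iic.2 (by omega)) (Set.mem_Iic.2 (by omega)) hab
  · intro a ha
    rcases Nat.lt_succ_iff_lt_or_eq.1 ha with h' | rfl
    · rw [Function.update_of_ne (by omega), Function.update_of_ne (by omega)]
      exact h.2 a h'
    · simpa using hT

lemma IsSimplePath.one_le_sum_descentSign {n : ℕ} {T : Fin n → Fin n → Prop} {p : ℕ → Fin n}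
    {k : ℕ} (hA : ¬ HasAscendingCycle T) (h : IsSimplePath T p k) (hT : T (p k) (p 0)) :
    1 ≤ ∑ a ∈ range k, descentSign (p a) (p (a + 1)) + descentSign (p k) (p 0) := by
  let c : ZMod (k + 1) → Fin n := fun i => p (Fin.val (n := k + 1) i)
  have hsucc : ∀ i : Fin k, c (Fin.castSucc i + 1 : Fin (k + 1)) = p (i + 1) := by
    intro i
    simp [c, Fin.coeSucc_eq_succ]
  have hlast : c (Fin.last k + 1 : Fin (k + 1)) = p 0 := by
    simp [c]
  have hinj : Function.Injective c := fun a b hab =>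
    Fin.ext (h.1 (Set.mem_Iic.2 (Fin.is_le (n := k) a)) (Set.mem_Iic.2 (Fin.is_le (n := k) b)) hab)
  have hedge : ∀ i : ZMod (k + 1), T (c i) (c (i + 1)) := by
    refine Fin.lastCases ?_ fun i => ?_
    · exact hlast.symm ▸ hT
    · exact (hsucc i).symm ▸ h.2 i i.2
  have hsum : ∑ i : ZMod (k + 1), descentSign (c i) (c (i + 1)) =
      ∑ a ∈ range k, descentSign (p a) (p (a + 1)) + descentSign (p k) (p 0) := by
    refine (Fin.sum_univ_castSucc (n := k) fun i : Fin (k + 1) =>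
      descentSign (c i) (c (i + 1 : Fin (k + 1)))).trans ?_
    rw [Finset.sum_range]
    simp only [hsucc, hlast]
    rfl
  have hcard : Nat.card {i : ZMod (k + 1) | c i < c (i + 1)} + 1 ≤
      Nat.card {i : ZMod (k + 1) | c (i + 1) < c i} := by
    by_contra hlt
    exact hA ⟨k + 1, k.succ_pos, c, hinj, hedge, by omega⟩
  have hcard' : (Nat.card {i : ZMod (k + 1) | c i < c (i + 1)} : ℝ) + 1 ≤
      Nat.card {i : ZMod (k + 1) | c (i + 1) < c i} := by exact_mod_cast hcard
  rw [← hsum, sum_descentSign]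
  linarith

/-- Absence of ascending cycles makes the difference constraints feasible: shortest simple path
lengths, with each edge shortened by `1 / (n + 1)`, form a solution. -/
lemma exists_satisfiesConstraints {n : ℕ} {T : Fin n → Fin n → Prop}
    (hA : ¬ HasAscendingCycle T) : ∃ x, SatisfiesConstraints T x := by
  set ε : ℝ := 1 / (n + 1) with hε
  have hε0 : 0 < ε := by positivity
  have hεn : ∀ k : ℕ, k < n → (k + 1) * ε < 1 := by
    intro k hk
    have : (k : ℝ) + 1 ≤ n := by exact_mod_cast hk
    rw [hε, mul_one_div, div_lt_one (by positivity)]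
    linarith
  let len (p : ℕ → Fin n) (k : ℕ) : ℝ := ∑ a ∈ range k, (descentSign (p a) (p (a + 1)) - ε)
  let S (v : Fin n) : Set ℝ := {r | ∃ p k, IsSimplePath T p k ∧ p k = v ∧ len p k = r}
  have hne : ∀ v, (S v).Nonempty := fun v =>
    ⟨0, fun _ => v, 0, ⟨by simp [Set.InjOn], by simp⟩, rfl, by simp [len]⟩
  have hbdd : ∀ v, BddBelow (S v) := by
    refine fun v => ⟨-(n * (1 + ε)), ?_⟩
    rintro _ ⟨p, k, hp, -, rfl⟩
    have h1 : ∑ _a ∈ range k, (-(1 + ε)) ≤ len p k :=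
      Finset.sum_le_sum fun a _ => by linarith [neg_one_le_descentSign (p a) (p (a + 1))]
    have h2 : (k : ℝ) ≤ n := by exact_mod_cast hp.lt.le
    simp only [sum_const, card_range, nsmul_eq_mul] at h1
    nlinarith
  refine ⟨fun v => sInf (S v), fun i j hij => ?_⟩
  suffices h : sInf (S j) - (descentSign i j - ε) ≤ sInf (S i) by
    change sInf (S j) - sInf (S i) < _
    linarith
  refine le_csInf (hne i) ?_
  rintro _ ⟨p, k, hp, rfl, rfl⟩
  by_cases hj : ∃ l ≤ k, p l = j
  · obtain ⟨l, hl, rfl⟩ := hj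
    obtain ⟨k, rfl⟩ := Nat.exists_eq_add_of_le hl
    have h1 := csInf_le (hbdd (p l)) ⟨p, l, hp.take hl, rfl, rfl⟩
    have h2 := hp.drop.one_le_sum_descentSign hA hij
    have h3 := hεn k hp.drop.lt
    have h4 : len p (l + k) = len p l +
        (∑ a ∈ range k, descentSign (p (l + a)) (p (l + (a + 1))) - k * ε) := by
      simp only [len, Finset.sum_range_add, Finset.sum_sub_distrib, sum_const, card_range,
        nsmul_eq_mul, Nat.add_assoc]
      push_cast
      ring
    simp only [Nat.add_zero] at h2
    linarith
  · push Not at hj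
    have h1 := csInf_le (hbdd j) ⟨_, k + 1, hp.update hj hij, by simp, rfl⟩
    have h2 : len (Function.update p (k + 1) j) (k + 1) =
        len p k + (descentSign (p k) j - ε) := by
      simp only [len]
      rw [Finset.sum_range_succ]
      congr 1
      · refine Finset.sum_congr rfl fun a ha => ?_
        have := Finset.mem_range.1 ha
        rw [Function.update_of_ne (by omega), Function.update_of_ne (by omega)]
      · simp
    linarith

lemma exists_sum_eq_zero_satisfiesConstraints {n : ℕ} (hn : 1 ≤ n) {T : Fin n → Fin n → Prop}
    (hA : ¬ HasAscendingCycle T) : ∃ x, ∑ i, x i = 0 ∧ SatisfiesConstraints T x := by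
  obtain ⟨x, hx⟩ := exists_satisfiesConstraints hA
  refine ⟨fun i => x i - (∑ j, x j) / n, ?_, fun i j hij => ?_⟩
  · have : (n : ℝ) ≠ 0 := by positivity
    simp only [Finset.sum_sub_distrib, sum_const, card_univ, Fintype.card_fin, nsmul_eq_mul]
    field_simp
    ring
  · simpa using hx i j hij

lemma convex_setOf_satisfiesConstraints {n : ℕ} (T : Fin n → Fin n → Prop) :
    Convex ℝ {x : Fin n → ℝ | ∑ i, x i = 0 ∧ SatisfiesConstraints T x} := by
  rintro x ⟨hx0, hx⟩ y ⟨hy0, hy⟩ a b ha hb hab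
  refine ⟨?_, fun i j hij => ?_⟩
  · simp [Finset.sum_add_distrib, ← Finset.mul_sum, hx0, hy0]
  · have h := convex_Iio (𝕜 := ℝ) (descentSign i j) (hx i j hij) (hy i j hij) ha hb hab
    simp only [Set.mem_Iio, smul_eq_mul] at h
    simp only [Pi.add_apply, Pi.smul_apply, smul_eq_mul]
    linarith

/-- The complement of the Linial arrangement in the hyperplane of vectors with sum zero. -/
def linialComplement (n : ℕ) : Set (Fin n → ℝ) :=
  {x | (∑ i, x i) = 0 ∧ ∀ i j : Fin n, i < j → x i - x j ≠ 1}

/-- The edges whose difference constraint is satisfied by `x`. -/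
def tournamentOf {n : ℕ} (x : Fin n → ℝ) (i j : Fin n) : Prop :=
  i ≠ j ∧ x j - x i < descentSign i j

lemma satisfiesConstraints_tournamentOf {n : ℕ} (x : Fin n → ℝ) :
    SatisfiesConstraints (tournamentOf x) x := fun _ _ h => h.2

lemma sub_ne_descentSign {n : ℕ} {x : Fin n → ℝ} (hx : x ∈ linialComplement n) {i j : Fin n}
    (hij : i ≠ j) : x j - x i ≠ descentSign i j := by
  rcases hij.lt_or_gt with h | h
  · rw [descentSign_of_lt h]
    exact fun h' => hx.2 i j h (by linarith)
  · rw [descentSign_swap, descentSign_of_lt h, neg_neg]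
    exact hx.2 j i h

lemma isTournament_tournamentOf {n : ℕ} {x : Fin n → ℝ} (hx : x ∈ linialComplement n) :
    IsTournament (tournamentOf x) := by
  refine ⟨fun i h => h.1 rfl, fun i j hij => ?_⟩
  have hne := sub_ne_descentSign hx hij
  simp only [tournamentOf, hij, hij.symm, ne_eq, not_false_eq_true, true_and, not_lt,
    descentSign_swap i j]
  exact ⟨fun h => by linarith, fun h => lt_of_le_of_ne (by linarith) hne⟩

lemma SatisfiesConstraints.mem_linialComplement {n : ℕ} {T : Fin n → Fin n → Prop}
    (hT : IsTournament T) {x : Fin n → ℝ} (h0 : ∑ i, x i = 0) (h : SatisfiesConstraints T x) :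
    x ∈ linialComplement n := by
  refine ⟨h0, fun i j hij heq => ?_⟩
  by_cases hji : T j i
  · have := h j i hji
    rw [descentSign_swap, descentSign_of_lt hij] at this
    linarith
  · have := h i j ((hT.2 i j hij.ne).2 hji)
    rw [descentSign_of_lt hij] at this
    linarith

lemma SatisfiesConstraints.tournamentOf_eq {n : ℕ} {T : Fin n → Fin n → Prop}
    (hT : IsTournament T) {x : Fin n → ℝ} (h : SatisfiesConstraints T x) :
    tournamentOf x = T := by
  ext i j
  constructor
  · rintro ⟨hij, hlt⟩
    refine (hT.2 i j hij).2 fun hji => ?_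
    have := h j i hji
    rw [descentSign_swap] at this
    linarith
  · exact fun hij => ⟨fun heq => hT.1 i (by rwa [← heq] at hij), h i j hij⟩

lemma isLocallyConstant_tournamentOf (n : ℕ) :
    IsLocallyConstant fun x : linialComplement n => tournamentOf x.1 := by
  refine (IsLocallyConstant.iff_eventually_eq _).2 fun x => ?_
  have h : ∀ i j, ∀ᶠ y : linialComplement n in nhds x,
      tournamentOf y.1 i j ↔ tournamentOf x.1 i j := by
    intro i j
    by_cases hij : i = j
    · simp [tournamentOf, hij]
    have hc : Continuous fun y : linialComplement n => y.1 j - y.1 i :=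
      ((continuous_apply j).comp continuous_subtype_val).sub
        ((continuous_apply i).comp continuous_subtype_val)
    rcases (sub_ne_descentSign x.2 hij).lt_or_gt with hlt | hlt
    · filter_upwards [hc.continuousAt.eventually_lt continuousAt_const hlt] with y hy
      simp [tournamentOf, hij, hy, hlt]
    · filter_upwards [continuousAt_const.eventually_lt hc.continuousAt hlt] with y hy
      simp [tournamentOf, hij, hy.not_gt, hlt.not_gt]
  filter_upwards [Filter.eventually_all.2 fun i => Filter.eventually_all.2 (h i)] with y hy
  ext i j
  exact hy i j

lemma connectedComponents_mk_eq_iff_tournamentOf_eq {n : ℕ} (x y : linialComplement n) :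
    (x : ConnectedComponents (linialComplement n)) = y ↔
      tournamentOf x.1 = tournamentOf y.1 := by
  rw [ConnectedComponents.coe_eq_coe']
  constructor
  · exact fun h => (isLocallyConstant_tournamentOf n).apply_eq_of_isPreconnected
      isPreconnected_connectedComponent h mem_connectedComponent
  · intro h
    have hT := isTournament_tournamentOf y.2
    let F : Set (linialComplement n) := {z | tournamentOf z.1 = tournamentOf y.1}
    have himage : Subtype.val '' F =
        {z | ∑ i, z i = 0 ∧ SatisfiesConstraints (tournamentOf y.1) z} := by
      ext z
      constructor
      · rintro ⟨z, hz, rfl⟩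
        exact ⟨z.2.1, hz ▸ satisfiesConstraints_tournamentOf z.1⟩
      · rintro ⟨h0, hz⟩
        exact ⟨⟨z, hz.mem_linialComplement hT h0⟩, hz.tournamentOf_eq hT, rfl⟩
    have hF : IsPreconnected F := by
      rw [← Topology.IsInducing.subtypeVal.isPreconnected_image, himage]
      exact (convex_setOf_satisfiesConstraints _).isPreconnected
    exact hF.subset_connectedComponent (x := y) rfl h

end

/-- The number of regions of the Linial arrangement `x_i - x_j = 1` (`1 ≤ i < j ≤ n`)
in `V_{n-1}` equals the number of semiacyclic tournaments on `{1, ..., n}`. -/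
theorem stmt13 (n : ℕ) (hn : 1 ≤ n) :
    numRegions {x : Fin n → ℝ | (∑ i, x i) = 0 ∧
        ∀ i j : Fin n, i < j → x i - x j ≠ 1} =
      Nat.card {T : Fin n → Fin n → Prop // IsTournament T ∧ ¬ HasAscendingCycle T} := by
  change Nat.card (ConnectedComponents (linialComplement n)) = _
  let f : ConnectedComponents (linialComplement n) →
      {T : Fin n → Fin n → Prop // IsTournament T ∧ ¬ HasAscendingCycle T} :=
    Quotient.lift (fun x => ⟨tournamentOf x.1, isTournament_tournamentOf x.2,
      (satisfiesConstraints_tournamentOf x.1).not_hasAscendingCycle⟩)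
      fun x y h => Subtype.ext ((connectedComponents_mk_eq_iff_tournamentOf_eq x y).1
        (Quotient.sound h))
  refine Nat.card_eq_of_bijective f ⟨?_, ?_⟩
  · rintro ⟨x⟩ ⟨y⟩ h
    exact (connectedComponents_mk_eq_iff_tournamentOf_eq x y).2 (congrArg Subtype.val h)
  · rintro ⟨T, hT, hA⟩
    obtain ⟨x, h0, hx⟩ := exists_sum_eq_zero_satisfiesConstraints hn hA
    exact ⟨ConnectedComponents.mk ⟨x, hx.mem_linialComplement hT h0⟩,
      Subtype.ext (hx.tournamentOf_eq hT)⟩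
end

section
/- Let a ≥ 1 be an integer. For every n ≥ 1, the number of regions of the truncated affine arrangement A^{aa}_{n-1} (given by the hyperplanes x_i − x_j = k for −a+1 ≤ k ≤ a−1 and 1 ≤ i < j ≤ n in V_{n-1}) equals an·(an − 1)·(an − 2)⋯(an − n + 2), i.e., the product ∏_{j=0}^{n−2} (an − j). -/
/-- A strictly increasing sequence (on indices below `n`) lying on none of the hyperplanes
`x j - x i = k` for `k ≤ m`. -/
def IsGenericUpTo (m n : ℕ) (x : ℕ → ℝ) : Prop :=
  ∀ j < n, ∀ i < j, x i < x j ∧ ∀ k : ℕ, k ≤ m → x j ≠ x i + k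

/-- The translates `x i + k` with `i < j` and `k ≤ m` that exceed `x j`. -/
noncomputable def translatesAbove (m : ℕ) (x : ℕ → ℝ) (j : ℕ) : Finset (ℕ × ℕ) :=
  (Finset.range j ×ˢ Finset.range (m + 1)).filter (fun p => x j < x p.1 + p.2)

/-- Sequences of natural numbers starting at most at `s` and growing by at most `m` each step. -/
def IsAdmissible (m : ℕ) : (n : ℕ) → ℕ → (Fin n → ℕ) → Prop
  | 0, _, _ => True
  | n + 1, s, c => c 0 ≤ s ∧ IsAdmissible m n (c 0 + m) (fun i => c i.succ)

theorem isAdmissible_iff (m n s : ℕ) (c : Fin n → ℕ) :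
    IsAdmissible m n s c ↔ (∀ h : 0 < n, c ⟨0, h⟩ ≤ s) ∧
      ∀ j (h : j + 1 < n), c ⟨j + 1, h⟩ ≤ c ⟨j, by omega⟩ + m := by
  induction n generalizing s with
  | zero => simp [IsAdmissible]
  | succ n ih =>
    rw [IsAdmissible, ih]
    constructor
    · rintro ⟨h0, h1, h2⟩
      refine ⟨fun _ => h0, fun j h => ?_⟩
      cases j with
      | zero => exact h1 (by omega)
      | succ j => exact h2 j (by omega)
    · rintro ⟨h0, h1⟩
      exact ⟨h0 (by omega), fun h => h1 0 (by omega), fun j h => h1 (j + 1) (by omega)⟩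

/-- An admissible sequence is its first term followed by an admissible sequence. -/
def admissibleSuccEquiv (m n s : ℕ) :
    {c : Fin (n + 1) → ℕ // IsAdmissible m (n + 1) s c} ≃
      Σ t : Fin (s + 1), {c : Fin n → ℕ // IsAdmissible m n (t + m) c} where
  toFun c := ⟨⟨c.1 0, Nat.lt_succ_of_le c.2.1⟩, ⟨fun i => c.1 i.succ, c.2.2⟩⟩
  invFun p := ⟨Fin.cons p.1.1 p.2.1, by
    refine ⟨?_, ?_⟩
    · simpa using Nat.le_of_lt_succ p.1.2
    · simpa using p.2.2⟩
  left_inv c := by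
    apply Subtype.ext
    exact Fin.cons_self_tail c.1
  right_inv p := by
    rcases p with ⟨t, c, hc⟩
    rfl

theorem finite_isAdmissible (m n s : ℕ) :
    Finite {c : Fin n → ℕ // IsAdmissible m n s c} := by
  induction n generalizing s with
  | zero => infer_instance
  | succ n ih =>
    have := fun t : Fin (s + 1) => ih (t + m)
    exact Finite.of_equiv _ (admissibleSuccEquiv m n s).symm

theorem sum_mul_descFactorial (m k s : ℕ) :
    ∑ t ∈ Finset.range (s + 1),
      (k + 2) * ((t + m + 1) * ((m + 1) * (k + 1) + (t + m)).descFactorial k) =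
    (s + 1) * ((m + 1) * (k + 2) + s).descFactorial (k + 1) := by
  induction s with
  | zero =>
    have h : (m + 1) * (k + 2) + 0 = ((m + 1) * (k + 1) + m) + 1 := by ring
    rw [h, Nat.succ_descFactorial_succ]
    simp
    ring
  | succ s ih =>
    rw [Finset.sum_range_succ, ih]
    obtain ⟨Y, hY⟩ : ∃ Y, Y = (m + 1) * (k + 1) + m + 1 + s := ⟨_, rfl⟩
    have h1 : (m + 1) * (k + 2) + s = Y := by rw [hY]; ring
    have h2 : (m + 1) * (k + 2) + (s + 1) = Y + 1 := by rw [hY]; ring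
    have h3 : (m + 1) * (k + 1) + (s + 1 + m) = Y := by rw [hY]; ring
    rw [h1, h2, h3, Nat.succ_descFactorial_succ, Nat.descFactorial_succ]
    have hk : k ≤ Y := by rw [hY]; nlinarith
    obtain ⟨d, hd⟩ := Nat.exists_eq_add_of_le hk
    have hdd : Y - k = d := by omega
    rw [hdd]
    have : (s + 1) * d + (k + 2) * (s + 1 + m + 1) = (s + 1 + 1) * (Y + 1) := by
      have : d + k = (m + 1) * (k + 1) + m + 1 + s := by omega
      rw [hY]
      nlinarith
    calc _ = ((s + 1) * d + (k + 2) * (s + 1 + m + 1)) * Y.descFactorial k := by ring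
      _ = _ := by rw [this]; ring

theorem factorial_mul_card_isAdmissible (m n s : ℕ) :
    (n + 1).factorial * Nat.card {c : Fin (n + 1) → ℕ // IsAdmissible m (n + 1) s c} =
      (s + 1) * ((m + 1) * (n + 1) + s).descFactorial n := by
  induction n generalizing s with
  | zero =>
    have h (t : ℕ) : Nat.card {c : Fin 0 → ℕ // IsAdmissible m 0 t c} = 1 := by
      rw [Nat.card_eq_one_iff_unique]
      exact ⟨inferInstance, ⟨⟨Fin.elim0, trivial⟩⟩⟩
    rw [Nat.card_congr (admissibleSuccEquiv m 0 s)]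
    have := fun t : Fin (s + 1) => finite_isAdmissible m 0 (t + m)
    rw [Nat.card_sigma]
    simp [h]
  | succ n ih =>
    rw [Nat.card_congr (admissibleSuccEquiv m (n + 1) s)]
    have := fun t : Fin (s + 1) => finite_isAdmissible m (n + 1) (t + m)
    rw [Nat.card_sigma, Nat.factorial_succ, mul_assoc, Finset.mul_sum]
    simp_rw [ih]
    rw [Finset.mul_sum, ← sum_mul_descFactorial]
    exact Fin.sum_univ_eq_sum_range (fun t =>
      (n + 2) * ((t + m + 1) * ((m + 1) * (n + 1) + (t + m)).descFactorial n)) (s + 1)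

theorem IsGenericUpTo.card_translatesAbove_succ_le {m n : ℕ} {x : ℕ → ℝ}
    (hx : IsGenericUpTo m n x) {j : ℕ} (hj : j + 1 < n) :
    (translatesAbove m x (j + 1)).card ≤ (translatesAbove m x j).card + m := by
  have hsub : translatesAbove m x (j + 1) ⊆
      translatesAbove m x j ∪ ({j} ×ˢ Finset.Icc 1 m) := by
    rintro ⟨i, k⟩ h
    have hlt := (hx (j + 1) hj j (by omega)).1
    simp only [translatesAbove, Finset.mem_filter, Finset.mem_product, Finset.mem_range,
      Finset.mem_union, Finset.mem_singleton, Finset.mem_Icc] at h ⊢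
    obtain ⟨⟨hi, hk⟩, h⟩ := h
    rcases Nat.lt_or_ge i j with hij | hij
    · exact Or.inl ⟨⟨hij, hk⟩, by linarith⟩
    · obtain rfl : i = j := by omega
      refine Or.inr ⟨rfl, ?_, by omega⟩
      by_contra hk0
      obtain rfl : k = 0 := by omega
      simp at h
      linarith
  calc _ ≤ _ := Finset.card_le_card hsub
    _ ≤ _ := Finset.card_union_le _ _
    _ = _ := by simp

theorem exists_gt_card_filter_lt_eq (T : Finset ℝ) (b : ℝ) (hb : ∀ v ∈ T, b < v) (c : ℕ)
    (hc : c ≤ T.card) : ∃ t, b < t ∧ t ∉ T ∧ (T.filter (fun v => t < v)).card = c := by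
  induction T using Finset.induction_on_min generalizing b with
  | empty => exact ⟨b + 1, by linarith, by simp, by simp at hc ⊢; omega⟩
  | insert a T ha ih =>
    have haT : a ∉ T := fun h => lt_irrefl _ (ha a h)
    have hba : b < a := hb a (by simp)
    rw [Finset.card_insert_of_notMem haT] at hc
    rcases Nat.lt_or_ge T.card c with h | h
    · refine ⟨(b + a) / 2, by linarith, fun hm => ?_, ?_⟩
      · rcases Finset.mem_insert.1 hm with h' | h'
        · linarith
        · linarith [ha _ h']
      · rw [Finset.filter_true_of_mem, Finset.card_insert_of_notMem haT]
        · omega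
        · intro v hv
          rcases Finset.mem_insert.1 hv with h' | h'
          · linarith
          · linarith [ha _ h']
    · obtain ⟨t, h1, h2, h3⟩ := ih a ha h
      refine ⟨t, by linarith, fun hm => ?_, ?_⟩
      · rcases Finset.mem_insert.1 hm with h' | h'
        · linarith
        · exact h2 h'
      · rw [Finset.filter_insert, if_neg (by linarith), h3]

theorem IsGenericUpTo.injOn {m n : ℕ} {x : ℕ → ℝ} (hx : IsGenericUpTo m n x) :
    Set.InjOn (fun p : ℕ × ℕ => x p.1 + p.2)
      (Finset.range n ×ˢ Finset.range (m + 1) : Finset (ℕ × ℕ)) := by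
  have key : ∀ i j k l : ℕ, i < j → j < n → k ≤ m → x i + k = x j + l → False := by
    intro i j k l hij hj hk h
    obtain ⟨h1, h2⟩ := hx j hj i hij
    have hlk : (l : ℝ) < k := by linarith
    have hlk' : l ≤ k := by exact_mod_cast hlk.le
    apply h2 (k - l) (by omega)
    push_cast [hlk']
    linarith
  rintro ⟨i, k⟩ hp ⟨j, l⟩ hq h
  simp only [Finset.coe_product, Finset.coe_range, Set.mem_prod, Set.mem_Iio] at hp hq h
  rcases lt_trichotomy i j with hij | rfl | hij
  · exact (key i j k l hij hq.1 (by omega) h).elim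
  · simpa using h
  · exact (key j i l k hij hp.1 (by omega) h.symm).elim

theorem IsGenericUpTo.exists_extension {m n : ℕ} {x : ℕ → ℝ} (hx : IsGenericUpTo m (n + 1) x)
    {c : ℕ} (hc : c ≤ (translatesAbove m x n).card + m) :
    ∃ t, x n < t ∧ (∀ i ≤ n, ∀ k : ℕ, k ≤ m → t ≠ x i + k) ∧
      ((Finset.range (n + 1) ×ˢ Finset.range (m + 1)).filter
        (fun p => t < x p.1 + p.2)).card = c := by
  classical
  set D := Finset.range (n + 1) ×ˢ Finset.range (m + 1) with hD
  set val : ℕ × ℕ → ℝ := fun p => x p.1 + p.2 with hval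
  set G := D.filter (fun p => x n < val p) with hG
  have hGcard : G.card = (translatesAbove m x n).card + m := by
    have : G = translatesAbove m x n ∪ ({n} ×ˢ Finset.Icc 1 m) := by
      ext ⟨i, k⟩
      simp only [hG, hD, hval, translatesAbove, Finset.mem_filter, Finset.mem_product,
        Finset.mem_range, Finset.mem_union, Finset.mem_singleton, Finset.mem_Icc]
      constructor
      · rintro ⟨⟨hi, hk⟩, h⟩
        rcases Nat.lt_or_ge i n with hin | hin
        · exact Or.inl ⟨⟨hin, hk⟩, h⟩
        · obtain rfl : i = n := by omega
          have : (0 : ℝ) < k := by linarith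
          have : 0 < k := by exact_mod_cast this
          exact Or.inr ⟨rfl, by omega, by omega⟩
      · rintro (⟨⟨hi, hk⟩, h⟩ | ⟨rfl, hk, hk'⟩)
        · exact ⟨⟨by omega, hk⟩, h⟩
        · have : (1 : ℝ) ≤ k := by exact_mod_cast hk
          exact ⟨⟨by omega, by omega⟩, by linarith⟩
    rw [this, Finset.card_union_of_disjoint]
    · simp
    · rw [Finset.disjoint_left]
      rintro ⟨i, k⟩ h h'
      simp only [translatesAbove, Finset.mem_filter, Finset.mem_product, Finset.mem_range,
        Finset.mem_singleton, Finset.mem_Icc] at h h'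
      omega
  have hinj := hx.injOn
  have hGD : (G : Set (ℕ × ℕ)) ⊆ D := by exact_mod_cast Finset.filter_subset _ _
  obtain ⟨t, ht, htT, htc⟩ := exists_gt_card_filter_lt_eq (G.image val) (x n)
    (by
      intro v hv
      obtain ⟨p, hp, rfl⟩ := Finset.mem_image.1 hv
      exact (Finset.mem_filter.1 hp).2) c
    (by rw [Finset.card_image_of_injOn (hinj.mono hGD), hGcard]; exact hc)
  refine ⟨t, ht, fun i hi k hk h => htT ?_, ?_⟩
  · refine Finset.mem_image.2 ⟨(i, k), ?_, h.symm⟩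
    simp only [hG, hD, hval, Finset.mem_filter, Finset.mem_product, Finset.mem_range]
    exact ⟨⟨by omega, by omega⟩, h ▸ ht⟩
  · rw [← htc, Finset.filter_image, Finset.card_image_of_injOn
      (hinj.mono (subset_trans (by exact_mod_cast Finset.filter_subset _ _) hGD)), hG,
      Finset.filter_filter]
    congr 1
    apply Finset.filter_congr
    intro p _
    exact ⟨fun h => ⟨ht.trans h, h⟩, fun h => h.2⟩

theorem translatesAbove_congr {m : ℕ} {x y : ℕ → ℝ} {j : ℕ} (h : ∀ i ≤ j, x i = y i) :
    translatesAbove m x j = translatesAbove m y j := by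
  apply Finset.filter_congr
  rintro ⟨i, k⟩ hp
  simp only [Finset.mem_product, Finset.mem_range] at hp
  rw [h j le_rfl, h i hp.1.le]

theorem exists_isGenericUpTo (m : ℕ) (c : ℕ → ℕ) (n : ℕ) (h0 : 0 < n → c 0 = 0)
    (hc : ∀ j, j + 1 < n → c (j + 1) ≤ c j + m) :
    ∃ x, IsGenericUpTo m n x ∧ ∀ j < n, (translatesAbove m x j).card = c j := by
  induction n with
  | zero => exact ⟨0, fun j hj => absurd hj (by omega), fun j hj => absurd hj (by omega)⟩
  | succ n ih =>
    obtain ⟨x, hx, hxc⟩ := ih (fun _ => h0 (by omega)) (fun j hj => hc j (by omega))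
    obtain ⟨t, ht1, ht2, ht3⟩ : ∃ t, (∀ i < n, x i < t) ∧
        (∀ i < n, ∀ k : ℕ, k ≤ m → t ≠ x i + k) ∧
        ((Finset.range n ×ˢ Finset.range (m + 1)).filter
          (fun p => t < x p.1 + p.2)).card = c n := by
      cases n with
      | zero => exact ⟨0, by simp, by simp, by simp [h0]⟩
      | succ n =>
        obtain ⟨t, h1, h2, h3⟩ := hx.exists_extension (c := c (n + 1))
          (by rw [hxc n (by omega)]; exact hc n (by omega))
        refine ⟨t, fun i hi => ?_, fun i hi => h2 i (by omega), h3⟩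
        rcases Nat.lt_or_ge i n with hin | hin
        · exact (hx n (by omega) i hin).1.trans h1
        · obtain rfl : i = n := by omega
          exact h1
    have hu : ∀ i < n, Function.update x n t i = x i := fun i hi =>
      Function.update_of_ne (by omega) _ _
    refine ⟨Function.update x n t, fun j hj i hi => ?_, fun j hj => ?_⟩
    · rw [hu i (by omega)]
      rcases Nat.lt_or_ge j n with hjn | hjn
      · rw [hu j hjn]
        exact hx j hjn i hi
      · obtain rfl : j = n := by omega
        rw [Function.update_self]
        exact ⟨ht1 i hi, ht2 i hi⟩
    · rcases Nat.lt_or_ge j n with hjn | hjn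
      · rw [← hxc j hjn, translatesAbove_congr fun i hi => hu i (by omega)]
      · obtain rfl : j = n := by omega
        rw [← ht3, translatesAbove]
        congr 1
        apply Finset.filter_congr
        rintro ⟨i, k⟩ hp
        simp only [Finset.mem_product, Finset.mem_range] at hp
        rw [Function.update_self, hu i hp.1]

theorem IsGenericUpTo.lt_add_iff_of_card_eq {m n : ℕ} {x y : ℕ → ℝ}
    (hx : IsGenericUpTo m n x) (hy : IsGenericUpTo m n y)
    (h : ∀ j < n, (translatesAbove m x j).card = (translatesAbove m y j).card) :
    ∀ j < n, ∀ i < j, ∀ k : ℕ, k ≤ m → (x j < x i + k ↔ y j < y i + k) := by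
  intro j
  induction j using Nat.strong_induction_on with
  | _ j ih =>
  intro hj
  have order : ∀ i < j, ∀ i' < j, ∀ k k' : ℕ, k ≤ m → k' ≤ m →
      x i + k < x i' + k' → y i + k < y i' + k' := by
    intro i hi i' hi' k k' hk hk' hlt
    rcases lt_trichotomy i i' with hii | rfl | hii
    · have hyy := (hy i' (by omega) i hii)
      rcases Nat.lt_or_ge k' k with hkk | hkk
      · have h1 := (ih i' hi' (by omega) i hii (k - k') (by omega)).not
        have h2 := hyy.2 (k - k') (by omega)
        push_cast [hkk.le] at h1 h2
        have h3 := h1.1 (by linarith)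
        rcases lt_or_eq_of_le (not_lt.1 h3) with h4 | h4
        · linarith
        · exact absurd h4.symm h2
      · have : (k : ℝ) ≤ k' := by exact_mod_cast hkk
        linarith [hyy.1]
    · linarith
    · have hxx := (hx i (by omega) i' hii).1
      have hkk : (k : ℝ) < k' := by linarith
      have hkk' : k < k' := by exact_mod_cast hkk
      have h1 := ih i hi (by omega) i' hii (k' - k) (by omega)
      push_cast [hkk'.le] at h1
      linarith [h1.1 (by linarith)]
  have hsets : translatesAbove m x j = translatesAbove m y j := by
    by_cases hs : translatesAbove m x j ⊆ translatesAbove m y j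
    · exact Finset.eq_of_subset_of_card_le hs (h j hj).ge
    · obtain ⟨⟨i, k⟩, hp, hp'⟩ := Finset.not_subset.1 hs
      refine (Finset.eq_of_subset_of_card_le ?_ (h j hj).le).symm
      rintro ⟨i', k'⟩ hq
      by_contra hq'
      simp only [translatesAbove, Finset.mem_filter, Finset.mem_product, Finset.mem_range,
        not_and, not_lt] at hp hp' hq hq'
      have h1 := hp' hp.1
      have h2 := hq' hq.1
      have h3 := order i' hq.1.1 i hp.1.1 k' k (by omega) (by omega) (by linarith [hp.2])
      linarith [hq.2]
  intro i hi k hk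
  have hmem := Finset.ext_iff.1 hsets (i, k)
  simp only [translatesAbove, Finset.mem_filter, Finset.mem_product, Finset.mem_range] at hmem
  have hik : i < j ∧ k < m + 1 := ⟨hi, by omega⟩
  simpa [hik] using hmem

/-- The complement in `V_{n-1}` of the hyperplanes `x i - x j = k` with `|k| ≤ m`. -/
def catalanComplement (m n : ℕ) : Set (Fin n → ℝ) :=
  {x | ∑ i, x i = 0 ∧ ∀ i j, i ≠ j → ∀ k : ℕ, k ≤ m → x i ≠ x j + k}

/-- Two points lie on the same side of each hyperplane `x i - x j = k` with `k ≤ m`. -/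
def SameSide (m : ℕ) {n : ℕ} (x y : Fin n → ℝ) : Prop :=
  ∀ i j, i ≠ j → ∀ k : ℕ, k ≤ m → (x i < x j + k ↔ y i < y j + k)

theorem mk_eq_mk_iff_sameSide {m n : ℕ} (x y : catalanComplement m n) :
    (x : ConnectedComponents (catalanComplement m n)) = y ↔ SameSide m x.1 y.1 := by
  rw [ConnectedComponents.coe_eq_coe]
  constructor
  · intro hxy i j hij k hk
    have hcont (l : Fin n) : Continuous fun z : catalanComplement m n => z.1 l :=
      (continuous_apply l).comp continuous_subtype_val
    have hclopen : IsClopen {z : catalanComplement m n | z.1 i < z.1 j + k} := by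
      constructor
      · have : {z : catalanComplement m n | z.1 i < z.1 j + k} =
            {z : catalanComplement m n | z.1 i ≤ z.1 j + k} := by
          ext z
          exact ⟨fun h => LT.lt.le (show z.1 i < z.1 j + k from h), fun h => lt_of_le_of_ne h (z.2.2 i j hij k hk)⟩
        rw [this]
        exact isClosed_le (hcont i) ((hcont j).add continuous_const)
      · exact isOpen_lt (hcont i) ((hcont j).add continuous_const)
    constructor
    · intro h
      exact hclopen.connectedComponent_subset (x := x) h (hxy ▸ mem_connectedComponent)
    · intro h
      exact hclopen.connectedComponent_subset (x := y) h (hxy ▸ mem_connectedComponent)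
  · intro hs
    apply connectedComponent_eq
    let S : Set (catalanComplement m n) := {z | SameSide m x.1 z.1}
    have hS : IsPreconnected S := by
      rw [← Topology.IsInducing.subtypeVal.isPreconnected_image]
      apply Convex.isPreconnected
      rintro _ ⟨u, hu, rfl⟩ _ ⟨v, hv, rfl⟩ p q hp hq hpq
      have key : ∀ i j, i ≠ j → ∀ k : ℕ, k ≤ m →
          ((x.1 i < x.1 j + k ∧ (p • u.1 + q • v.1) i < (p • u.1 + q • v.1) j + k) ∨
          (¬ x.1 i < x.1 j + k ∧ (p • u.1 + q • v.1) j + k < (p • u.1 + q • v.1) i)) := by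
        intro i j hij k hk
        simp only [Pi.add_apply, Pi.smul_apply, smul_eq_mul]
        have h1 := hu i j hij k hk
        have h2 := hv i j hij k hk
        obtain rfl : q = 1 - p := by linarith
        by_cases hxx : x.1 i < x.1 j + k
        · refine Or.inl ⟨hxx, ?_⟩
          have h1 := h1.1 hxx
          have h2 := h2.1 hxx
          rcases hp.eq_or_lt with rfl | hp'
          · linarith
          · nlinarith
        · refine Or.inr ⟨hxx, ?_⟩
          have h1 := lt_of_le_of_ne (not_lt.1 (h1.not.1 hxx)) (u.2.2 i j hij k hk).symm
          have h2 := lt_of_le_of_ne (not_lt.1 (h2.not.1 hxx)) (v.2.2 i j hij k hk).symm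
          rcases hp.eq_or_lt with rfl | hp'
          · linarith
          · nlinarith
      refine ⟨⟨p • u.1 + q • v.1, ?_, ?_⟩, ?_, rfl⟩
      · simp [Finset.sum_add_distrib, ← Finset.mul_sum, u.2.1, v.2.1]
      · intro i j hij k hk
        rcases key i j hij k hk with h | h
        · exact h.2.ne
        · exact h.2.ne'
      · intro i j hij k hk
        rcases key i j hij k hk with h | h
        · exact iff_of_true h.1 h.2
        · exact iff_of_false h.1 (not_lt.2 h.2.le)
    exact hS.subset_connectedComponent (x := x) (fun i j _ k _ => Iff.rfl) hs

/-- Extension of a finite sequence by zero. -/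
noncomputable def extendZero {n : ℕ} (x : Fin n → ℝ) (i : ℕ) : ℝ :=
  if h : i < n then x ⟨i, h⟩ else 0

theorem extendZero_of_lt {n : ℕ} (x : Fin n → ℝ) {i : ℕ} (h : i < n) :
    extendZero x i = x ⟨i, h⟩ := dif_pos h

theorem isGenericUpTo_extendZero {m n : ℕ} {x : Fin n → ℝ} (hx : x ∈ catalanComplement m n)
    {σ : Equiv.Perm (Fin n)} (hσ : StrictMono (x ∘ σ)) :
    IsGenericUpTo m n (extendZero (x ∘ σ)) := by
  intro j hj i hi
  rw [extendZero_of_lt _ hj, extendZero_of_lt _ (hi.trans hj)]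
  refine ⟨hσ hi, hx.2 _ _ fun h => ?_⟩
  have := congrArg Fin.val (σ.injective h)
  simp at this
  omega

theorem SameSide.card_translatesAbove_eq {m n : ℕ} {x y : Fin n → ℝ} (h : SameSide m x y)
    (σ : Equiv.Perm (Fin n)) {j : ℕ} (hj : j < n) :
    (translatesAbove m (extendZero (x ∘ σ)) j).card =
      (translatesAbove m (extendZero (y ∘ σ)) j).card := by
  congr 1
  apply Finset.filter_congr
  rintro ⟨i, k⟩ hp
  simp only [Finset.mem_product, Finset.mem_range] at hp
  simp only [extendZero_of_lt _ hj, extendZero_of_lt _ (hp.1.trans hj)]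
  refine h _ _ (fun he => ?_) k (by omega)
  have := congrArg Fin.val (σ.injective he)
  simp at this
  omega

theorem sameSide_of_card_eq {m n : ℕ} {x y : Fin n → ℝ} (hx : x ∈ catalanComplement m n)
    (hy : y ∈ catalanComplement m n) {σ : Equiv.Perm (Fin n)} (hxσ : StrictMono (x ∘ σ))
    (hyσ : StrictMono (y ∘ σ))
    (h : ∀ j < n, (translatesAbove m (extendZero (x ∘ σ)) j).card =
      (translatesAbove m (extendZero (y ∘ σ)) j).card) : SameSide m x y := by
  have key := (isGenericUpTo_extendZero hx hxσ).lt_add_iff_of_card_eq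
    (isGenericUpTo_extendZero hy hyσ) h
  intro i j hij k hk
  obtain ⟨i, rfl⟩ := σ.surjective i
  obtain ⟨j, rfl⟩ := σ.surjective j
  rcases lt_trichotomy i j with h | h | h
  · have h1 : x (σ i) < x (σ j) := hxσ h
    have h2 : y (σ i) < y (σ j) := hyσ h
    have : (0 : ℝ) ≤ k := k.cast_nonneg
    exact iff_of_true (by linarith) (by linarith)
  · exact absurd (congrArg σ h) hij
  · have := key i i.2 j h k hk
    rwa [extendZero_of_lt _ i.2, extendZero_of_lt _ j.2, extendZero_of_lt _ i.2,
      extendZero_of_lt _ j.2] at this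

theorem exists_mem_catalanComplement {m n : ℕ} (σ : Equiv.Perm (Fin n)) {c : Fin n → ℕ}
    (hc : IsAdmissible m n 0 c) :
    ∃ x ∈ catalanComplement m n, StrictMono (x ∘ σ) ∧
      ∀ j : Fin n, (translatesAbove m (extendZero (x ∘ σ)) j).card = c j := by
  rw [isAdmissible_iff] at hc
  obtain ⟨z, hz, hzc⟩ := exists_isGenericUpTo m (fun j => if h : j < n then c ⟨j, h⟩ else 0) n
    (fun h => by simpa [h] using hc.1 h)
    (fun j hj => by simpa [hj, (show j < n by omega)] using hc.2 j hj)
  set M : ℝ := (∑ i : Fin n, z i) / n with hM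
  set x : Fin n → ℝ := fun i => z (σ.symm i) - M with hxdef
  have hxσ : ∀ i : Fin n, (x ∘ σ) i = z i - M := fun i => by simp [hxdef]
  refine ⟨x, ⟨?_, ?_⟩, ?_, ?_⟩
  · rw [← Equiv.sum_comp σ x]
    change ∑ i, (x ∘ σ) i = 0
    simp_rw [hxσ]
    rw [Finset.sum_sub_distrib]
    rcases Nat.eq_zero_or_pos n with rfl | hn
    · simp
    · have : (n : ℝ) ≠ 0 := by positivity
      simp [hM]
      field_simp
      simp
  · intro i j hij k hk h
    simp only [hxdef] at h
    have hne : σ.symm i ≠ σ.symm j := fun h => hij (σ.symm.injective h)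
    rcases lt_or_gt_of_ne hne with hlt | hlt
    · have := (hz _ (σ.symm j).2 _ hlt).1
      have : (0 : ℝ) ≤ k := k.cast_nonneg
      linarith
    · exact (hz _ (σ.symm i).2 _ hlt).2 k hk (by linarith)
  · intro i j hij
    rw [hxσ, hxσ]
    linarith [(hz j j.2 i hij).1]
  · intro j
    have := hzc j j.2
    simp only [j.2, dite_true] at this
    rw [← this]
    congr 1
    apply Finset.filter_congr
    rintro ⟨i, k⟩ hp
    simp only [Finset.mem_product, Finset.mem_range] at hp
    simp only [extendZero_of_lt _ j.2, extendZero_of_lt _ (hp.1.trans j.2), hxσ]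
    constructor <;> intro h <;> linarith

theorem eq_of_strictMono_comp {n : ℕ} {x : Fin n → ℝ} {σ τ : Equiv.Perm (Fin n)}
    (hσ : StrictMono (x ∘ σ)) (hτ : StrictMono (x ∘ τ)) : σ = τ := by
  have h : x ∘ σ = x ∘ τ := Tuple.unique_monotone hσ.monotone hτ.monotone
  have hinj : Function.Injective x := by
    have := hσ.injective
    rwa [σ.injective_comp] at this
  ext i
  exact congrArg Fin.val (hinj (congrFun h i))

theorem card_connectedComponents_catalanComplement (m n : ℕ) :
    Nat.card (ConnectedComponents (catalanComplement m n)) =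
      n.factorial * Nat.card {c : Fin n → ℕ // IsAdmissible m n 0 c} := by
  choose x hx hmono hcard using fun p : Equiv.Perm (Fin n) ×
    {c : Fin n → ℕ // IsAdmissible m n 0 c} => exists_mem_catalanComplement p.1 p.2.2
  have hbij : Function.Bijective (fun p =>
      ((⟨x p, hx p⟩ : catalanComplement m n) :
        ConnectedComponents (catalanComplement m n))) := by
    constructor
    · rintro p q hpq
      have hs : SameSide m (x p) (x q) := (mk_eq_mk_iff_sameSide _ _).1 hpq
      have hσ : p.1 = q.1 := by
        refine eq_of_strictMono_comp (x := x q) (fun i j hij => ?_) (hmono q)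
        have h := (hs (p.1 i) (p.1 j) (p.1.injective.ne hij.ne) 0 m.zero_le).1
          (by simpa using hmono p hij)
        simpa using h
      refine Prod.ext hσ (Subtype.ext (funext fun j => ?_))
      rw [← hcard p j, ← hcard q j, ← hσ]
      exact hs.card_translatesAbove_eq _ j.2
    · intro C
      obtain ⟨y, rfl⟩ := ConnectedComponents.surjective_coe C
      have hinj : Function.Injective y.1 := by
        intro i j h
        by_contra hij
        exact y.2.2 i j hij 0 m.zero_le (by simpa using h)
      have hy : StrictMono (y.1 ∘ Tuple.sort y.1) :=
        (Tuple.monotone_sort y.1).strictMono_of_injective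
          (hinj.comp (Tuple.sort y.1).injective)
      have hgen := isGenericUpTo_extendZero y.2 hy
      refine ⟨⟨Tuple.sort y.1, fun j =>
        (translatesAbove m (extendZero (y.1 ∘ Tuple.sort y.1)) j).card, ?_⟩, ?_⟩
      · rw [isAdmissible_iff]
        exact ⟨fun _ => by simp [translatesAbove],
          fun j hj => hgen.card_translatesAbove_succ_le hj⟩
      · refine (mk_eq_mk_iff_sameSide _ _).2 (sameSide_of_card_eq (hx _) y.2 (hmono _) hy ?_)
        intro j hj
        exact hcard _ ⟨j, hj⟩
  rw [← Nat.card_congr (Equiv.ofBijective _ hbij), Nat.card_prod, Nat.card_perm, Nat.card_fin]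

theorem setOf_eq_catalanComplement (m n : ℕ) :
    {x : Fin n → ℝ | (∑ i, x i) = 0 ∧
        ∀ i j : Fin n, i < j → ∀ k : ℤ,
          -((m + 1 : ℕ) : ℤ) + 1 ≤ k → k ≤ ((m + 1 : ℕ) : ℤ) - 1 → x i - x j ≠ (k : ℝ)} =
      catalanComplement m n := by
  ext x
  refine and_congr_right fun _ => ⟨fun h i j hij k hk he => ?_, fun h i j hij k h1 h2 he => ?_⟩
  · rcases lt_or_gt_of_ne hij with hlt | hlt
    · exact h i j hlt k (by omega) (by omega) (by push_cast; linarith)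
    · exact h j i hlt (-k) (by omega) (by omega) (by push_cast; linarith)
  · obtain ⟨l, rfl | rfl⟩ := k.eq_nat_or_neg
    · exact h i j hij.ne l (by omega) (by push_cast at he; linarith)
    · exact h j i hij.ne' l (by omega) (by push_cast at he; linarith)

/-- The number of regions of the balanced truncated affine arrangement `A^{aa}_{n-1}`
(hyperplanes `x_i - x_j = -a+1, ..., a-1` for `i < j` in `V_{n-1}`) equals
`an(an-1)⋯(an-n+2)`. -/
theorem stmt16 (a n : ℕ) (ha : 1 ≤ a) (hn : 1 ≤ n) :
    numRegions {x : Fin n → ℝ | (∑ i, x i) = 0 ∧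
        ∀ i j : Fin n, i < j → ∀ k : ℤ,
          -(a : ℤ) + 1 ≤ k → k ≤ (a : ℤ) - 1 → x i - x j ≠ (k : ℝ)} =
      ∏ j ∈ Finset.range (n - 1), (a * n - j) := by
  obtain ⟨m, rfl⟩ := Nat.exists_eq_add_of_le' ha
  obtain ⟨n, rfl⟩ := Nat.exists_eq_add_of_le' hn
  rw [setOf_eq_catalanComplement, numRegions, card_connectedComponents_catalanComplement,
    factorial_mul_card_isAdmissible, Nat.descFactorial_eq_prod_range]
  simp
end
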